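/- arXiv:1602.05972 — 3 statements merged into one kernel-verified Lean document; each statement's English description precedes it below -/
import Mathlib

section
/- (Three-color Regularity Lemma) For every ε > 0 and every integer k₀ > 0 there is a positive integer K₀ = K₀(ε, k₀) such that for every n ≥ K₀ the following holds. For all graphs G₁, G₂ and G₃ on the same vertex set V with |V| = n, there is a partition of V into k+1 classes V₀, V₁, ..., V_k such that: (i) k₀ ≤ k ≤ K₀; (ii) |V₁| = |V₂| = ... = |V_k|; (iii) |V₀| < εn; and (iv) apart from at most ε·(k choose 2) exceptional pairs, each pair {V_i, V_j} with 1 ≤ i < j ≤ k is ε-regular in G₁, in G₂, and in G₃ simultaneously. -/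
/-- The density of `G` between the (disjoint) vertex sets `A` and `B`:
`e_G(A,B) / (|A|·|B|)`. -/
noncomputable def dens {V : Type*} (G : SimpleGraph V) (A B : Finset V) : ℝ :=
  ((Set.ncard {p : V × V | p.1 ∈ A ∧ p.2 ∈ B ∧ G.Adj p.1 p.2}) : ℝ) /
    ((A.card : ℝ) * (B.card : ℝ))

/-- The pair `(A,B)` is ε-regular in `G`: for all `X ⊆ A`, `Y ⊆ B` with `|X| > ε|A|` and
`|Y| > ε|B|` one has `|d(X,Y) − d(A,B)| < ε`. -/
def IsRegPair {V : Type*} (G : SimpleGraph V) (ε : ℝ) (A B : Finset V) : Prop :=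
  ∀ X ⊆ A, ∀ Y ⊆ B, ε * (A.card : ℝ) < (X.card : ℝ) → ε * (B.card : ℝ) < (Y.card : ℝ) →
    |dens G X Y - dens G A B| < ε

section Energy

open Finset

variable {α : Type*} [DecidableEq α] (G : SimpleGraph α) [DecidableRel G.Adj]

/-- Partitioning two sets into `N` pieces each of size `m` or `m + 1` almost does not decrease the
mean square density between them. -/
theorem SimpleGraph.edgeDensity_sq_sub_le_of_finpartition {U V : Finset α} (P : Finpartition U)
    (Q : Finpartition V) {N m : ℕ} (hN : 0 < N) (hm : 0 < m) (hPN : #P.parts = N)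
    (hQN : #Q.parts = N) (hP : ∀ A ∈ P.parts, m ≤ #A ∧ #A ≤ m + 1)
    (hQ : ∀ A ∈ Q.parts, m ≤ #A ∧ #A ≤ m + 1) :
    G.edgeDensity U V ^ 2 - 4 / m ≤
      (∑ AB ∈ P.parts ×ˢ Q.parts, G.edgeDensity AB.1 AB.2 ^ 2) / (N : ℚ) ^ 2 := by
  have hU : N * m ≤ #U := by
    rw [← P.sum_card_parts, ← hPN, ← smul_eq_mul]
    exact card_nsmul_le_sum _ _ _ fun A hA => (hP A hA).1
  have hV : N * m ≤ #V := by
    rw [← Q.sum_card_parts, ← hQN, ← smul_eq_mul]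
    exact card_nsmul_le_sum _ _ _ fun A hA => (hQ A hA).1
  set x := G.edgeDensity U V with hx
  have hx0 : 0 ≤ x := G.edgeDensity_nonneg _ _
  have hx1 : x ≤ 1 := G.edgeDensity_le_one _ _
  set S := ∑ AB ∈ P.parts ×ˢ Q.parts, G.edgeDensity AB.1 AB.2 with hS
  set T := ∑ AB ∈ P.parts ×ˢ Q.parts, G.edgeDensity AB.1 AB.2 ^ 2
  have hS0 : 0 ≤ S := sum_nonneg fun _ _ => G.edgeDensity_nonneg _ _
  have hN' : (0 : ℚ) < N := by exact_mod_cast hN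
  have hm' : (0 : ℚ) < m := by exact_mod_cast hm
  have hedges : (#(G.interedges U V) : ℚ) ≤ (m + 1) ^ 2 * S := by
    rw [SimpleGraph.interedges, Rel.card_interedges_finpartition G.Adj P Q, hS, mul_sum]
    push_cast
    refine sum_le_sum fun AB hAB => ?_
    obtain ⟨hA, hB⟩ := mem_product.1 hAB
    have hA' : (0 : ℚ) < #AB.1 := by exact_mod_cast hm.trans_le (hP _ hA).1
    have hB' : (0 : ℚ) < #AB.2 := by exact_mod_cast hm.trans_le (hQ _ hB).1
    have hA'' : (#AB.1 : ℚ) ≤ m + 1 := by exact_mod_cast (hP _ hA).2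
    have hB'' : (#AB.2 : ℚ) ≤ m + 1 := by exact_mod_cast (hQ _ hB).2
    calc (#(Rel.interedges G.Adj AB.1 AB.2) : ℚ)
        = (#AB.1 * #AB.2) * G.edgeDensity AB.1 AB.2 := by
          rw [SimpleGraph.edgeDensity_def, SimpleGraph.interedges]; field_simp
      _ ≤ ((m + 1) * (m + 1)) * G.edgeDensity AB.1 AB.2 := by
          gcongr
          exact G.edgeDensity_nonneg _ _
      _ = _ := by ring
  have hlower : ((N : ℚ) * m) ^ 2 * x ≤ #(G.interedges U V) := by
    have hU' : (N : ℚ) * m ≤ #U := by exact_mod_cast hU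
    have hV' : (N : ℚ) * m ≤ #V := by exact_mod_cast hV
    have hNm : (0 : ℚ) < N * m := by positivity
    have hU0 := hNm.trans_le hU'
    have hV0 := hNm.trans_le hV'
    calc ((N : ℚ) * m) ^ 2 * x = ((N * m) * (N * m)) * x := by ring
      _ ≤ (#U * #V) * x := by gcongr
      _ = _ := by rw [hx, SimpleGraph.edgeDensity_def]; field_simp
  have hCS : S ^ 2 ≤ (N : ℚ) ^ 2 * T := by
    have := sq_sum_le_card_mul_sum_sq (s := P.parts ×ˢ Q.parts)
      (f := fun AB => G.edgeDensity AB.1 AB.2)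
    rw [card_product, hPN, hQN] at this
    push_cast at this
    rwa [sq (N : ℚ)]
  clear_value x S T
  set a := S / (N : ℚ) ^ 2 with ha
  have ha0 : 0 ≤ a := div_nonneg hS0 (sq_nonneg _)
  have haS : S = a * (N : ℚ) ^ 2 := by rw [ha]; field_simp
  have haT : a ^ 2 ≤ T / (N : ℚ) ^ 2 := by
    rw [le_div_iff₀ (by positivity)]
    rw [haS, mul_pow] at hCS
    refine le_of_mul_le_mul_left ?_ (by positivity : (0 : ℚ) < (N : ℚ) ^ 2)
    linarith
  have hxa : (m : ℚ) ^ 2 * x ≤ (m + 1) ^ 2 * a := by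
    have := hlower.trans hedges
    rw [haS] at this
    refine le_of_mul_le_mul_left ?_ (by positivity : (0 : ℚ) < (N : ℚ) ^ 2)
    linarith
  refine le_trans ?_ haT
  obtain hxa' | hxa' := le_total x a
  · have : x ^ 2 ≤ a ^ 2 := by gcongr
    have : (0 : ℚ) ≤ 4 / m := by positivity
    linarith
  have hdiff : (x - a) * m ≤ 2 := by
    refine le_of_mul_le_mul_right (a := (m : ℚ) + 1) ?_ (by positivity)
    nlinarith [mul_nonneg hm'.le (sub_nonneg.2 hx1)]
  rw [sub_le_comm, le_div_iff₀ hm']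
  have h2 : x + a ≤ 2 := by linarith
  calc (x ^ 2 - a ^ 2) * m = ((x - a) * m) * (x + a) := by ring
    _ ≤ 2 * 2 := by
      gcongr
    _ = 4 := by norm_num

theorem Finpartition.sum_offDiag_le_sum_offDiag_bind {s : Finset α} (P : Finpartition s)
    (Q : ∀ U ∈ P.parts, Finpartition U) (f : Finset α × Finset α → ℚ) (hf : ∀ x, 0 ≤ f x) :
    ∑ x ∈ P.parts.offDiag.attach, ∑ y ∈ (Q x.1.1 (mem_offDiag.1 x.2).1).parts ×ˢ
        (Q x.1.2 (mem_offDiag.1 x.2).2.1).parts, f y ≤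
      ∑ y ∈ (P.bind Q).parts.offDiag, f y := by
  rw [← sum_biUnion]
  · refine sum_le_sum_of_subset_of_nonneg ?_ fun y _ _ => hf y
    rintro ⟨A, B⟩
    simp only [mem_offDiag, mem_biUnion, Prod.exists, mem_product, mem_attach, true_and,
      Subtype.exists, Finpartition.mem_bind]
    rintro ⟨U, V, hUV, hA, hB⟩
    refine ⟨⟨_, hUV.1, hA⟩, ⟨_, hUV.2.1, hB⟩, ?_⟩
    rintro rfl
    obtain ⟨i, hi⟩ := nonempty_of_mem_parts _ hA
    exact hUV.2.2 (P.disjoint.elim_finset hUV.1 hUV.2.1 i (Finpartition.le _ hA hi) <|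
      Finpartition.le _ hB hi)
  · rintro ⟨⟨s₁, s₂⟩, hs⟩ _ ⟨⟨t₁, t₂⟩, ht⟩ _ hst
    refine Finset.disjoint_left.2 fun y hy₁ hy₂ => hst ?_
    rw [mem_product] at hy₁ hy₂
    rw [mem_offDiag] at hs ht
    obtain ⟨a, ha⟩ := Finpartition.nonempty_of_mem_parts _ hy₁.1
    obtain ⟨b, hb⟩ := Finpartition.nonempty_of_mem_parts _ hy₁.2
    exact Subtype.ext <| Prod.ext
      (P.disjoint.elim_finset hs.1 ht.1 a (Finpartition.le _ hy₁.1 ha) <|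
        Finpartition.le _ hy₂.1 ha) <|
      P.disjoint.elim_finset hs.2.1 ht.2.1 b (Finpartition.le _ hy₁.2 hb) <|
        Finpartition.le _ hy₂.2 hb

/-- Splitting every part of a partition into the same number of pieces of size `m` or `m + 1`
decreases the energy by at most `4 / m`. -/
theorem Finpartition.energy_sub_le_energy_bind {s : Finset α} (P : Finpartition s)
    (Q : ∀ U ∈ P.parts, Finpartition U) {N m : ℕ} (hN : 0 < N) (hm : 0 < m)
    (hQN : ∀ U hU, #(Q U hU).parts = N)
    (hQ : ∀ U hU, ∀ A ∈ (Q U hU).parts, m ≤ #A ∧ #A ≤ m + 1) :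
    P.energy G - 4 / m ≤ (P.bind Q).energy G := by
  have hm' : (0 : ℚ) < m := by exact_mod_cast hm
  have hcard : #(P.bind Q).parts = #P.parts * N := by
    rw [Finpartition.card_bind, sum_const_nat fun U _ => hQN U.1 U.2, card_attach]
  obtain hP | hP := (#P.parts).eq_zero_or_pos
  · have h0 : P.energy G = 0 := by simp [Finpartition.energy, hP]
    have := (P.bind Q).energy_nonneg G
    have : (0 : ℚ) ≤ 4 / m := by positivity
    linarith
  have hP' : (0 : ℚ) < #P.parts := by exact_mod_cast hP
  have hN' : (0 : ℚ) < N := by exact_mod_cast hN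
  have hsum : ∑ x ∈ P.parts.offDiag, (G.edgeDensity x.1 x.2 ^ 2 - 4 / m : ℚ) ≤
      (∑ y ∈ (P.bind Q).parts.offDiag, G.edgeDensity y.1 y.2 ^ 2) / (N : ℚ) ^ 2 := by
    rw [← sum_attach]
    refine le_trans (sum_le_sum fun x _ => G.edgeDensity_sq_sub_le_of_finpartition
      (Q x.1.1 (mem_offDiag.1 x.2).1) (Q x.1.2 (mem_offDiag.1 x.2).2.1) hN hm (hQN _ _) (hQN _ _)
      (hQ _ _) (hQ _ _)) ?_
    rw [← sum_div]
    gcongr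
    exact P.sum_offDiag_le_sum_offDiag_bind Q (fun y => G.edgeDensity y.1 y.2 ^ 2)
      fun _ => sq_nonneg _
  rw [sum_sub_distrib, sum_const, nsmul_eq_mul] at hsum
  have hoff : (#P.parts.offDiag : ℚ) ≤ #P.parts ^ 2 := by
    rw [offDiag_card]
    exact_mod_cast (Nat.sub_le _ _).trans (sq _).ge
  have hoff' : (#P.parts.offDiag : ℚ) * (4 / m) ≤ #P.parts ^ 2 * (4 / m) := by gcongr
  rw [Finpartition.energy, Finpartition.energy, hcard, Nat.cast_mul, mul_pow,
    mul_comm ((#P.parts : ℚ) ^ 2), ← div_div _ ((N : ℚ) ^ 2), le_div_iff₀ (by positivity),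
    sub_mul, div_mul_cancel₀ _ (by positivity)]
  linarith

end Energy

section Regularity

open Finset Fintype SzemerediRegularity

variable {α : Type*} [Fintype α] [DecidableEq α] {P : Finpartition (univ : Finset α)}

/-- The increment partition of one graph hardly decreases the energy of another graph. -/
theorem SzemerediRegularity.energy_sub_le_energy_increment [Nonempty α] (hP : P.IsEquipartition)
    (G H : SimpleGraph α) [DecidableRel G.Adj] [DecidableRel H.Adj] {ε : ℝ}
    (hPα : #P.parts * 16 ^ #P.parts ≤ card α) (hPε : 100 ≤ (4 : ℝ) ^ #P.parts * ε ^ 5) :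
    (P.energy H : ℝ) - ε ^ 5 / 25 ≤ (increment hP G ε).energy H := by
  have hm := m_pos hPα
  have hε : 0 < ε ^ 5 := eps_pow_five_pos hPε
  have hm' : (0 : ℝ) < (card α / stepBound #P.parts : ℕ) := by exact_mod_cast hm
  have h := P.energy_sub_le_energy_bind H (fun U hU => chunk hP G ε hU)
    (N := 4 ^ #P.parts) (m := card α / stepBound #P.parts) (by positivity) hm
    (fun U hU => card_chunk hm.ne') (fun U hU A hA => ⟨m_le_card_of_mem_chunk_parts hA,
      card_le_m_add_one_of_mem_chunk_parts hA⟩)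
  have h' : (P.energy H : ℝ) - 4 / (card α / stepBound #P.parts : ℕ) ≤
      (increment hP G ε).energy H := by
    have := (Rat.cast_le (K := ℝ)).2 h
    rwa [Rat.cast_sub, Rat.cast_div, Rat.cast_natCast, Rat.cast_ofNat] at this
  refine le_trans ?_ h'
  refine sub_le_sub_left ?_ _
  rw [div_le_div_iff₀ hm' (by norm_num)]
  have := hundred_div_ε_pow_five_le_m hPα hPε
  rw [div_le_iff₀ hε] at this
  linarith

/-- **Szemerédi Regularity Lemma** for three graphs simultaneously: a sufficiently large vertex set
has an equipartition of bounded size which is `ε`-uniform for all three graphs. -/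
theorem exists_isEquipartition_isUniform_three {ε : ℝ} (hε : 0 < ε) (hε₁ : ε ≤ 1) (l : ℕ) :
    ∃ M : ℕ, ∀ (α : Type*) [Fintype α] [DecidableEq α] (G : Fin 3 → SimpleGraph α)
      [∀ i, DecidableRel (G i).Adj], M ≤ card α →
      ∃ P : Finpartition (univ : Finset α),
        P.IsEquipartition ∧ l ≤ #P.parts ∧ #P.parts ≤ M ∧ ∀ i, P.IsUniform (G i) ε := by
  set t := initialBound ε l
  set T := ⌊24 / ε ^ 5⌋₊ + 1 with hT
  set N := stepBound^[T] t
  have htN : t ≤ N := Function.id_le_iterate_of_id_le le_stepBound _ _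
  have hNM : N ≤ N * 16 ^ N := Nat.le_mul_of_pos_right _ (by positivity)
  refine ⟨N * 16 ^ N, fun α _ _ G _ hα => ?_⟩
  have : Nonempty α := card_pos_iff.1 <|
    ((initialBound_pos ε l).trans_le (htN.trans hNM)).trans_le hα
  suffices h : ∀ i ≤ T, ∃ P : Finpartition (univ : Finset α), P.IsEquipartition ∧ t ≤ #P.parts ∧
      #P.parts ≤ stepBound^[i] t ∧
        ((∀ j, P.IsUniform (G j) ε) ∨ ε ^ 5 / 8 * i ≤ ∑ j, (P.energy (G j) : ℝ)) by
    obtain ⟨P, hP₁, hP₂, hP₃, hP₄⟩ := h T le_rfl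
    refine ⟨P, hP₁, (le_initialBound _ _).trans hP₂, hP₃.trans hNM,
      hP₄.resolve_right fun hPenergy => lt_irrefl (3 : ℝ) ?_⟩
    calc
      (3 : ℝ) = ε ^ 5 / 8 * (24 / ε ^ 5) := by field_simp; norm_num
      _ < ε ^ 5 / 8 * T := by
        rw [hT, Nat.cast_add_one]
        gcongr
        exact Nat.lt_floor_add_one _
      _ ≤ ∑ j, (P.energy (G j) : ℝ) := hPenergy
      _ ≤ ∑ _j : Fin 3, (1 : ℝ) := sum_le_sum fun j _ => mod_cast P.energy_le_one (G j)
      _ = 3 := by simp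
  intro i
  induction i with
  | zero =>
    intro _
    obtain ⟨P, hP₁, hP₂⟩ := Finpartition.exists_equipartition_card_eq (univ : Finset α)
      (initialBound_pos ε l).ne' ((htN.trans hNM).trans (hα.trans_eq card_univ.symm))
    refine ⟨P, hP₁, hP₂.ge, hP₂.le, Or.inr ?_⟩
    rw [Nat.cast_zero, mul_zero]
    exact sum_nonneg fun j _ => mod_cast P.energy_nonneg (G j)
  | succ i ih =>
  intro hi
  obtain ⟨P, hP₁, hP₂, hP₃, hP₄⟩ := ih (by omega)
  by_cases huniform : ∀ j, P.IsUniform (G j) ε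
  · refine ⟨P, hP₁, hP₂, ?_, Or.inl huniform⟩
    rw [Function.iterate_succ_apply']
    exact hP₃.trans (le_stepBound _)
  replace hP₄ := hP₄.resolve_left huniform
  obtain ⟨j, hj⟩ := not_forall.1 huniform
  have hPε : 100 ≤ (4 : ℝ) ^ #P.parts * ε ^ 5 :=
    (hundred_lt_pow_initialBound_mul hε l).le.trans <| by
      gcongr
      norm_num
  have hsize : #P.parts ≤ N :=
    hP₃.trans (Function.monotone_iterate_of_id_le le_stepBound (by omega) _)
  have hPα : #P.parts * 16 ^ #P.parts ≤ card α :=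
    (Nat.mul_le_mul hsize (Nat.pow_le_pow_right (by simp) hsize)).trans hα
  refine ⟨increment hP₁ (G j) ε, increment_isEquipartition hP₁ (G j) ε, ?_, ?_, Or.inr ?_⟩
  · rw [card_increment hPα hj]
    exact hP₂.trans (le_stepBound _)
  · rw [card_increment hPα hj, Function.iterate_succ_apply']
    exact stepBound_mono hP₃
  · have hgain := energy_increment hP₁ ((seven_le_initialBound ε l).trans hP₂) hPε hPα hj hε.le hε₁
    have hloss : ∑ k ∈ univ.erase j, ((P.energy (G k) : ℝ) - ε ^ 5 / 25) ≤
        ∑ k ∈ univ.erase j, ((increment hP₁ (G j) ε).energy (G k) : ℝ) :=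
      sum_le_sum fun k _ => energy_sub_le_energy_increment hP₁ (G j) (G k) hPα hPε
    rw [sum_sub_distrib, sum_const, card_erase_of_mem (mem_univ j), card_univ, Fintype.card_fin,
      nsmul_eq_mul] at hloss
    rw [← add_sum_erase _ _ (mem_univ j)] at hP₄ ⊢
    rw [Nat.cast_add_one]
    norm_num only at hloss
    have : 0 < ε ^ 5 := by positivity
    linarith

end Regularity

section RegPair

open Finset hiding dens

variable {V : Type*} (G : SimpleGraph V) {ε δ : ℝ} {A B A' B' : Finset V}

theorem dens_eq_edgeDensity [DecidableRel G.Adj] (A B : Finset V) :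
    dens G A B = (G.edgeDensity A B : ℝ) := by
  have : {p : V × V | p.1 ∈ A ∧ p.2 ∈ B ∧ G.Adj p.1 p.2} = G.interedges A B := by
    ext p
    simp [SimpleGraph.mem_interedges_iff]
  rw [dens, this, Set.ncard_coe_finset, SimpleGraph.edgeDensity_def]
  push_cast
  rfl

variable {G}

/-- Regularity is inherited, with a worse parameter, by pairs of large subsets. -/
theorem SimpleGraph.IsUniform.isRegPair_of_subset [DecidableRel G.Adj] (h : G.IsUniform δ A B)
    (hA : A' ⊆ A) (hB : B' ⊆ B) (hA' : (#A : ℝ) ≤ 2 * #A') (hB' : (#B : ℝ) ≤ 2 * #B')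
    (hδ : δ ≤ 1 / 2) (hδε : 2 * δ ≤ ε) : IsRegPair G ε A' B' := by
  intro X hX Y hY hXc hYc
  have hδ0 := h.pos
  have hlarge : ∀ {C C' : Finset V}, (#C : ℝ) ≤ 2 * #C' → #C * δ ≤ #C' := fun {C C'} hC => by
    nlinarith [(#C).cast_nonneg (α := ℝ)]
  have hlarge' : ∀ {C C' Z : Finset V}, (#C : ℝ) ≤ 2 * #C' → ε * #C' < #Z → #C * δ ≤ #Z :=
    fun {C C' Z} hC hZ => by nlinarith [(#C').cast_nonneg (α := ℝ)]
  have h₁ := abs_lt.1 (h (hX.trans hA) (hY.trans hB) (hlarge' hA' hXc) (hlarge' hB' hYc))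
  have h₂ := abs_lt.1 (h hA hB (hlarge hA') (hlarge hB'))
  rw [dens_eq_edgeDensity, dens_eq_edgeDensity, abs_lt]
  constructor <;> linarith

/-- Each part of an equipartition into at most half as many parts as there are elements can be
shrunk to the common size `#s / #P.parts`, losing at most half of the part. -/
theorem Finpartition.IsEquipartition.exists_subset_card_eq_average [DecidableEq V] {s : Finset V}
    {P : Finpartition s} (hP : P.IsEquipartition) (hs : 2 * #P.parts ≤ #s) (h : A ∈ P.parts) :
    ∃ A' ⊆ A, #A' = #s / #P.parts ∧ (#A : ℝ) ≤ 2 * #A' := by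
  obtain ⟨A', hA', hcard⟩ := Finset.exists_subset_card_eq (hP.average_le_card_part h)
  refine ⟨A', hA', hcard, ?_⟩
  have h₁ := hP.card_part_le_average_add_one h
  have h₂ : 1 ≤ #s / #P.parts := by
    rw [Nat.one_le_div_iff (card_pos.2 ⟨A, h⟩)]
    omega
  rw [hcard]
  exact_mod_cast (by omega : #A ≤ 2 * (#s / #P.parts))

end RegPair

/-- Three-color Regularity Lemma: for every ε > 0 and integer k₀ > 0 there is `K₀` such that
any three graphs `G₁, G₂, G₃` on a common vertex set of size `n ≥ K₀` admit a partition
`V₀, V₁, …, V_k` with `k₀ ≤ k ≤ K₀`, all `V_i` (`i ≥ 1`) of equal size, `|V₀| < εn`, and all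
but at most `ε·(k choose 2)` of the pairs `{V_i, V_j}` (`1 ≤ i < j ≤ k`) ε-regular in `G₁`,
`G₂` and `G₃` simultaneously. -/
theorem three_color_regularity_lemma :
    ∀ ε : ℝ, 0 < ε → ∀ k₀ : ℕ, 0 < k₀ → ∃ K₀ : ℕ, 0 < K₀ ∧
      ∀ n : ℕ, K₀ ≤ n → ∀ G₁ G₂ G₃ : SimpleGraph (Fin n),
        ∃ (k : ℕ) (V₀ : Finset (Fin n)) (P : Fin k → Finset (Fin n)),
          k₀ ≤ k ∧ k ≤ K₀ ∧
          -- V₀, V₁, …, V_k is a partition of the vertex set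
          (∀ i, Disjoint V₀ (P i)) ∧
          (∀ i j, i ≠ j → Disjoint (P i) (P j)) ∧
          (∀ v, v ∈ V₀ ∨ ∃ i, v ∈ P i) ∧
          -- the classes V₁, …, V_k have equal sizes
          (∀ i j, (P i).card = (P j).card) ∧
          -- the exceptional class is small
          ((V₀.card : ℝ) < ε * n) ∧
          -- all but at most ε·(k choose 2) pairs are ε-regular in G₁, G₂ and G₃
          ((Set.ncard {p : Fin k × Fin k | p.1 < p.2 ∧
              ¬(IsRegPair G₁ ε (P p.1) (P p.2) ∧ IsRegPair G₂ ε (P p.1) (P p.2) ∧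
                IsRegPair G₃ ε (P p.1) (P p.2))} : ℝ) ≤ ε * (k.choose 2)) := by
  classical
  intro ε hε k₀ hk₀
  set δ : ℝ := min ε 1 / 6 with hδ
  have hδ0 : 0 < δ := by positivity
  have hδ1 : 6 * δ ≤ 1 := by linarith [min_le_right ε 1]
  have hδε : 6 * δ ≤ ε := by linarith [min_le_left ε 1]
  obtain ⟨M, hM⟩ := exists_isEquipartition_isUniform_three hδ0 (by linarith) k₀
  refine ⟨2 * M + ⌈M / ε⌉₊ + 1, by omega, fun n hn G₁ G₂ G₃ => ?_⟩
  obtain ⟨Q, hQ, hkQ, hQM, hunif⟩ := hM (Fin n) ![G₁, G₂, G₃] (by rw [Fintype.card_fin]; omega)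
  have hcardn : (Finset.univ : Finset (Fin n)).card = n := by simp
  set k := Q.parts.card
  let e := Q.parts.equivFin
  choose P hPsub hPcard hPlarge using fun i : Fin k =>
    hQ.exists_subset_card_eq_average (by rw [hcardn]; omega) (e.symm i).2
  have hPdisj : ∀ i j, i ≠ j → Disjoint (P i) (P j) := fun i j hij =>
    (Q.disjoint (e.symm i).2 (e.symm j).2 fun h => hij <| e.symm.injective <|
      Subtype.ext h).mono (hPsub i) (hPsub j)
  refine ⟨k, Finset.univ \ Finset.univ.biUnion P, P, hkQ, by omega, fun i => ?_, hPdisj,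
    fun v => ?_, fun i j => (hPcard i).trans (hPcard j).symm, ?_, ?_⟩
  · exact Finset.sdiff_disjoint.mono_right
      (Finset.subset_biUnion_of_mem P (Finset.mem_univ i))
  · simp only [Finset.mem_sdiff, Finset.mem_univ, Finset.mem_biUnion, true_and]
    tauto
  · have hunion : (Finset.univ.biUnion P).card = k * (n / k) := by
      rw [Finset.card_biUnion fun i _ j _ => hPdisj i j, Finset.sum_const_nat fun i _ => hPcard i,
        Finset.card_univ, Fintype.card_fin, hcardn]
    have hV₀ : (Finset.univ \ Finset.univ.biUnion P).card ≤ M := by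
      rw [Finset.card_sdiff_of_subset (Finset.subset_univ _), hunion, hcardn]
      have := Nat.mod_lt n (hk₀.trans_le hkQ)
      have := Nat.div_add_mod n k
      omega
    have hMn : (M : ℝ) / ε < n := (Nat.le_ceil _).trans_lt (by exact_mod_cast (by omega))
    rw [div_lt_iff₀' hε] at hMn
    exact lt_of_le_of_lt (by exact_mod_cast hV₀) hMn
  · have hreg : ∀ (i : Fin 3) (a b : Fin k),
        (![G₁, G₂, G₃] i).IsUniform δ (e.symm a).1 (e.symm b).1 →
          IsRegPair (![G₁, G₂, G₃] i) ε (P a) (P b) := fun i a b h =>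
      h.isRegPair_of_subset (hPsub a) (hPsub b) (hPlarge a) (hPlarge b) (by linarith)
        (by linarith)
    have hcard : Set.ncard {p : Fin k × Fin k | p.1 < p.2 ∧
        ¬(IsRegPair G₁ ε (P p.1) (P p.2) ∧ IsRegPair G₂ ε (P p.1) (P p.2) ∧
          IsRegPair G₃ ε (P p.1) (P p.2))} ≤
        ∑ i, (Q.nonUniforms (![G₁, G₂, G₃] i) δ).card := by
      refine le_trans ?_ Finset.card_biUnion_le
      rw [← Set.ncard_coe_finset]
      refine Set.ncard_le_ncard_of_injOn (fun p => ((e.symm p.1).1, (e.symm p.2).1)) ?_ ?_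
        (Finset.finite_toSet _)
      · rintro ⟨a, b⟩ ⟨hab, hirr⟩
        by_contra hmem
        have hall : ∀ i, (![G₁, G₂, G₃] i).IsUniform δ (e.symm a).1 (e.symm b).1 := fun i => by
          by_contra hi
          refine hmem <| Finset.mem_coe.2 <| Finset.mem_biUnion.2 ⟨i, Finset.mem_univ i, ?_⟩
          rw [Finpartition.mk_mem_nonUniforms]
          exact ⟨(e.symm a).2, (e.symm b).2,
            fun h => hab.ne (e.symm.injective (Subtype.ext h)), hi⟩
        exact hirr ⟨hreg 0 a b (hall 0), hreg 1 a b (hall 1), hreg 2 a b (hall 2)⟩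
      · rintro ⟨a, b⟩ _ ⟨c, d⟩ _ h
        rw [Prod.mk.injEq] at h
        exact Prod.ext (e.symm.injective (Subtype.ext h.1)) (e.symm.injective (Subtype.ext h.2))
    calc _ ≤ ∑ i, ((Q.nonUniforms (![G₁, G₂, G₃] i) δ).card : ℝ) := by exact_mod_cast hcard
      _ ≤ ∑ _i : Fin 3, ((k * (k - 1) : ℕ) : ℝ) * δ := Finset.sum_le_sum fun i _ => hunif i
      _ = 6 * δ * k.choose 2 := by
        have hchoose : k * (k - 1) = 2 * k.choose 2 := by
          rw [Nat.choose_two_right, Nat.mul_div_cancel' k.even_mul_pred_self.two_dvd]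
        rw [Finset.sum_const, Finset.card_univ, Fintype.card_fin, hchoose, nsmul_eq_mul]
        push_cast
        ring
      _ ≤ _ := by gcongr
end

section
/- (Embedding Lemma) For all d > 0 and Δ > 0 there is an ε = ε(d,Δ) > 0 such that the following holds. Let G be an N-vertex graph admitting a vertex partition (V_i)_{i∈[s]} whose (ε,d)-reduced graph contains a tree T on [s], such that G is moreover (ε,d)-super-regular on a subgraph M ⊆ T. Let H be an n-vertex graph with maximum degree Δ(H) ≤ Δ and n ≤ N, admitting a vertex partition (W_i)_{i∈[s]} that is (ε,T,M)-compatible with (V_i)_{i∈[s]}. Then H is a subgraph of G. -/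
/-- `G` contains a copy of `H`: an injective graph homomorphism from `H` to `G`. -/
def hasCopy {α : Type*} {β : Type*} (G : SimpleGraph α) (H : SimpleGraph β) : Prop :=
  ∃ f : H →g G, Function.Injective f

/-- The pair `(A,B)` is (ε,d)-super-regular in `G`. -/
def IsSuperRegPair {V : Type*} (G : SimpleGraph V) (ε d : ℝ) (A B : Finset V) : Prop :=
  IsRegPair G ε A B ∧
  (∀ a ∈ A, d * (B.card : ℝ) < (((B : Set V) ∩ G.neighborSet a).ncard : ℝ)) ∧
  (∀ b ∈ B, d * (A.card : ℝ) < (((A : Set V) ∩ G.neighborSet b).ncard : ℝ))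

/-- `U_i`: vertices of `W_i` having a neighbor in some `W_j` with `ij ∈ E_T \ E_M`. -/
def compatU {n s : ℕ} (H : SimpleGraph (Fin n)) (Q : Fin s → Finset (Fin n))
    (T M : SimpleGraph (Fin s)) (i : Fin s) : Set (Fin n) :=
  {w | w ∈ Q i ∧ ∃ j, T.Adj i j ∧ ¬ M.Adj i j ∧ ∃ w' ∈ Q j, H.Adj w w'}

/-- `U = ⋃ i U_i`. -/
def compatUnion {n s : ℕ} (H : SimpleGraph (Fin n)) (Q : Fin s → Finset (Fin n))
    (T M : SimpleGraph (Fin s)) : Set (Fin n) :=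
  ⋃ i, compatU H Q T M i

/-- `U_i' = N_H(U) ∩ (W_i \ U)`. -/
def compatU' {n s : ℕ} (H : SimpleGraph (Fin n)) (Q : Fin s → Finset (Fin n))
    (T M : SimpleGraph (Fin s)) (i : Fin s) : Set (Fin n) :=
  {w | w ∈ Q i ∧ w ∉ compatUnion H Q T M ∧ ∃ u ∈ compatUnion H Q T M, H.Adj w u}

section
open scoped Classical
open Finset

theorem card_swap_le {A X : Type*} [Fintype A] [Fintype X] (a : A) (S : Finset A)
    (E : (A ≃ X) → Finset X) (e : ℝ) (hE : ∀ φ, ((E φ).card : ℝ) ≤ e)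
    (hinv : ∀ φ a', a' ∉ S → E ((Equiv.swap a a').trans φ) = E φ) :
    ((Fintype.card A : ℝ) - S.card) * ((univ.filter fun φ : A ≃ X => φ a ∈ E φ).card : ℝ)
      ≤ e * Fintype.card (A ≃ X) := by
  have h1 : ∀ a' ∈ Sᶜ, (univ.filter fun φ : A ≃ X => φ a ∈ E φ).card
      = (univ.filter fun φ : A ≃ X => φ a' ∈ E φ).card := by
    intro a' ha'
    have ha'S : a' ∉ S := by simpa using ha'
    refine Finset.card_bij' (fun φ _ => (Equiv.swap a a').trans φ)
      (fun φ _ => (Equiv.swap a a').trans φ) ?_ ?_ ?_ ?_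
    · intro φ hφ
      simp only [mem_filter, mem_univ, true_and] at hφ ⊢
      rw [hinv φ a' ha'S]; simpa using hφ
    · intro φ hφ
      simp only [mem_filter, mem_univ, true_and] at hφ ⊢
      rw [hinv φ a' ha'S]; simpa using hφ
    · intro φ _; ext; simp
    · intro φ _; ext; simp
  have h2 : Sᶜ.card * (univ.filter fun φ : A ≃ X => φ a ∈ E φ).card
      ≤ ∑ φ : A ≃ X, (E φ).card := by
    calc Sᶜ.card * (univ.filter fun φ : A ≃ X => φ a ∈ E φ).card
        = ∑ a' ∈ Sᶜ, (univ.filter fun φ : A ≃ X => φ a' ∈ E φ).card := by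
          rw [← Finset.sum_congr rfl h1]; simp
      _ = ∑ φ : A ≃ X, (Sᶜ.filter fun a' => φ a' ∈ E φ).card := by
          simp only [Finset.card_filter]; rw [Finset.sum_comm]
      _ ≤ ∑ φ : A ≃ X, (E φ).card := by
          refine Finset.sum_le_sum fun φ _ => ?_
          refine Finset.card_le_card_of_injOn φ ?_ φ.injective.injOn
          intro x hx
          have hx' := Finset.mem_coe.1 hx
          simp only [mem_filter] at hx'
          exact hx'.2
  have h3 : (Sᶜ.card : ℝ) = (Fintype.card A : ℝ) - S.card := by
    rw [Finset.card_compl, Nat.cast_sub (Finset.card_le_univ S)]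
  rw [← h3]
  calc (Sᶜ.card : ℝ) * ((univ.filter fun φ : A ≃ X => φ a ∈ E φ).card : ℝ)
      ≤ ((∑ φ : A ≃ X, (E φ).card : ℕ) : ℝ) := by exact_mod_cast h2
    _ = ∑ φ : A ≃ X, ((E φ).card : ℝ) := by push_cast; rfl
    _ ≤ ∑ _φ : A ≃ X, e := Finset.sum_le_sum fun φ _ => hE φ
    _ = e * Fintype.card (A ≃ X) := by simp [mul_comm]

/-- The common neighbourhood of the image of `S` under `φ`. -/
noncomputable def commonNbhd {A X Y : Type*} [Fintype Y] (R : X → Y → Prop) (φ : A → X)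
    (S : Finset A) : Finset Y := univ.filter fun y => ∀ a ∈ S, R (φ a) y

/-- For every `Z`, all but an `ε`-fraction of the vertices of `X` have about `δ|Z|` neighbours
in `Z`. -/
def OneSidedReg {X Y : Type*} [Fintype X] [Fintype Y] (R : X → Y → Prop) (ε δ : ℝ) : Prop :=
  ∀ Z : Finset Y, ((univ.filter fun x => ε * Fintype.card Y <
    |((Z.filter fun y => R x y).card : ℝ) - δ * Z.card|).card : ℝ) ≤ ε * Fintype.card X

theorem commonNbhd_insert {A X Y : Type*} [Fintype Y] (R : X → Y → Prop) (φ : A → X)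
    (S : Finset A) (a : A) :
    commonNbhd R φ (insert a S) = (commonNbhd R φ S).filter fun y => R (φ a) y := by
  ext y; simp [commonNbhd, and_comm]

theorem card_not_typical_le {A X Y : Type*} [Fintype A] [Fintype X] [Fintype Y]
    {R : X → Y → Prop} {ε δ : ℝ} (hR : OneSidedReg R ε δ) (hε : 0 < ε) (hδ0 : 0 ≤ δ)
    (hδ1 : δ ≤ 1) (hAX : Fintype.card A = Fintype.card X) (S : Finset A)
    (hS : 2 * (S.card : ℝ) * ε ≤ 1) :
    ((univ.filter fun φ : A ≃ X => S.card * ε * Fintype.card Y <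
      |((commonNbhd R φ S).card : ℝ) - δ ^ S.card * Fintype.card Y|).card : ℝ)
      ≤ 2 * ε * S.card * Fintype.card (A ≃ X) := by
  induction S using Finset.induction_on with
  | empty => simp [commonNbhd]
  | insert a S ha ih =>
    rw [Finset.card_insert_of_notMem ha] at hS ⊢
    push_cast at hS ⊢
    have ih' := ih (by nlinarith)
    set E : (A ≃ X) → Finset X := fun φ => univ.filter fun x => ε * Fintype.card Y <
      |(((commonNbhd R φ S).filter fun y => R x y).card : ℝ) - δ * (commonNbhd R φ S).card|
      with hEdef
    have hE : ∀ φ, ((E φ).card : ℝ) ≤ ε * Fintype.card X := fun φ => hR _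
    have hinv : ∀ (φ : A ≃ X) a', a' ∉ S → E ((Equiv.swap a a').trans φ) = E φ := by
      intro φ a' ha'
      have : commonNbhd R ((Equiv.swap a a').trans φ) S = commonNbhd R φ S := by
        ext y
        simp only [commonNbhd, mem_filter, mem_univ, true_and]
        refine forall₂_congr fun b hb => ?_
        have h1 : b ≠ a := fun h => ha (h ▸ hb)
        have h2 : b ≠ a' := fun h => ha' (h ▸ hb)
        simp [Equiv.swap_apply_of_ne_of_ne h1 h2]
      simp only [hEdef, this]
    have hbad : ((univ.filter fun φ : A ≃ X => φ a ∈ E φ).card : ℝ)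
        ≤ 2 * ε * Fintype.card (A ≃ X) := by
      by_cases hk : ε * Fintype.card X < 1
      · have : (univ.filter fun φ : A ≃ X => φ a ∈ E φ) = ∅ := by
          refine Finset.filter_eq_empty_iff.2 fun φ _ hφ => ?_
          have h1 : 1 ≤ (E φ).card := Finset.card_pos.2 ⟨_, hφ⟩
          have h2 : (1 : ℝ) ≤ (E φ).card := by exact_mod_cast h1
          linarith [hE φ]
        rw [this]; simp; positivity
      · have h := card_swap_le a S E _ hE hinv
        push Not at hk
        have hN : (0 : ℝ) ≤ Fintype.card (A ≃ X) := by positivity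
        have hB : (0 : ℝ) ≤ ((univ.filter fun φ : A ≃ X => φ a ∈ E φ).card : ℝ) := by positivity
        rw [hAX] at h
        have hk0 : (0 : ℝ) < Fintype.card X := by
          by_contra hc; nlinarith
        have hSk : 2 * (S.card : ℝ) ≤ Fintype.card X := by
          by_contra hc
          push Not at hc
          nlinarith
        have h3 : (Fintype.card X : ℝ) / 2 * ((univ.filter fun φ : A ≃ X => φ a ∈ E φ).card : ℝ)
            ≤ ε * Fintype.card X * Fintype.card (A ≃ X) := by
          refine le_trans ?_ h
          gcongr; linarith
        have h4 : (Fintype.card X : ℝ) * ((univ.filter fun φ : A ≃ X => φ a ∈ E φ).card : ℝ)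
            ≤ (Fintype.card X : ℝ) * (2 * ε * Fintype.card (A ≃ X)) := by linarith
        exact le_of_mul_le_mul_left h4 hk0
    refine le_trans (b := (((univ.filter fun φ : A ≃ X => S.card * ε * Fintype.card Y <
      |((commonNbhd R φ S).card : ℝ) - δ ^ S.card * Fintype.card Y|) ∪
      (univ.filter fun φ : A ≃ X => φ a ∈ E φ)).card : ℝ)) ?_ ?_
    · norm_cast
      refine Finset.card_le_card fun φ hφ => ?_
      by_contra hc
      simp only [mem_union, mem_filter, mem_univ, true_and, not_or, not_lt, hEdef] at hc hφ
      rw [commonNbhd_insert] at hφ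
      obtain ⟨h1, h2⟩ := hc
      refine absurd hφ (not_lt.2 ?_)
      rw [abs_le] at *
      push_cast
      rw [pow_succ]
      have hδabs : |δ| ≤ 1 := abs_le.2 ⟨by linarith, hδ1⟩
      have hT : (0 : ℝ) ≤ S.card * ε * Fintype.card Y := by positivity
      constructor
      · nlinarith
      · nlinarith
    · calc _ ≤ ((_ + _ : ℕ) : ℝ) := by exact_mod_cast Finset.card_union_le _ _
        _ ≤ _ := by push_cast; linarith

theorem second_moment {ι Y : Type*} [Fintype Y] (C : ι → Finset Y) (p : ι → ℝ)
    (hp0 : ∀ i, 0 ≤ p i) (hp1 : ∀ i, p i ≤ 1) (J : Finset ι) (Z : Finset Y) (bad : ι → ι → Prop)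
    (γ γ' : ℝ) (hγ : 0 ≤ γ) (hγ' : 0 ≤ γ')
    (hJ : ∀ i ∈ J, ((C i ∩ Z).card : ℝ) < p i * Z.card - γ' * Fintype.card Y)
    (hgood : ∀ i ∈ J, ∀ j ∈ J, ¬ bad i j → ((C i ∩ C j).card : ℝ) - p i * (C j).card
      - p j * (C i).card + p i * p j * Fintype.card Y ≤ γ * Fintype.card Y) :
    γ' ^ 2 * (J.card : ℝ) ^ 2 ≤ γ * (J.card : ℝ) ^ 2
      + 2 * (((J ×ˢ J).filter fun q => bad q.1 q.2).card : ℝ) := by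
  set m : ℝ := (Fintype.card Y : ℝ) with hm
  rcases J.eq_empty_or_nonempty with rfl | ⟨i₀, hi₀⟩
  · simp
  have hm0 : 0 < m := by
    rw [hm]
    norm_cast
    by_contra hc
    have hY : Fintype.card Y = 0 := by omega
    have : IsEmpty Y := Fintype.card_eq_zero_iff.1 hY
    have := hJ i₀ hi₀
    simp [Finset.eq_empty_of_isEmpty, hm] at this
  set F : Y → ℝ := fun y => ∑ i ∈ J, ((if y ∈ C i then (1 : ℝ) else 0) - p i) with hF
  have hcard : ∀ (D E : Finset Y), ((D ∩ E).card : ℝ)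
      = ∑ y ∈ E, (if y ∈ D then (1 : ℝ) else 0) := by
    intro D E
    rw [Finset.sum_ite_mem, inter_comm]; simp
  have h1 : ∑ y ∈ Z, F y ≤ - (γ' * m * J.card) := by
    rw [hF, Finset.sum_comm]
    calc ∑ i ∈ J, ∑ y ∈ Z, ((if y ∈ C i then (1 : ℝ) else 0) - p i)
        = ∑ i ∈ J, (((C i ∩ Z).card : ℝ) - p i * Z.card) := by
          refine Finset.sum_congr rfl fun i _ => ?_
          rw [Finset.sum_sub_distrib, hcard]; simp [mul_comm]
      _ ≤ ∑ i ∈ J, (- (γ' * m)) := Finset.sum_le_sum fun i hi => by linarith [hJ i hi]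
      _ = _ := by simp; ring
  have h2 : (∑ y ∈ Z, F y) ^ 2 ≤ Z.card * ∑ y, F y ^ 2 := by
    refine (sq_sum_le_card_mul_sum_sq).trans ?_
    gcongr
    exact Finset.subset_univ Z
  have h3 : ∑ y, F y ^ 2 = ∑ q ∈ J ×ˢ J, (((C q.1 ∩ C q.2).card : ℝ) - p q.1 * (C q.2).card
      - p q.2 * (C q.1).card + p q.1 * p q.2 * m) := by
    have : ∀ y, F y ^ 2 = ∑ q ∈ J ×ˢ J, ((if y ∈ C q.1 then (1 : ℝ) else 0) - p q.1) *
        ((if y ∈ C q.2 then (1 : ℝ) else 0) - p q.2) := by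
      intro y; rw [sq, hF, Finset.sum_mul_sum, Finset.sum_product]
    simp_rw [this]
    rw [Finset.sum_comm]
    refine Finset.sum_congr rfl fun q _ => ?_
    have e1 : ∀ i, ((C i).card : ℝ) = ∑ y, (if y ∈ C i then (1 : ℝ) else 0) := by
      intro i; rw [← hcard]; simp
    have e2 : ((C q.1 ∩ C q.2).card : ℝ) = ∑ y, (if y ∈ C q.1 then (1 : ℝ) else 0) *
        (if y ∈ C q.2 then (1 : ℝ) else 0) := by
      have := hcard (C q.1 ∩ C q.2) univ
      rw [Finset.inter_univ] at this
      rw [this]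
      refine Finset.sum_congr rfl fun y _ => ?_
      by_cases a1 : y ∈ C q.1 <;> by_cases a2 : y ∈ C q.2 <;> simp [a1, a2]
    have e3 : m = ∑ _y : Y, (1 : ℝ) := by simp [hm]
    rw [e1, e1, e2, e3, Finset.mul_sum, Finset.mul_sum, Finset.mul_sum,
      ← Finset.sum_sub_distrib, ← Finset.sum_sub_distrib, ← Finset.sum_add_distrib]
    refine Finset.sum_congr rfl fun y _ => by ring
  have h4 : ∑ y, F y ^ 2 ≤ m * (γ * (J.card : ℝ) ^ 2
      + 2 * (((J ×ˢ J).filter fun q => bad q.1 q.2).card : ℝ)) := by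
    rw [h3]
    calc _ ≤ ∑ q ∈ J ×ˢ J, (γ * m + if bad q.1 q.2 then 2 * m else 0) := by
          refine Finset.sum_le_sum fun q hq => ?_
          rw [Finset.mem_product] at hq
          by_cases hb : bad q.1 q.2
          · have a1 : ((C q.1 ∩ C q.2).card : ℝ) ≤ m := by
              rw [hm]; exact_mod_cast Finset.card_le_univ _
            have a2 : p q.1 * p q.2 ≤ 1 := mul_le_one₀ (hp1 _) (hp0 _) (hp1 _)
            have a3 : 0 ≤ p q.1 * (C q.2).card := mul_nonneg (hp0 _) (by positivity)
            have a4 : 0 ≤ p q.2 * (C q.1).card := mul_nonneg (hp0 _) (by positivity)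
            have a5 : 0 ≤ γ * m := by positivity
            simp only [hb, if_true]
            nlinarith
          · simp only [hb, if_false, add_zero]
            exact hgood _ hq.1 _ hq.2 hb
      _ = _ := by
          rw [Finset.sum_add_distrib, ← Finset.sum_filter]
          simp [Finset.card_product]; ring
  have h5 : (γ' * m * J.card) ^ 2 ≤ (∑ y ∈ Z, F y) ^ 2 := by
    rw [← neg_sq (∑ y ∈ Z, F y)]
    exact pow_le_pow_left₀ (by positivity) (by linarith) 2
  have h6 : (Z.card : ℝ) ≤ m := by rw [hm]; exact_mod_cast Finset.card_le_univ _
  have h7 : 0 ≤ γ * (J.card : ℝ) ^ 2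
      + 2 * (((J ×ˢ J).filter fun q => bad q.1 q.2).card : ℝ) := by positivity
  have h8 : (γ' * m * J.card) ^ 2 ≤ m * (m * (γ * (J.card : ℝ) ^ 2
      + 2 * (((J ×ˢ J).filter fun q => bad q.1 q.2).card : ℝ))) := by
    refine (h5.trans h2).trans ?_
    have : 0 ≤ ∑ y, F y ^ 2 := by positivity
    calc _ ≤ m * ∑ y, F y ^ 2 := by gcongr
      _ ≤ _ := by gcongr
  have h9 : m ^ 2 * (γ' ^ 2 * (J.card : ℝ) ^ 2) ≤ m ^ 2 * (γ * (J.card : ℝ) ^ 2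
      + 2 * (((J ×ˢ J).filter fun q => bad q.1 q.2).card : ℝ)) := by
    calc _ = (γ' * m * J.card) ^ 2 := by ring
      _ ≤ _ := h8
      _ = _ := by ring
  exact le_of_mul_le_mul_left h9 (by positivity)

theorem commonNbhd_union {A X Y : Type*} [Fintype Y] (R : X → Y → Prop) (φ : A → X)
    (S S' : Finset A) : commonNbhd R φ (S ∪ S') = commonNbhd R φ S ∩ commonNbhd R φ S' := by
  ext y
  simp only [commonNbhd, mem_filter, mem_univ, true_and, mem_union, mem_inter]
  exact ⟨fun h => ⟨fun a ha => h a (Or.inl ha), fun a ha => h a (Or.inr ha)⟩,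
    fun h a ha => ha.elim (h.1 a) (h.2 a)⟩

theorem commonNbhd_lower_of_small {A X Y : Type*} [Fintype X] [Fintype Y]
    {R : X → Y → Prop} {ε δ : ℝ} (hR : OneSidedReg R ε δ) (hε : 0 < ε) (hδ0 : 0 ≤ δ)
    (hδ1 : δ ≤ 1) (hk : ε * Fintype.card X < 1) (φ : A → X) (Z : Finset Y) (S : Finset A) :
    δ ^ S.card * Z.card - S.card * ε * Fintype.card Y ≤ ((commonNbhd R φ S ∩ Z).card : ℝ) := by
  induction S using Finset.induction_on with
  | empty => simp [commonNbhd]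
  | insert a S ha ih =>
    have h1 := hR (commonNbhd R φ S ∩ Z)
    have h2 : (univ.filter fun x => ε * Fintype.card Y <
      |(((commonNbhd R φ S ∩ Z).filter fun y => R x y).card : ℝ)
        - δ * (commonNbhd R φ S ∩ Z).card|) = ∅ := by
      rw [← Finset.card_eq_zero]
      by_contra hc
      have h3 := Nat.one_le_iff_ne_zero.2 hc
      have h4 := (Nat.one_le_cast (α := ℝ)).2 h3
      linarith
    have h3 := Finset.filter_eq_empty_iff.1 h2 (mem_univ (φ a))
    rw [not_lt, abs_le] at h3
    have h4 : commonNbhd R φ (insert a S) ∩ Z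
        = (commonNbhd R φ S ∩ Z).filter fun y => R (φ a) y := by
      rw [commonNbhd_insert]; ext y; simp; tauto
    rw [h4, Finset.card_insert_of_notMem ha, pow_succ]
    push_cast
    have hT : (0 : ℝ) ≤ S.card * ε * Fintype.card Y := by positivity
    nlinarith

set_option maxHeartbeats 1000000 in
theorem exists_quasirandom {A X Y : Type*} [Fintype A] [Fintype X] [Fintype Y]
    {R : X → Y → Prop} {ε δ : ℝ} (hR : OneSidedReg R ε δ) (hε : 0 < ε) (hδ0 : 0 ≤ δ)
    (hδ1 : δ ≤ 1) (hAX : Fintype.card A = Fintype.card X) (Δ K : ℕ) (γ η : ℝ)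
    (hγ : 0 < γ) (hγ1 : γ ≤ 1) (hη : 0 < η) (𝒮 : Finset (Finset A))
    (hΔ : ∀ S ∈ 𝒮, S.card ≤ Δ) (hK : 𝒮.card ≤ K * Fintype.card A)
    (hI : ∀ S ∈ 𝒮, (𝒮.filter fun S' => ¬ Disjoint S S').card ≤ K)
    (hε1 : 4 * Δ * ε ≤ 1) (hε2 : 4 * Δ * ε ≤ γ ^ 2 / 2)
    (hε3 : 4 * K ^ 2 * (8 * Δ + 1) * ε ≤ η ^ 2 * γ ^ 2) :
    ∃ φ : A ≃ X, ∀ Z : Finset Y, ((𝒮.filter fun S => ((commonNbhd R φ S ∩ Z).card : ℝ) <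
      δ ^ S.card * Z.card - γ * Fintype.card Y).card : ℝ) ≤ η * Fintype.card A := by
  have hNe : Nonempty (A ≃ X) := ⟨Fintype.equivOfCardEq hAX⟩
  by_cases hk : ε * Fintype.card X < 1
  · obtain ⟨φ⟩ := hNe
    refine ⟨φ, fun Z => ?_⟩
    rw [Finset.filter_eq_empty_iff.2]
    · simp; positivity
    · intro S hS
      rw [not_lt]
      refine le_trans ?_ (commonNbhd_lower_of_small hR hε hδ0 hδ1 hk φ Z S)
      have h1 : (S.card : ℝ) ≤ Δ := by exact_mod_cast hΔ S hS
      have h2 : S.card * ε ≤ γ := by nlinarith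
      have h3 : (0 : ℝ) ≤ Fintype.card Y := by positivity
      nlinarith
  push Not at hk
  set k : ℝ := (Fintype.card A : ℝ) with hkdef
  rw [← hAX, ← hkdef] at hk
  set N : ℝ := (Fintype.card (A ≃ X) : ℝ) with hN
  have hNpos : 0 < N := by rw [hN]; exact_mod_cast Fintype.card_pos
  set NT : Finset A → (A ≃ X) → Prop := fun S φ => S.card * ε * Fintype.card Y <
      |((commonNbhd R φ S).card : ℝ) - δ ^ S.card * Fintype.card Y| with hNT
  set bad : (A ≃ X) → Finset A → Finset A → Prop := fun φ S S' =>
    ¬ Disjoint S S' ∨ NT S φ ∨ NT S' φ ∨ NT (S ∪ S') φ with hbad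
  have hKk : (𝒮.card : ℝ) ≤ K * k := by rw [hkdef]; exact_mod_cast hK
  have hNTc : ∀ S : Finset A, S.card ≤ 2 * Δ →
      ((univ.filter fun φ => NT S φ).card : ℝ) ≤ 2 * ε * S.card * N := by
    intro S hS
    have hS' : (S.card : ℝ) ≤ 2 * Δ := by exact_mod_cast hS
    exact card_not_typical_le hR hε hδ0 hδ1 hAX S (by nlinarith)
  have hsum : ∑ φ : A ≃ X, (((𝒮 ×ˢ 𝒮).filter fun q => bad φ q.1 q.2).card : ℝ)
      ≤ ∑ _φ : A ≃ X, K ^ 2 * (8 * Δ + 1) * ε * k ^ 2 := by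
    have e1 : ∑ φ : A ≃ X, (((𝒮 ×ˢ 𝒮).filter fun q => bad φ q.1 q.2).card : ℝ)
        = ∑ q ∈ 𝒮 ×ˢ 𝒮, ((univ.filter fun φ => bad φ q.1 q.2).card : ℝ) := by
      simp only [Finset.card_filter]
      push_cast
      rw [Finset.sum_comm]
    have e2 : ∀ q ∈ 𝒮 ×ˢ 𝒮, ((univ.filter fun φ => bad φ q.1 q.2).card : ℝ)
        ≤ (if ¬ Disjoint q.1 q.2 then N else 0) + 8 * Δ * ε * N := by
      intro q hq
      rw [Finset.mem_product] at hq
      by_cases hd : Disjoint q.1 q.2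
      · simp only [hd, not_true_eq_false, if_false, zero_add, hbad, false_or]
        have c1 := hΔ _ hq.1
        have c2 := hΔ _ hq.2
        have t1 := hNTc q.1 (by omega)
        have t2 := hNTc q.2 (by omega)
        have t3 := hNTc (q.1 ∪ q.2) ((card_union_le _ _).trans (by omega))
        have c1' : (q.1.card : ℝ) ≤ Δ := by exact_mod_cast c1
        have c2' : (q.2.card : ℝ) ≤ Δ := by exact_mod_cast c2
        have c3' : ((q.1 ∪ q.2).card : ℝ) ≤ 2 * Δ := by
          exact_mod_cast (card_union_le _ _).trans (by omega)
        have hsub : (univ.filter fun φ => NT q.1 φ ∨ NT q.2 φ ∨ NT (q.1 ∪ q.2) φ).card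
            ≤ (univ.filter fun φ => NT q.1 φ).card + ((univ.filter fun φ => NT q.2 φ).card
              + (univ.filter fun φ => NT (q.1 ∪ q.2) φ).card) := by
          rw [Finset.filter_or, Finset.filter_or]
          exact (card_union_le _ _).trans (Nat.add_le_add_left (card_union_le _ _) _)
        have hsub' : ((univ.filter fun φ => NT q.1 φ ∨ NT q.2 φ ∨ NT (q.1 ∪ q.2) φ).card : ℝ)
            ≤ (univ.filter fun φ => NT q.1 φ).card + ((univ.filter fun φ => NT q.2 φ).card
              + (univ.filter fun φ => NT (q.1 ∪ q.2) φ).card) := by exact_mod_cast hsub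
        refine hsub'.trans ?_
        have hεN : 0 ≤ ε * N := by positivity
        nlinarith
      · simp only [hd, not_false_eq_true, if_true]
        have : ((univ.filter fun φ => bad φ q.1 q.2).card : ℝ) ≤ N := by
          rw [hN]; exact_mod_cast card_le_univ _
        have h8 : 0 ≤ 8 * Δ * ε * N := by positivity
        linarith
    rw [e1]
    refine (Finset.sum_le_sum e2).trans ?_
    rw [Finset.sum_add_distrib, ← Finset.sum_filter]
    have e3 : (((𝒮 ×ˢ 𝒮).filter fun q => ¬ Disjoint q.1 q.2).card : ℝ) ≤ K * k * K := by
      have : ((𝒮 ×ˢ 𝒮).filter fun q => ¬ Disjoint q.1 q.2).card ≤ 𝒮.card * K := by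
        rw [Finset.card_filter, Finset.sum_product]
        calc _ ≤ ∑ _S ∈ 𝒮, K := Finset.sum_le_sum fun S hS => by
              rw [← Finset.card_filter]; exact hI S hS
          _ = _ := by simp
      have h' : (((𝒮 ×ˢ 𝒮).filter fun q => ¬ Disjoint q.1 q.2).card : ℝ) ≤ 𝒮.card * K := by
        exact_mod_cast this
      exact h'.trans (by gcongr)
    simp only [Finset.sum_const, Finset.card_product, nsmul_eq_mul, Finset.card_univ, ← hN]
    push_cast
    have e4 : (𝒮.card : ℝ) * 𝒮.card ≤ K * k * (K * k) := by gcongr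
    have hk0 : 0 ≤ k := by positivity
    calc _ ≤ K * k * K * N + K * k * (K * k) * (8 * Δ * ε * N) := by gcongr
      _ ≤ K * k * K * (ε * k) * N + K * k * (K * k) * (8 * Δ * ε * N) := by
          have h5 : 0 ≤ K * k * K * N := by positivity
          have h6 := mul_le_mul_of_nonneg_left hk h5
          linarith
      _ = _ := by ring
  obtain ⟨φ, -, hφ⟩ := Finset.exists_le_of_sum_le Finset.univ_nonempty hsum
  refine ⟨φ, fun Z => ?_⟩
  set J := 𝒮.filter fun S => ((commonNbhd R φ S ∩ Z).card : ℝ) <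
      δ ^ S.card * Z.card - γ * Fintype.card Y with hJ
  have hJ𝒮 : J ⊆ 𝒮 := Finset.filter_subset _ _
  have hsm := second_moment (fun S : Finset A => commonNbhd R φ S) (fun S => δ ^ S.card)
    (fun S => pow_nonneg hδ0 _) (fun S => pow_le_one₀ hδ0 hδ1) J Z (bad φ) (4 * Δ * ε) γ
    (by positivity) hγ.le (fun S hS => (Finset.mem_filter.1 hS).2) (by
      intro S hS S' hS' hb
      simp only [hbad, hNT, not_or, not_not, not_lt] at hb
      obtain ⟨b1, b2, b3, b4⟩ := hb
      rw [Finset.card_union_of_disjoint b1, commonNbhd_union, pow_add] at b4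
      rw [abs_le] at b2 b3 b4
      have c1' : (S.card : ℝ) ≤ Δ := by exact_mod_cast hΔ _ (hJ𝒮 hS)
      have c2' : (S'.card : ℝ) ≤ Δ := by exact_mod_cast hΔ _ (hJ𝒮 hS')
      push_cast at b4
      have p1 : δ ^ S.card ≤ 1 := pow_le_one₀ hδ0 hδ1
      have p2 : δ ^ S'.card ≤ 1 := pow_le_one₀ hδ0 hδ1
      have p1' : 0 ≤ δ ^ S.card := pow_nonneg hδ0 _
      have p2' : 0 ≤ δ ^ S'.card := pow_nonneg hδ0 _
      have hεm : 0 ≤ ε * Fintype.card Y := by positivity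
      have q1 : S.card * ε * Fintype.card Y ≤ Δ * (ε * Fintype.card Y) := by
        rw [mul_assoc]; gcongr
      have q2 : S'.card * ε * Fintype.card Y ≤ Δ * (ε * Fintype.card Y) := by
        rw [mul_assoc]; gcongr
      have q0 : 0 ≤ Δ * (ε * Fintype.card Y) := by positivity
      have aux : ∀ p u T : ℝ, 0 ≤ p → p ≤ 1 → 0 ≤ T → -T ≤ u → -T ≤ p * u := by
        intro p u T hp0 hp1 hT hu
        nlinarith [mul_nonneg hp0 (by linarith : 0 ≤ u + T), mul_nonneg hT (sub_nonneg.2 hp1)]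
      have r1 := aux _ _ _ p2' p2 q0 ((neg_le_neg q1).trans b2.1)
      have r2 := aux _ _ _ p1' p1 q0 ((neg_le_neg q2).trans b3.1)
      have b5 := b4.2
      linarith)
  have hmono : γ ^ 2 * (J.card : ℝ) ^ 2 ≤ 4 * Δ * ε * (J.card : ℝ) ^ 2
      + 2 * (((𝒮 ×ˢ 𝒮).filter fun q => bad φ q.1 q.2).card : ℝ) := by
    refine hsm.trans (add_le_add le_rfl (mul_le_mul_of_nonneg_left ?_ zero_le_two))
    refine Nat.cast_le.2 (card_le_card fun q hq => ?_)
    simp only [mem_filter, mem_product] at hq ⊢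
    exact ⟨⟨hJ𝒮 hq.1.1, hJ𝒮 hq.1.2⟩, hq.2⟩
  have hk0 : 0 ≤ k := by positivity
  have h1 : γ ^ 2 * (J.card : ℝ) ^ 2 ≤ γ ^ 2 * (η * k) ^ 2 := by
    have hJ2 : 0 ≤ (J.card : ℝ) ^ 2 := by positivity
    have h2 : 4 * Δ * ε * (J.card : ℝ) ^ 2 ≤ γ ^ 2 / 2 * (J.card : ℝ) ^ 2 := by gcongr
    have h3 : 4 * K ^ 2 * (8 * Δ + 1) * ε * k ^ 2 ≤ η ^ 2 * γ ^ 2 * k ^ 2 := by gcongr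
    nlinarith
  have h2 := le_of_mul_le_mul_left h1 (by positivity)
  exact le_of_sq_le_sq h2 (by positivity)

/-- The neighbours in `A` of `b` under the bipartite relation `h`. -/
noncomputable def leftNbrs {A B : Type*} [Fintype A] (h : A → B → Prop) (b : B) : Finset A :=
  univ.filter fun a => h a b

theorem mem_leftNbrs {A B : Type*} [Fintype A] {h : A → B → Prop} {a : A} {b : B} :
    a ∈ leftNbrs h b ↔ h a b := by simp [leftNbrs]

theorem exists_quasirandom_bijection {A B X Y : Type*} [Fintype A] [Fintype B] [Fintype X]
    [Fintype Y] {R : X → Y → Prop} {ε δ d : ℝ} (hR : OneSidedReg R ε δ) (hε : 0 < ε)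
    (hd : 0 < d) (hdδ : d ≤ δ) (hδ1 : δ ≤ 1) (hAX : Fintype.card A = Fintype.card X)
    (h : A → B → Prop) (Δ : ℕ) (hΔ0 : 0 < Δ) (hA : ∀ a, (univ.filter fun b => h a b).card ≤ Δ)
    (hB : ∀ b, (leftNbrs h b).card ≤ Δ) (γ μ : ℝ)
    (hγ : 0 < γ) (hγ1 : γ ≤ 1) (hμ : 0 < μ)
    (hε1 : 4 * Δ * ε ≤ 1) (hε2 : 4 * Δ * ε ≤ γ ^ 2 / 2)
    (hε3 : 4 * ((Δ ^ 2 * 2 ^ Δ : ℕ) : ℝ) ^ 2 * (8 * Δ + 1) * ε ≤ (μ / Δ ^ 2) ^ 2 * γ ^ 2) :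
    ∃ φ : A ≃ X, ∀ Z : Finset Y,
      ((univ.filter fun b : B => ((commonNbhd R φ (leftNbrs h b) ∩ Z).card : ℝ) <
        d ^ Δ * Z.card - γ * Fintype.card Y).card : ℝ) ≤ μ * Fintype.card A ∧
      ((univ.filter fun a : A => ∃ b, h a b ∧
        ((commonNbhd R φ ((leftNbrs h b).erase a) ∩ Z).card : ℝ) <
        d ^ Δ * Z.card - γ * Fintype.card Y).card : ℝ) ≤ μ * Fintype.card A := by
  set 𝒮 : Finset (Finset A) :=
    ((univ : Finset B).biUnion fun b => (leftNbrs h b).powerset).erase ∅ with h𝒮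
  have mem𝒮 : ∀ S, S ∈ 𝒮 ↔ S ≠ ∅ ∧ ∃ b, S ⊆ leftNbrs h b := by
    intro S; simp [h𝒮]
  have hcontain : ∀ a, (𝒮.filter fun S => a ∈ S).card ≤ Δ * 2 ^ Δ := by
    intro a
    have hsub : (𝒮.filter fun S => a ∈ S) ⊆
        (univ.filter fun b => h a b).biUnion fun b => (leftNbrs h b).powerset := by
      intro S hS
      rw [mem_filter, mem𝒮] at hS
      obtain ⟨⟨-, b, hb⟩, haS⟩ := hS
      rw [mem_biUnion]
      exact ⟨b, by simpa using mem_leftNbrs.1 (hb haS), mem_powerset.2 hb⟩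
    refine (card_le_card hsub).trans ?_
    refine (card_biUnion_le_card_mul _ _ (2 ^ Δ) fun b _ => ?_).trans ?_
    · rw [card_powerset]; exact Nat.pow_le_pow_right (by norm_num) (hB b)
    · exact Nat.mul_le_mul_right _ (hA a)
  have hcardS : ∀ S ∈ 𝒮, S.card ≤ Δ := by
    intro S hS
    obtain ⟨-, b, hb⟩ := (mem𝒮 S).1 hS
    exact (card_le_card hb).trans (hB b)
  have hK : 𝒮.card ≤ (Δ ^ 2 * 2 ^ Δ) * Fintype.card A := by
    have hsub : 𝒮 ⊆ (univ : Finset A).biUnion fun a => 𝒮.filter fun S => a ∈ S := by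
      intro S hS
      obtain ⟨a, ha⟩ := nonempty_iff_ne_empty.2 ((mem𝒮 S).1 hS).1
      rw [mem_biUnion]
      exact ⟨a, mem_univ _, mem_filter.2 ⟨hS, ha⟩⟩
    refine (card_le_card hsub).trans ?_
    refine (card_biUnion_le_card_mul _ _ (Δ * 2 ^ Δ) fun a _ => hcontain a).trans ?_
    rw [card_univ, mul_comm]
    refine Nat.mul_le_mul_right _ (Nat.mul_le_mul_right _ ?_)
    nlinarith
  have hI : ∀ S ∈ 𝒮, (𝒮.filter fun S' => ¬ Disjoint S S').card ≤ Δ ^ 2 * 2 ^ Δ := by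
    intro S hS
    have hsub : (𝒮.filter fun S' => ¬ Disjoint S S') ⊆
        S.biUnion fun a => 𝒮.filter fun S => a ∈ S := by
      intro S' hS'
      rw [mem_filter, not_disjoint_iff] at hS'
      obtain ⟨hS', a, ha, ha'⟩ := hS'
      rw [mem_biUnion]
      exact ⟨a, ha, mem_filter.2 ⟨hS', ha'⟩⟩
    refine (card_le_card hsub).trans ?_
    refine (card_biUnion_le_card_mul _ _ (Δ * 2 ^ Δ) fun a _ => hcontain a).trans ?_
    calc _ ≤ Δ * (Δ * 2 ^ Δ) := Nat.mul_le_mul_right _ (hcardS S hS)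
      _ = _ := by ring
  have hΔr : (1 : ℝ) ≤ Δ := by exact_mod_cast hΔ0
  obtain ⟨φ, hφ⟩ := exists_quasirandom hR hε (hd.le.trans hdδ) hδ1 hAX Δ (Δ ^ 2 * 2 ^ Δ) γ
    (μ / Δ ^ 2) hγ hγ1 (by positivity) 𝒮 hcardS hK hI hε1 hε2 hε3
  refine ⟨φ, fun Z => ?_⟩
  set 𝒥 := 𝒮.filter fun S => ((commonNbhd R φ S ∩ Z).card : ℝ) <
      δ ^ S.card * Z.card - γ * Fintype.card Y with h𝒥
  have hm : (0 : ℝ) ≤ Fintype.card Y := by positivity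
  have hδ0 : 0 < δ := hd.trans_le hdδ
  have hdev : ∀ (S : Finset A) (b : B), S ⊆ leftNbrs h b →
      ((commonNbhd R φ S ∩ Z).card : ℝ) < d ^ Δ * Z.card - γ * Fintype.card Y → S ∈ 𝒥 := by
    intro S b hSb hlt
    have hSΔ : S.card ≤ Δ := (card_le_card hSb).trans (hB b)
    have hpow : d ^ Δ ≤ δ ^ S.card :=
      (pow_le_pow_left₀ hd.le hdδ Δ).trans (pow_le_pow_of_le_one hδ0.le hδ1 hSΔ)
    have hlt' : ((commonNbhd R φ S ∩ Z).card : ℝ) <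
        δ ^ S.card * Z.card - γ * Fintype.card Y := by
      refine hlt.trans_le ?_
      gcongr
    rw [h𝒥, mem_filter, mem𝒮]
    refine ⟨⟨?_, b, hSb⟩, hlt'⟩
    rintro rfl
    have : 0 ≤ γ * (Fintype.card Y : ℝ) := by positivity
    simp [commonNbhd] at hlt'
    linarith
  have hfin : ∀ n : ℕ, n ≤ 𝒥.card * Δ ^ 2 → (n : ℝ) ≤ μ * Fintype.card A := by
    intro n hn
    have hn' : (n : ℝ) ≤ 𝒥.card * Δ ^ 2 := by exact_mod_cast hn
    refine hn'.trans ?_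
    calc _ ≤ μ / Δ ^ 2 * Fintype.card A * Δ ^ 2 := by gcongr; exact hφ Z
      _ = _ := by field_simp
  constructor
  · apply hfin
    have hsub : (univ.filter fun b : B => ((commonNbhd R φ (leftNbrs h b) ∩ Z).card : ℝ) <
        d ^ Δ * Z.card - γ * Fintype.card Y) ⊆
        𝒥.biUnion fun S => univ.filter fun b => leftNbrs h b = S := by
      intro b hb
      rw [mem_filter] at hb
      rw [mem_biUnion]
      exact ⟨_, hdev _ b subset_rfl hb.2, by simp⟩
    refine (card_le_card hsub).trans (card_biUnion_le_card_mul _ _ _ fun S hS => ?_)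
    obtain ⟨a, ha⟩ := nonempty_iff_ne_empty.2 ((mem𝒮 S).1 (mem_filter.1 hS).1).1
    refine le_trans (card_le_card (t := univ.filter fun b => h a b) ?_)
      ((hA a).trans (by nlinarith))
    intro b hb
    rw [mem_filter] at hb ⊢
    rw [← hb.2, mem_leftNbrs] at ha
    exact ⟨mem_univ _, ha⟩
  · apply hfin
    have hsub : (univ.filter fun a : A => ∃ b, h a b ∧
        ((commonNbhd R φ ((leftNbrs h b).erase a) ∩ Z).card : ℝ) <
        d ^ Δ * Z.card - γ * Fintype.card Y) ⊆
        𝒥.biUnion fun S => univ.filter fun a => ∃ b, h a b ∧ S ⊆ leftNbrs h b := by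
      intro a ha
      rw [mem_filter] at ha
      obtain ⟨-, b, hab, hlt⟩ := ha
      rw [mem_biUnion]
      exact ⟨_, hdev _ b (erase_subset _ _) hlt, by simpa using ⟨b, hab, erase_subset _ _⟩⟩
    refine (card_le_card hsub).trans (card_biUnion_le_card_mul _ _ _ fun S hS => ?_)
    obtain ⟨a, ha⟩ := nonempty_iff_ne_empty.2 ((mem𝒮 S).1 (mem_filter.1 hS).1).1
    have hsub2 : (univ.filter fun a => ∃ b, h a b ∧ S ⊆ leftNbrs h b) ⊆
        (univ.filter fun b => h a b).biUnion fun b => leftNbrs h b := by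
      intro a' ha'
      rw [mem_filter] at ha'
      obtain ⟨-, b, hb, hSb⟩ := ha'
      rw [mem_biUnion]
      exact ⟨b, by simpa using mem_leftNbrs.1 (hSb ha), mem_leftNbrs.2 hb⟩
    refine (card_le_card hsub2).trans ((card_biUnion_le_card_mul _ _ Δ fun b _ => hB b).trans ?_)
    rw [sq]
    exact Nat.mul_le_mul_right _ (hA a)

theorem card_filter_near_le {A B : Type*} [Fintype A] [Fintype B] (h : A → B → Prop) (Δ : ℕ)
    (hA : ∀ a, (univ.filter fun b => h a b).card ≤ Δ)
    (hB : ∀ b, (leftNbrs h b).card ≤ Δ) (a : A) :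
    (univ.filter fun a' => a = a' ∨ ∃ b, h a b ∧ h a' b).card ≤ 1 + Δ ^ 2 := by
  have hsub : (univ.filter fun a' => a = a' ∨ ∃ b, h a b ∧ h a' b) ⊆
      {a} ∪ (univ.filter fun b => h a b).biUnion fun b => leftNbrs h b := by
    intro a' ha'
    rw [mem_filter] at ha'
    rw [mem_union, mem_singleton, mem_biUnion]
    rcases ha'.2 with rfl | ⟨b, hb, hb'⟩
    · exact Or.inl rfl
    · exact Or.inr ⟨b, by simpa using hb, mem_leftNbrs.2 hb'⟩
  refine (card_le_card hsub).trans ((card_union_le _ _).trans ?_)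
  rw [card_singleton]
  refine Nat.add_le_add_left ?_ _
  refine (card_biUnion_le_card_mul _ _ Δ fun b _ => hB b).trans ?_
  rw [sq]
  exact Nat.mul_le_mul_right _ (hA a)

theorem exists_switch_partners {A B X Y : Type*} [Fintype A] [Fintype B] [Fintype X]
    [Fintype Y] {R : X → Y → Prop} {ε δ d : ℝ} (hR : OneSidedReg R ε δ)
    (hd : 0 < d) (hd1 : d ≤ 1) (hdδ : d ≤ δ)
    (h : A → B → Prop) (Δ : ℕ) (hA : ∀ a, (univ.filter fun b => h a b).card ≤ Δ)
    (hB : ∀ b, (leftNbrs h b).card ≤ Δ) (φ : A ≃ X) (D : Finset A)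
    (L : A → Finset X) (LB : B → Finset Y) (W : A → Finset A) (c lam μ : ℝ) (hc : 0 < c)
    (hL : ∀ a ∈ D, lam ≤ (L a).card) (hW : ∀ a ∈ D, ((W a).card : ℝ) ≤ μ)
    (hbase : ∀ b, c * Fintype.card Y ≤
      ((LB b ∩ commonNbhd R φ (leftNbrs h b \ D)).card : ℝ))
    (hε : 2 * ε ≤ d * (c * (d / 2) ^ Δ))
    (hbudget : 2 * D.card * (1 + Δ ^ 2) + μ + Δ * (ε * Fintype.card X) < lam) :
    ∃ f : A → A,
      (∀ a ∈ D, φ (f a) ∈ L a ∧ f a ∉ W a ∧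
        ∀ a₂ ∈ D, ¬ (a₂ = f a ∨ ∃ b, h a₂ b ∧ h (f a) b)) ∧
      (∀ a ∈ D, ∀ a₂ ∈ D, a ≠ a₂ → ¬ (f a₂ = f a ∨ ∃ b, h (f a₂) b ∧ h (f a) b)) ∧
      ∀ b, c * (d / 2) ^ Δ * Fintype.card Y ≤ ((LB b ∩ commonNbhd R φ (leftNbrs h b \ D) ∩
        commonNbhd R (fun a => φ (f a)) (leftNbrs h b ∩ D)).card : ℝ) := by
  suffices H : ∀ T : Finset A, T ⊆ D → ∃ f : A → A,
      (∀ a ∈ T, φ (f a) ∈ L a ∧ f a ∉ W a ∧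
        ∀ a₂ ∈ D, ¬ (a₂ = f a ∨ ∃ b, h a₂ b ∧ h (f a) b)) ∧
      (∀ a ∈ T, ∀ a₂ ∈ T, a ≠ a₂ → ¬ (f a₂ = f a ∨ ∃ b, h (f a₂) b ∧ h (f a) b)) ∧
      ∀ b, c * (d / 2) ^ (leftNbrs h b ∩ T).card * Fintype.card Y ≤
        ((LB b ∩ commonNbhd R φ (leftNbrs h b \ D) ∩
        commonNbhd R (fun a => φ (f a)) (leftNbrs h b ∩ T)).card : ℝ) by
    obtain ⟨f, h1, h2, h3⟩ := H D subset_rfl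
    refine ⟨f, h1, h2, fun b => le_trans ?_ (h3 b)⟩
    have hle : (leftNbrs h b ∩ D).card ≤ Δ := (card_le_card inter_subset_left).trans (hB b)
    have := pow_le_pow_of_le_one (by positivity : 0 ≤ d / 2) (by linarith) hle
    gcongr
  intro T
  induction T using Finset.induction_on with
  | empty =>
    intro _
    refine ⟨id, by simp, by simp, fun b => ?_⟩
    simpa [commonNbhd] using hbase b
  | insert a T ha ih =>
    intro hTD
    have haD : a ∈ D := hTD (mem_insert_self _ _)
    have hTD' : T ⊆ D := (subset_insert _ _).trans hTD
    obtain ⟨f, h1, h2, h3⟩ := ih hTD'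
    set Zb : B → Finset Y := fun b => LB b ∩ commonNbhd R φ (leftNbrs h b \ D) ∩
        commonNbhd R (fun a => φ (f a)) (leftNbrs h b ∩ T) with hZb
    set nr : A → Finset A := fun a => univ.filter fun a' => a = a' ∨ ∃ b, h a b ∧ h a' b with hnr
    set Eb : B → Finset A := fun b => univ.filter fun a' => ε * Fintype.card Y <
      |(((Zb b).filter fun y => R (φ a') y).card : ℝ) - δ * (Zb b).card| with hEb
    have hnrc : ∀ a, (nr a).card ≤ 1 + Δ ^ 2 := card_filter_near_le h Δ hA hB
    have hEbc : ∀ b, ((Eb b).card : ℝ) ≤ ε * Fintype.card X := by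
      intro b
      refine le_trans ?_ (hR (Zb b))
      refine Nat.cast_le.2 (card_le_card_of_injOn φ ?_ φ.injective.injOn)
      intro x hx
      simpa [hEb] using hx
    set forb : Finset A := W a ∪ (D.biUnion nr ∪ (T.biUnion fun a₂ => nr (f a₂))) ∪
      (univ.filter fun b => h a b).biUnion Eb with hforb
    have hforbc : (forb.card : ℝ) < lam := by
      have c1 : (D.biUnion nr).card ≤ D.card * (1 + Δ ^ 2) :=
        card_biUnion_le_card_mul _ _ _ fun a _ => hnrc a
      have c2 : (T.biUnion fun a₂ => nr (f a₂)).card ≤ D.card * (1 + Δ ^ 2) :=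
        (card_biUnion_le_card_mul _ _ _ fun a _ => hnrc _).trans
          (Nat.mul_le_mul_right _ (card_le_card hTD'))
      have c3 : (((univ.filter fun b => h a b).biUnion Eb).card : ℝ)
          ≤ Δ * (ε * Fintype.card X) := by
        calc (((univ.filter fun b => h a b).biUnion Eb).card : ℝ)
            ≤ ∑ b ∈ (univ.filter fun b => h a b), ((Eb b).card : ℝ) := by
              exact_mod_cast card_biUnion_le
          _ ≤ ∑ _b ∈ (univ.filter fun b => h a b), ε * (Fintype.card X : ℝ) :=
              Finset.sum_le_sum fun b _ => hEbc b
          _ ≤ Δ * (ε * Fintype.card X) := by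
              rw [sum_const, nsmul_eq_mul]
              have : 0 ≤ ε * (Fintype.card X : ℝ) := by
                by_cases hne : Nonempty B
                · obtain ⟨b⟩ := hne
                  exact le_trans (Nat.cast_nonneg _) (hEbc b)
                · exact le_trans (Nat.cast_nonneg _) (hR ∅)
              have hA' : ((univ.filter fun b => h a b).card : ℝ) ≤ Δ := by exact_mod_cast hA a
              gcongr
      have c4 : forb.card ≤ (W a).card + (D.card * (1 + Δ ^ 2) + D.card * (1 + Δ ^ 2)) +
          ((univ.filter fun b => h a b).biUnion Eb).card := by
        refine (card_union_le _ _).trans (Nat.add_le_add_right ?_ _)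
        refine (card_union_le _ _).trans (Nat.add_le_add_left ?_ _)
        exact (card_union_le _ _).trans (Nat.add_le_add c1 c2)
      have c5 : (forb.card : ℝ) ≤ (W a).card + (D.card * (1 + Δ ^ 2) + D.card * (1 + Δ ^ 2)) +
          ((univ.filter fun b => h a b).biUnion Eb).card := by exact_mod_cast c4
      linarith [hW a haD]
    have hLc : ((univ.filter fun a' => φ a' ∈ L a).card : ℝ) = (L a).card := by
      congr 1
      rw [← card_image_of_injective _ φ.injective]
      congr 1
      ext x
      simp only [mem_image, mem_filter, mem_univ, true_and]
      exact ⟨fun ⟨a', ha', e⟩ => e ▸ ha', fun hx => ⟨φ.symm x, by simpa using hx, by simp⟩⟩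
    obtain ⟨a', ha'L, ha'f⟩ : ∃ a' ∈ (univ.filter fun a' => φ a' ∈ L a), a' ∉ forb := by
      by_contra hcon
      push Not at hcon
      have : ((univ.filter fun a' => φ a' ∈ L a).card : ℝ) ≤ forb.card :=
        Nat.cast_le.2 (card_le_card hcon)
      linarith [hL a haD]
    simp only [hforb, mem_union, mem_biUnion, not_or, not_exists, not_and, hnr, mem_filter,
      mem_univ, true_and] at ha'f ha'L
    obtain ⟨⟨f1, f2, f3⟩, f4⟩ := ha'f
    have hfT : ∀ a₂ ∈ T, Function.update f a a' a₂ = f a₂ := fun a₂ h₂ =>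
      Function.update_of_ne (ne_of_mem_of_not_mem h₂ ha) _ _
    have hfa : Function.update f a a' a = a' := Function.update_self _ _ _
    refine ⟨Function.update f a a', ?_, ?_, ?_⟩
    · intro a₂ h₂
      rcases mem_insert.1 h₂ with rfl | h₂
      · rw [hfa]
        refine ⟨ha'L, f1, fun a₃ h₃ hcon => ?_⟩
        rcases hcon with e | ⟨b, hb, hb'⟩
        · exact (f2 a₃ h₃).1 e
        · exact (f2 a₃ h₃).2 b hb hb'
      · rw [hfT a₂ h₂]; exact h1 a₂ h₂
    · have key : ∀ a₃ ∈ T, ¬ (f a₃ = a' ∨ ∃ b, h (f a₃) b ∧ h a' b) := by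
        rintro a₃ h₃ (e | ⟨b, hb, hb'⟩)
        · exact (f3 a₃ h₃).1 e
        · exact (f3 a₃ h₃).2 b hb hb'
      intro a₂ h₂ a₃ h₃ hne
      rcases mem_insert.1 h₂ with rfl | h₂' <;> rcases mem_insert.1 h₃ with rfl | h₃'
      · exact absurd rfl hne
      · rw [hfa, hfT a₃ h₃']; exact key a₃ h₃'
      · rw [hfa, hfT a₂ h₂']
        rintro (e | ⟨b, hb, hb'⟩)
        · exact key a₂ h₂' (Or.inl e.symm)
        · exact key a₂ h₂' (Or.inr ⟨b, hb', hb⟩)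
      · rw [hfT a₂ h₂', hfT a₃ h₃']; exact h2 a₂ h₂' a₃ h₃' hne
    · intro b
      have hcongr : commonNbhd R (fun a₂ => φ (Function.update f a a' a₂)) (leftNbrs h b ∩ T)
          = commonNbhd R (fun a => φ (f a)) (leftNbrs h b ∩ T) := by
        ext y
        simp only [commonNbhd, mem_filter, mem_univ, true_and]
        refine forall₂_congr fun a₂ h₂ => ?_
        rw [hfT a₂ (mem_inter.1 h₂).2]
      by_cases hab : h a b
      · have e1 : leftNbrs h b ∩ insert a T = insert a (leftNbrs h b ∩ T) :=
          inter_insert_of_mem (mem_leftNbrs.2 hab)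
        have e2 : a ∉ leftNbrs h b ∩ T := fun hx => ha (mem_inter.1 hx).2
        rw [e1, commonNbhd_insert, hcongr, card_insert_of_notMem e2, hfa]
        have e3 : LB b ∩ commonNbhd R φ (leftNbrs h b \ D) ∩
            (commonNbhd R (fun a => φ (f a)) (leftNbrs h b ∩ T)).filter (fun y => R (φ a') y)
            = (Zb b).filter fun y => R (φ a') y := by
          ext y; simp [hZb]; tauto
        rw [e3]
        have e4 := f4 b hab
        simp only [hEb, mem_filter, mem_univ, true_and, not_lt] at e4
        rw [abs_le] at e4
        have e5 : c * (d / 2) ^ (leftNbrs h b ∩ T).card * Fintype.card Y ≤ (Zb b).card := h3 b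
        have hle : (leftNbrs h b ∩ T).card ≤ Δ := (card_le_card inter_subset_left).trans (hB b)
        have e6 := pow_le_pow_of_le_one (by positivity : 0 ≤ d / 2) (by linarith) hle
        have hm : (0 : ℝ) ≤ Fintype.card Y := by positivity
        have e7 : 2 * ε * Fintype.card Y ≤
            d * (c * (d / 2) ^ (leftNbrs h b ∩ T).card) * Fintype.card Y := by
          refine mul_le_mul_of_nonneg_right (hε.trans ?_) hm
          gcongr
        have e8 : d * (Zb b).card ≤ δ * (Zb b).card := by gcongr
        have e9 : d * (c * (d / 2) ^ (leftNbrs h b ∩ T).card * Fintype.card Y) ≤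
          d * (Zb b).card := by gcongr
        rw [pow_succ]
        linarith [e4.1]
      · have e1 : leftNbrs h b ∩ insert a T = leftNbrs h b ∩ T :=
          inter_insert_of_notMem fun hx => hab (mem_leftNbrs.1 hx)
        rw [e1, hcongr]
        exact h3 b

theorem exists_switched_bijection {A B X Y : Type*} [Fintype A] [Fintype B] [Fintype X]
    [Fintype Y] {R : X → Y → Prop} {ε δ d : ℝ} (hR : OneSidedReg R ε δ)
    (hd : 0 < d) (hd1 : d ≤ 1) (hdδ : d ≤ δ)
    (h : A → B → Prop) (Δ : ℕ) (hA : ∀ a, (univ.filter fun b => h a b).card ≤ Δ)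
    (hB : ∀ b, (leftNbrs h b).card ≤ Δ) (φ : A ≃ X) (D : Finset A)
    (L : A → Finset X) (LB : B → Finset Y) (W : A → Finset A) (c lam μ : ℝ) (hc : 0 < c)
    (hL : ∀ a ∈ D, lam ≤ (L a).card) (hW : ∀ a ∈ D, ((W a).card : ℝ) ≤ μ)
    (hbase : ∀ b, c * Fintype.card Y ≤
      ((LB b ∩ commonNbhd R φ (leftNbrs h b \ D)).card : ℝ))
    (hε : 2 * ε ≤ d * (c * (d / 2) ^ Δ))
    (hbudget : 2 * D.card * (1 + Δ ^ 2) + μ + Δ * (ε * Fintype.card X) < lam) :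
    ∃ (φ' : A ≃ X) (P : Finset A), P.card ≤ D.card ∧
      (∀ a ∈ D, φ' a ∈ L a) ∧ (∀ a ∉ D ∪ P, φ' a = φ a) ∧
      (∀ b, Disjoint (leftNbrs h b) P → c * (d / 2) ^ Δ * Fintype.card Y ≤
        ((LB b ∩ commonNbhd R φ' (leftNbrs h b)).card : ℝ)) ∧
      ∀ b, ¬ Disjoint (leftNbrs h b) P → Disjoint (leftNbrs h b) D ∧ ∃ a ∈ D, ∃ a' ∉ W a,
        h a' b ∧ commonNbhd R φ' (leftNbrs h b) =
          (commonNbhd R φ ((leftNbrs h b).erase a')).filter fun y => R (φ a) y := by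
  obtain ⟨f, h1, h2, h3⟩ := exists_switch_partners hR hd hd1 hdδ h Δ hA hB φ D L LB W c lam μ hc
    hL hW hbase hε hbudget
  set σ : A → A := fun a => if a ∈ D then f a else
    if hx : ∃ a₀ ∈ D, f a₀ = a then hx.choose else a with hσ
  have hfD : ∀ a ∈ D, f a ∉ D := fun a ha hfa => (h1 a ha).2.2 _ hfa (Or.inl rfl)
  have hinj : ∀ a ∈ D, ∀ a₂ ∈ D, f a₂ = f a → a₂ = a := by
    intro a ha a₂ ha₂ e
    by_contra hne
    exact h2 a ha a₂ ha₂ (Ne.symm hne) (Or.inl e)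
  have σD : ∀ a ∈ D, σ a = f a := fun a ha => by simp [hσ, ha]
  have σf : ∀ a ∈ D, σ (f a) = a := by
    intro a ha
    have hx : ∃ a₀ ∈ D, f a₀ = f a := ⟨a, ha, rfl⟩
    have : σ (f a) = hx.choose := by
      simp only [hσ, hfD a ha, if_false]
      rw [dif_pos hx]
    rw [this]
    exact hinj a ha _ hx.choose_spec.1 hx.choose_spec.2
  have σo : ∀ a ∉ D ∪ D.image f, σ a = a := by
    intro a ha
    rw [mem_union, mem_image, not_or] at ha
    simp only [hσ, ha.1, if_false]
    rw [dif_neg ha.2]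
  have hσσ : Function.Involutive σ := by
    intro a
    by_cases ha : a ∈ D
    · rw [σD a ha, σf a ha]
    · by_cases ha' : a ∈ D.image f
      · obtain ⟨a₀, ha₀, rfl⟩ := mem_image.1 ha'
        rw [σf a₀ ha₀, σD a₀ ha₀]
      · have : a ∉ D ∪ D.image f := by simp only [mem_union, not_or]; exact ⟨ha, ha'⟩
        rw [σo a this, σo a this]
  refine ⟨hσσ.toPerm.trans φ, D.image f, card_image_le, ?_, ?_, ?_, ?_⟩
  · intro a ha
    simpa [σD a ha] using (h1 a ha).1
  · intro a ha
    simp [σo a ha]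
  · intro b hb
    refine (h3 b).trans (Nat.cast_le.2 (card_le_card ?_))
    intro y hy
    simp only [mem_inter, commonNbhd, mem_filter, mem_univ, true_and, mem_sdiff] at hy ⊢
    obtain ⟨⟨y1, y2⟩, y3⟩ := hy
    refine ⟨y1, fun a ha => ?_⟩
    by_cases haD : a ∈ D
    · simpa [σD a haD] using y3 a ⟨ha, haD⟩
    · have : a ∉ D ∪ D.image f := by
        rw [mem_union, not_or]; exact ⟨haD, disjoint_left.1 hb ha⟩
      simpa [σo a this] using y2 a ⟨ha, haD⟩
  · intro b hb
    rw [not_disjoint_iff] at hb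
    obtain ⟨a', ha'b, ha'P⟩ := hb
    obtain ⟨a, ha, rfl⟩ := mem_image.1 ha'P
    have hD : Disjoint (leftNbrs h b) D := by
      rw [disjoint_left]
      intro a₂ h₂ h₂D
      exact (h1 a ha).2.2 a₂ h₂D (Or.inr ⟨b, mem_leftNbrs.1 h₂, mem_leftNbrs.1 ha'b⟩)
    refine ⟨hD, a, ha, f a, (h1 a ha).2.1, mem_leftNbrs.1 ha'b, ?_⟩
    have hoth : ∀ a₂ ∈ (leftNbrs h b).erase (f a), σ a₂ = a₂ := by
      intro a₂ h₂
      rw [mem_erase] at h₂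
      refine σo _ ?_
      rw [mem_union, not_or]
      refine ⟨disjoint_left.1 hD h₂.2, fun h₃P => ?_⟩
      obtain ⟨a₃, h₃, rfl⟩ := mem_image.1 h₃P
      refine h2 a ha a₃ h₃ (fun e => h₂.1 (e ▸ rfl)) (Or.inr ⟨b, ?_, mem_leftNbrs.1 ha'b⟩)
      exact mem_leftNbrs.1 h₂.2
    conv_lhs => rw [← insert_erase ha'b, commonNbhd_insert]
    have e1 : (hσσ.toPerm.trans φ) (f a) = φ a := by simp [σf a ha]
    rw [e1]
    congr 1
    ext y
    simp only [commonNbhd, mem_filter, mem_univ, true_and]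
    refine forall₂_congr fun a₂ h₂ => ?_
    have : (hσσ.toPerm.trans φ) a₂ = φ a₂ := by simp [hoth a₂ h₂]
    rw [this]

theorem exists_matching_of_expansion {B Y : Type*} [Fintype B] [Fintype Y] (B' : Finset B)
    (Y' : Finset Y) (hcard : B'.card = Y'.card) (F : B → Finset Y) (t₁ t₂ : ℝ)
    (h1 : ∀ b ∈ B', t₁ ≤ (F b ∩ Y').card)
    (h2 : ∀ Z ⊆ Y', t₂ ≤ Z.card → ((B'.filter fun b => Disjoint (F b) Z).card : ℝ) < t₁)
    (h3 : ∀ y ∈ Y', t₂ ≤ (B'.filter fun b => y ∈ F b).card) :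
    ∃ ψ : B' → Y, Function.Injective ψ ∧ ∀ b : B', ψ b ∈ F b ∩ Y' := by
  have hall : ∀ S : Finset B', S.card ≤ (S.biUnion fun b : B' => F b ∩ Y').card := by
    intro S
    by_cases hS : (S.card : ℝ) < t₁
    · rcases S.eq_empty_or_nonempty with rfl | ⟨b, hb⟩
      · simp
      · have e1 : (F b ∩ Y').card ≤ (S.biUnion fun b : B' => F b ∩ Y').card :=
          card_le_card (subset_biUnion_of_mem (fun b : B' => F b ∩ Y') hb)
        have e2 : (S.card : ℝ) ≤ (F b ∩ Y').card := hS.le.trans (h1 b b.2)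
        exact (Nat.cast_le.1 e2).trans e1
    · set N := S.biUnion fun b : B' => F b ∩ Y' with hN
      have hNY : N ⊆ Y' := by
        intro y hy
        obtain ⟨b, -, hb⟩ := mem_biUnion.1 hy
        exact (mem_inter.1 hb).2
      set S' : Finset B := S.map ⟨Subtype.val, Subtype.val_injective⟩ with hS'
      have hS'c : S'.card = S.card := card_map _
      have hS'B : S' ⊆ B' := by
        intro b hb
        obtain ⟨b', -, rfl⟩ := mem_map.1 hb
        exact b'.2
      have hdis : ∀ b ∈ S', ∀ z ∈ Y' \ N, z ∉ F b := by
        intro b hb z hz hzb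
        obtain ⟨b', hb', rfl⟩ := mem_map.1 hb
        rw [mem_sdiff] at hz
        exact hz.2 (mem_biUnion.2 ⟨b', hb', mem_inter.2 ⟨hzb, hz.1⟩⟩)
      have hZ : ((Y' \ N).card : ℝ) < t₂ := by
        by_contra hc
        have e1 := h2 _ sdiff_subset (not_lt.1 hc)
        have e2 : S'.card ≤ (B'.filter fun b => Disjoint (F b) (Y' \ N)).card := by
          refine card_le_card fun b hb => mem_filter.2 ⟨hS'B hb, ?_⟩
          rw [disjoint_left]
          exact fun z hz hz' => hdis b hb z hz' hz
        have e3 : (S'.card : ℝ) ≤ _ := Nat.cast_le.2 e2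
        rw [hS'c] at e3
        exact hS (e3.trans_lt e1)
      rcases (Y' \ N).eq_empty_or_nonempty with he | ⟨z, hz⟩
      · rw [sdiff_eq_empty_iff_subset] at he
        calc S.card = S'.card := hS'c.symm
          _ ≤ B'.card := card_le_card hS'B
          _ = Y'.card := hcard
          _ ≤ N.card := card_le_card he
      · have e1 := h3 z (mem_sdiff.1 hz).1
        have e2 : Disjoint S' (B'.filter fun b => z ∈ F b) := by
          rw [disjoint_left]
          exact fun b hb hb' => hdis b hb z hz (mem_filter.1 hb').2
        have e3 : S'.card + (B'.filter fun b => z ∈ F b).card ≤ B'.card := by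
          rw [← card_union_of_disjoint e2]
          exact card_le_card (union_subset hS'B (filter_subset _ _))
        have e4 : (Y' \ N).card + N.card = Y'.card := card_sdiff_add_card_eq_card hNY
        have e5 : (S'.card : ℝ) + (B'.filter fun b => z ∈ F b).card ≤ Y'.card := by
          rw [← hcard]; exact_mod_cast e3
        have e6 : ((Y' \ N).card : ℝ) + N.card = Y'.card := by exact_mod_cast e4
        rw [hS'c] at e5
        have e7 : (S.card : ℝ) ≤ N.card := by linarith
        exact_mod_cast e7
  exact (Finset.all_card_le_biUnion_card_iff_exists_injective _).1 hall

theorem exists_separated_choice {Y B : Type*} [Fintype B] (E : Finset Y) (forb : Finset B)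
    (conf : B → B → Prop) (hsymm : ∀ b b', conf b b' → conf b' b) (K : ℕ)
    (hK : ∀ b, (univ.filter fun b' => conf b b').card ≤ K)
    (hB : forb.card + E.card * K < Fintype.card B) :
    ∃ g : Y → B, (∀ y ∈ E, g y ∉ forb) ∧
      ∀ y ∈ E, ∀ y' ∈ E, y ≠ y' → ¬ conf (g y) (g y') := by
  induction E using Finset.induction_on with
  | empty =>
    obtain ⟨b⟩ : Nonempty B := Fintype.card_pos_iff.1 (by omega)
    exact ⟨fun _ => b, by simp, by simp⟩
  | insert y E hy ih =>
    rw [card_insert_of_notMem hy, Nat.add_mul] at hB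
    obtain ⟨g, h1, h2⟩ := ih (by omega)
    obtain ⟨b, hb⟩ : ∃ b, b ∉ forb ∪ E.biUnion fun y => univ.filter fun b' => conf (g y) b' := by
      by_contra hcon
      push Not at hcon
      have e1 : Fintype.card B ≤
          (forb ∪ E.biUnion fun y => univ.filter fun b' => conf (g y) b').card :=
        card_le_card fun b _ => hcon b
      have e2 := card_union_le forb (E.biUnion fun y => univ.filter fun b' => conf (g y) b')
      have e3 : (E.biUnion fun y => univ.filter fun b' => conf (g y) b').card ≤ E.card * K :=
        card_biUnion_le_card_mul _ _ _ fun y _ => hK _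
      omega
    simp only [mem_union, mem_biUnion, mem_filter, mem_univ, true_and, not_or, not_exists,
      not_and] at hb
    have hE : ∀ y' ∈ E, Function.update g y b y' = g y' := fun y' h' =>
      Function.update_of_ne (ne_of_mem_of_not_mem h' hy) _ _
    have hs : Function.update g y b y = b := Function.update_self _ _ _
    refine ⟨Function.update g y b, ?_, ?_⟩
    · intro y' h'
      rcases mem_insert.1 h' with rfl | h'
      · rw [hs]; exact hb.1
      · rw [hE y' h']; exact h1 y' h'
    · intro y' h' y'' h'' hne
      rcases mem_insert.1 h' with e | k' <;> rcases mem_insert.1 h'' with e' | k''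
      · exact absurd (e.trans e'.symm) hne
      · rw [e, hs, hE y'' k'']; exact fun hc => hb.2 y'' k'' (hsymm _ _ hc)
      · rw [e', hs, hE y' k']; exact hb.2 y' k'
      · rw [hE y' k', hE y'' k'']; exact h2 y' k' y'' k'' hne

theorem card_filter_leftNbrs_nonempty_le {A B : Type*} [Fintype A] [Fintype B]
    (h : A → B → Prop) (Δ : ℕ) (hA : ∀ a, (univ.filter fun b => h a b).card ≤ Δ)
    (S : Finset A) :
    (univ.filter fun b => ¬ Disjoint (leftNbrs h b) S).card ≤ S.card * Δ := by
  refine (card_le_card ?_).trans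
    (card_biUnion_le_card_mul S (fun a => univ.filter fun b => h a b) Δ fun a _ => hA a)
  intro b hb
  rw [mem_filter, not_disjoint_iff] at hb
  obtain ⟨-, a, ha, haS⟩ := hb
  exact mem_biUnion.2 ⟨a, haS, by simpa using mem_leftNbrs.1 ha⟩

theorem card_rarely_common_le {A B X Y : Type*} [Fintype A] [Fintype B] [Fintype X]
    [Fintype Y] {R : X → Y → Prop} (hBY : Fintype.card B = Fintype.card Y)
    (hAB : Fintype.card A ≤ Fintype.card B) (h : A → B → Prop) (Δ : ℕ)
    (hA : ∀ a, (univ.filter fun b => h a b).card ≤ Δ) (φ : A → X) (κ ζ : ℝ) (hκ : 0 < κ)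
    (hκ1 : κ ≤ 1) (hζ : 0 < ζ) (hζ1 : ζ ≤ 1 / 2)
    (hφ : ∀ Z : Finset Y, ((univ.filter fun b : B =>
      ((commonNbhd R φ (leftNbrs h b) ∩ Z).card : ℝ) <
        κ * Z.card - κ * ζ / 2 * Fintype.card Y).card : ℝ) ≤ ζ * Fintype.card A) :
    ((univ.filter fun y => ((univ.filter fun b => y ∈ commonNbhd R φ (leftNbrs h b)).card : ℝ)
      < κ / 4 * Fintype.card Y).card : ℝ) ≤ 2 * Δ * ζ * Fintype.card A := by
  set E := univ.filter fun y => ((univ.filter fun b =>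
    y ∈ commonNbhd R φ (leftNbrs h b)).card : ℝ) < κ / 4 * Fintype.card Y with hE
  set m : ℝ := (Fintype.card Y : ℝ) with hm
  have hmB : (Fintype.card B : ℝ) = m := by rw [hBY]
  have hm0 : 0 ≤ m := by positivity
  have hkm : (Fintype.card A : ℝ) ≤ m := by rw [← hmB]; exact_mod_cast hAB
  by_cases hmk : m ≤ 2 * Δ * Fintype.card A
  · have key : (E.card : ℝ) ≤ ζ * m := by
      by_contra hcon
      push Not at hcon
      set good : Finset B := univ.filter fun b => ¬ ((commonNbhd R φ (leftNbrs h b) ∩ E).card : ℝ)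
        < κ * E.card - κ * ζ / 2 * m with hgood
      have hg : m - ζ * m ≤ good.card := by
        have e1 := card_filter_add_card_filter_not (s := (univ : Finset B))
          (fun b => ((commonNbhd R φ (leftNbrs h b) ∩ E).card : ℝ)
            < κ * E.card - κ * ζ / 2 * m)
        rw [card_univ] at e1
        have e2 := congrArg (Nat.cast (R := ℝ)) e1
        rw [Nat.cast_add, ← hgood] at e2
        have e3 := hφ E
        have e4 : ζ * Fintype.card A ≤ ζ * m := by gcongr
        linarith
      have hsum1 : good.card * (κ / 2 * E.card) ≤
          ∑ b : B, ((commonNbhd R φ (leftNbrs h b) ∩ E).card : ℝ) := by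
        rw [← nsmul_eq_mul, ← sum_const]
        refine (sum_le_sum fun b hb => ?_).trans
          (sum_le_sum_of_subset_of_nonneg (subset_univ good) fun _ _ _ => Nat.cast_nonneg _)
        have := (mem_filter.1 hb).2
        nlinarith
      have hsum2 : ∑ b : B, ((commonNbhd R φ (leftNbrs h b) ∩ E).card : ℝ) =
          ∑ y ∈ E, ((univ.filter fun b => y ∈ commonNbhd R φ (leftNbrs h b)).card : ℝ) := by
        have e1 : ∀ b : B, (commonNbhd R φ (leftNbrs h b) ∩ E).card =
            ∑ y ∈ E, if y ∈ commonNbhd R φ (leftNbrs h b) then 1 else 0 := by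
          intro b
          rw [← card_filter, inter_comm, ← filter_mem_eq_inter]
        simp only [e1, card_filter]
        push_cast
        rw [sum_comm]
      have hEpos : 0 < (E.card : ℝ) := lt_of_le_of_lt (by positivity) hcon
      have hsum3 : ∑ y ∈ E, ((univ.filter fun b =>
          y ∈ commonNbhd R φ (leftNbrs h b)).card : ℝ) < E.card * (κ / 4 * m) := by
        rw [← nsmul_eq_mul, ← sum_const]
        refine sum_lt_sum_of_nonempty (card_pos.1 (by exact_mod_cast hEpos)) fun y hy => ?_
        exact (mem_filter.1 hy).2
      have e5 : m / 2 * (κ / 2 * E.card) ≤ good.card * (κ / 2 * E.card) := by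
        have : m / 2 ≤ good.card := by nlinarith
        gcongr
      rw [hsum2] at hsum1
      nlinarith
    calc (E.card : ℝ) ≤ ζ * m := key
      _ ≤ ζ * (2 * Δ * Fintype.card A) := by gcongr
      _ = _ := by ring
  · push Not at hmk
    have : E = ∅ := by
      refine filter_eq_empty_iff.2 fun y _ hy => ?_
      have e1 := card_filter_leftNbrs_nonempty_le h Δ hA univ
      have e2 : (univ.filter fun b : B => ¬ ¬ Disjoint (leftNbrs h b) univ) ⊆
          univ.filter fun b => y ∈ commonNbhd R φ (leftNbrs h b) := by
        intro b hb
        simp only [mem_filter, mem_univ, true_and, not_not] at hb ⊢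
        have : leftNbrs h b = ∅ := by
          ext a; simpa using fun ha => disjoint_left.1 hb ha (mem_univ a)
        simp [this, commonNbhd]
      have e3 := card_filter_add_card_filter_not (s := (univ : Finset B))
          (fun b => ¬ Disjoint (leftNbrs h b) univ)
      rw [card_univ] at e1 e3
      have e4 : ((univ.filter fun b : B => ¬ Disjoint (leftNbrs h b) univ).card : ℝ) ≤
        Fintype.card A * Δ := by exact_mod_cast e1
      have e5 := congrArg (Nat.cast (R := ℝ)) e3
      rw [Nat.cast_add] at e5
      have e6 : ((univ.filter fun b : B => ¬ ¬ Disjoint (leftNbrs h b) univ).card : ℝ) ≤ _ :=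
        Nat.cast_le.2 (card_le_card e2)
      nlinarith
    rw [this]
    simp only [card_empty, Nat.cast_zero]
    positivity

theorem card_le_add_of_forall_mem {B : Type*} {S S₁ S₂ S₃ : Finset B}
    (hS : ∀ b ∈ S, b ∈ S₁ ∨ b ∈ S₂ ∨ b ∈ S₃) :
    (S.card : ℝ) ≤ S₁.card + S₂.card + S₃.card := by
  have : S.card ≤ S₁.card + S₂.card + S₃.card := by
    refine (card_le_card (t := S₁ ∪ S₂ ∪ S₃) fun b hb => ?_).trans
      ((card_union_le _ _).trans (Nat.add_le_add_right (card_union_le _ _) _))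
    simpa [or_assoc] using hS b hb
  exact_mod_cast this

set_option maxHeartbeats 1000000 in
theorem exists_bipartite_embedding_of_le {A B X Y : Type*} [Fintype A] [Fintype B] [Fintype X]
    [Fintype Y] {R : X → Y → Prop} {ε δ d c ζ : ℝ} (hR : OneSidedReg R ε δ) (hε : 0 < ε)
    (hd : 0 < d) (hd1 : d ≤ 1) (hc : 0 < c) (hc1 : c ≤ 1) (hdδ : d ≤ δ) (hδ1 : δ ≤ 1)
    (hAX : Fintype.card A = Fintype.card X) (hBY : Fintype.card B = Fintype.card Y)
    (hAB : Fintype.card A ≤ Fintype.card B)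
    (hdegX : ∀ x, d * Fintype.card Y ≤ (univ.filter fun y => R x y).card)
    (hdegY : ∀ y, d * Fintype.card X ≤ (univ.filter fun x => R x y).card)
    (h : A → B → Prop) (Δ : ℕ) (hΔ : 0 < Δ)
    (hA : ∀ a, (univ.filter fun b => h a b).card ≤ Δ) (hB : ∀ b, (leftNbrs h b).card ≤ Δ)
    (LA : A → Finset X) (LB : B → Finset Y)
    (hLA : ∀ a, c * Fintype.card X ≤ (LA a).card) (hLB : ∀ b, c * Fintype.card Y ≤ (LB b).card)
    (hLA' : ((univ.filter fun a => LA a ≠ univ).card : ℝ) ≤ ε * Fintype.card A)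
    (hLB' : ((univ.filter fun b => LB b ≠ univ).card : ℝ) ≤ ε * Fintype.card A)
    (hζ : 100 * Δ ^ 4 * ζ = c * d ^ Δ / 2 * (d / 2) ^ Δ) (hεζ : ε ≤ ζ)
    (hε1 : 4 * Δ * ε ≤ 1) (hε2 : 4 * Δ * ε ≤ (d ^ Δ * ζ / 2) ^ 2 / 2)
    (hε3 : 4 * ((Δ ^ 2 * 2 ^ Δ : ℕ) : ℝ) ^ 2 * (8 * Δ + 1) * ε
      ≤ (ζ / Δ ^ 2) ^ 2 * (d ^ Δ * ζ / 2) ^ 2)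
    (hε4 : 2 * ε ≤ d * (c * d ^ Δ / 2 * (d / 2) ^ Δ)) :
    ∃ (φ : A → X) (ψ : B → Y), Function.Injective φ ∧ Function.Injective ψ ∧
      (∀ a, φ a ∈ LA a) ∧ (∀ b, ψ b ∈ LB b) ∧ ∀ a b, h a b → R (φ a) (ψ b) := by
  rcases Nat.eq_zero_or_pos (Fintype.card A) with hA0 | hApos
  · have := Fintype.card_eq_zero_iff.1 hA0
    have hLBu : ∀ b, LB b = univ := by
      intro b
      by_contra hb
      rw [hA0, Nat.cast_zero, mul_zero] at hLB'
      have : (univ.filter fun b => LB b ≠ univ).card = 0 := by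
        exact_mod_cast le_antisymm hLB' (Nat.cast_nonneg _)
      exact (filter_eq_empty_iff.1 (card_eq_zero.1 this)) (mem_univ b) hb
    exact ⟨isEmptyElim, Fintype.equivOfCardEq hBY, fun a => isEmptyElim a,
      (Fintype.equivOfCardEq hBY).injective, isEmptyElim, fun b => by simp [hLBu], isEmptyElim⟩
  have hΔ1 : (1 : ℝ) ≤ Δ := by exact_mod_cast hΔ
  set κ : ℝ := d ^ Δ with hκ
  have hκ0 : 0 < κ := by positivity
  have hκ1 : κ ≤ 1 := pow_le_one₀ hd.le hd1
  have hκd : κ ≤ d := pow_le_of_le_one hd.le hd1 hΔ.ne'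
  set q : ℝ := (d / 2) ^ Δ with hq
  have hq0 : 0 < q := by positivity
  have hqd : q ≤ d / 2 := pow_le_of_le_one (by positivity) (by linarith) hΔ.ne'
  set c₂ : ℝ := c * κ / 2 * q with hc₂
  have hc₂0 : 0 < c₂ := by positivity
  have hcκ : c * κ ≤ κ := mul_le_of_le_one_left hκ0.le hc1
  have hcκ' : c * κ ≤ c := mul_le_of_le_one_right hc.le hκ1
  have hcκ0 : 0 < c * κ := by positivity
  have b1 : c₂ ≤ κ / 4 := by
    calc c₂ ≤ κ / 2 * (1 / 2) := by rw [hc₂]; gcongr; linarith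
      _ = κ / 4 := by ring
  have b2 : c₂ ≤ c * d / 4 := by
    calc c₂ ≤ c / 2 * (d / 2) := by rw [hc₂]; gcongr
      _ = _ := by ring
  have b3 : c₂ ≤ κ * d / 4 := by
    calc c₂ ≤ κ / 2 * (d / 2) := by rw [hc₂]; gcongr
      _ = _ := by ring
  have hΔsq : (Δ : ℝ) ≤ Δ ^ 2 := le_self_pow₀ hΔ1 (by norm_num)
  have hΔ4 : (1 : ℝ) ≤ Δ ^ 4 := one_le_pow₀ hΔ1
  have hζ0 : 0 < ζ := by
    refine (mul_pos_iff_of_pos_left (a := 100 * (Δ : ℝ) ^ 4) (by positivity)).1 ?_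
    rw [hζ]; positivity
  have z4 : (Δ : ℝ) ^ 4 * ζ = c₂ / 100 := by linarith
  have z3 : (Δ : ℝ) ^ 3 * ζ ≤ c₂ / 100 := by
    rw [← z4]; gcongr; norm_num
  have z2 : (Δ : ℝ) ^ 2 * ζ ≤ c₂ / 100 := by
    rw [← z4]; gcongr; norm_num
  have z1 : (Δ : ℝ) * ζ ≤ c₂ / 100 := by
    refine le_trans ?_ z2
    gcongr
  have z0 : ζ ≤ c₂ / 100 := (le_mul_of_one_le_left hζ0.le hΔ1).trans z1
  have hcd1 : c * d ≤ 1 := mul_le_one₀ hc1 hd.le hd1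
  have hcdd : c * d ≤ d := mul_le_of_le_one_left hd.le hc1
  have hcdc : c * d ≤ c := mul_le_of_le_one_right hc.le hd1
  have hζhalf : ζ ≤ 1 / 2 := by linarith
  have hκζ : 0 < κ * ζ := by positivity
  set γ : ℝ := κ * ζ / 2 with hγ
  have hγd : γ ≤ κ * d / 4 := by
    have : κ * ζ ≤ κ * (d / 2) := by gcongr; linarith
    linarith
  have hκd' : κ * d ≤ κ := mul_le_of_le_one_right hκ0.le hd1
  obtain ⟨φ₀, hφ₀⟩ := exists_quasirandom_bijection hR hε hd hdδ hδ1 hAX h Δ hΔ hA hB γ ζ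
    (by positivity) (by linarith) hζ0 hε1 hε2 hε3
  simp only [← hκ] at hφ₀
  clear_value γ κ q c₂
  set k : ℝ := (Fintype.card A : ℝ) with hk
  set m : ℝ := (Fintype.card Y : ℝ) with hm
  have hkX : (Fintype.card X : ℝ) = k := by rw [hk, hAX]
  have hmB : (Fintype.card B : ℝ) = m := by rw [hm, hBY]
  have hk0 : 0 < k := by rw [hk]; exact_mod_cast hApos
  have hkm : k ≤ m := by rw [← hmB]; exact Nat.cast_le.2 hAB
  have hm0 : 0 < m := hk0.trans_le hkm
  have hεk : ε * k ≤ ζ * k := by gcongr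
  -- vertices of `Y` lying in few of the candidate sets
  set E : Finset Y := univ.filter fun y => ((univ.filter fun b =>
    y ∈ commonNbhd R φ₀ (leftNbrs h b)).card : ℝ) < κ / 4 * m with hE
  have hEc : (E.card : ℝ) ≤ 2 * Δ * ζ * k :=
    card_rarely_common_le hBY hAB h Δ hA φ₀ κ ζ hκ0 hκ1 hζ0 hζhalf fun Z => by
      rw [← hγ]; exact (hφ₀ Z).1
  clear_value E
  have hEm : (E.card : ℝ) ≤ 2 * (c₂ / 100) * m := by
    calc (E.card : ℝ) ≤ 2 * (Δ * ζ) * k := by linarith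
      _ ≤ _ := by gcongr
  set A₀ : Finset A := univ.filter fun a => LA a ≠ univ with hA₀
  set B₀ : Finset B := univ.filter fun b => LB b ≠ univ with hB₀
  set B₁ : Finset B := univ.filter fun b => ((commonNbhd R φ₀ (leftNbrs h b) ∩ univ).card : ℝ)
    < κ * (univ : Finset Y).card - γ * m with hB₁
  clear_value A₀ B₀ B₁
  have hB₁c : (B₁.card : ℝ) ≤ ζ * k := by rw [hB₁]; exact (hφ₀ univ).1
  have hfinD : ∀ D' : Finset A, ((univ.filter fun b => ¬ Disjoint (leftNbrs h b) D').card : ℝ)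
      ≤ D'.card * Δ := fun D' => by
    exact_mod_cast card_filter_leftNbrs_nonempty_le h Δ hA D'
  obtain ⟨g, hg1, hg2⟩ := exists_separated_choice E
    (B₀ ∪ univ.filter fun b => ¬ Disjoint (leftNbrs h b) A₀)
    (fun b b' => b = b' ∨ ∃ a, h a b ∧ h a b') (by
      rintro b b' (e | ⟨a, ha, ha'⟩)
      · exact Or.inl e.symm
      · exact Or.inr ⟨a, ha', ha⟩) (1 + Δ ^ 2)
    (fun b => by
      convert card_filter_near_le (fun b a => h a b) Δ hB (fun a => by
        simpa [leftNbrs] using hA a) b) (by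
      have e1 := card_union_le B₀ (univ.filter fun b => ¬ Disjoint (leftNbrs h b) A₀)
      have e2 : ((B₀ ∪ univ.filter fun b => ¬ Disjoint (leftNbrs h b) A₀).card : ℝ) ≤
        B₀.card + (univ.filter fun b => ¬ Disjoint (leftNbrs h b) A₀).card := by
        exact_mod_cast e1
      have e3 := hfinD A₀
      have e4 : (A₀.card : ℝ) * Δ ≤ (ζ * k) * Δ := by gcongr; linarith
      have e5 : (E.card : ℝ) * (1 + Δ ^ 2) ≤ (2 * Δ * ζ * k) * (1 + Δ ^ 2) := by gcongr
      have e6 : ((B₀ ∪ univ.filter fun b => ¬ Disjoint (leftNbrs h b) A₀).card : ℝ)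
          + E.card * (1 + Δ ^ 2) < Fintype.card B := by
        rw [hmB]
        refine lt_of_lt_of_le ?_ hkm
        calc _ ≤ (ζ + Δ * ζ + 2 * (Δ * ζ) + 2 * (Δ ^ 3 * ζ)) * k := by linarith
          _ < 1 * k := by gcongr; linarith
          _ = k := one_mul k
      exact_mod_cast e6)
  have hginj : Set.InjOn g E := by
    intro y hy y' hy' e
    by_contra hne
    exact hg2 y hy y' hy' hne (Or.inl e)
  have hgB₀ : ∀ y ∈ E, LB (g y) = univ := by
    intro y hy
    have := hg1 y hy
    simp only [mem_union, not_or, hB₀, mem_filter, mem_univ, true_and, not_not] at this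
    exact this.1
  have hgA₀ : ∀ y ∈ E, ∀ a, h a (g y) → LA a = univ := by
    intro y hy a ha
    have := hg1 y hy
    simp only [mem_union, not_or, mem_filter, mem_univ, true_and, not_not] at this
    have h2 := disjoint_left.1 this.2 (mem_leftNbrs.2 ha)
    simpa [hA₀] using h2
  set D : Finset A := A₀ ∪ B₀.biUnion (leftNbrs h) ∪ B₁.biUnion (leftNbrs h) ∪
    E.biUnion (fun y => leftNbrs h (g y)) with hD
  have hDA₀ : A₀ ⊆ D := hD ▸ (subset_union_left.trans subset_union_left).trans subset_union_left
  have hDB₀ : B₀.biUnion (leftNbrs h) ⊆ D :=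
    hD ▸ (subset_union_right.trans subset_union_left).trans subset_union_left
  have hDB₁ : B₁.biUnion (leftNbrs h) ⊆ D := hD ▸ subset_union_right.trans subset_union_left
  have hDE : E.biUnion (fun y => leftNbrs h (g y)) ⊆ D := hD ▸ subset_union_right
  clear_value D
  have hDc : (D.card : ℝ) ≤ 5 * (Δ ^ 2 * ζ) * k := by
    have e1 : (B₀.biUnion (leftNbrs h)).card ≤ B₀.card * Δ :=
      card_biUnion_le_card_mul _ _ _ fun b _ => hB b
    have e2 : (B₁.biUnion (leftNbrs h)).card ≤ B₁.card * Δ :=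
      card_biUnion_le_card_mul _ _ _ fun b _ => hB b
    have e3 : (E.biUnion fun y => leftNbrs h (g y)).card ≤ E.card * Δ :=
      card_biUnion_le_card_mul _ _ _ fun b _ => hB _
    have e4 : D.card ≤ A₀.card + B₀.card * Δ + B₁.card * Δ + E.card * Δ := by
      rw [hD]
      have f1 := card_union_le (A₀ ∪ B₀.biUnion (leftNbrs h) ∪ B₁.biUnion (leftNbrs h))
        (E.biUnion (fun y => leftNbrs h (g y)))
      have f2 := card_union_le (A₀ ∪ B₀.biUnion (leftNbrs h)) (B₁.biUnion (leftNbrs h))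
      have f3 := card_union_le A₀ (B₀.biUnion (leftNbrs h))
      omega
    have e5 : (D.card : ℝ) ≤ A₀.card + B₀.card * Δ + B₁.card * Δ + E.card * Δ := by
      exact_mod_cast e4
    have e6 : (B₀.card : ℝ) * Δ ≤ (ζ * k) * Δ := by gcongr; linarith
    have e7 : (B₁.card : ℝ) * Δ ≤ (ζ * k) * Δ := by gcongr
    have e8 : (E.card : ℝ) * Δ ≤ (2 * Δ * ζ * k) * Δ := by gcongr
    have e9 : (A₀.card : ℝ) ≤ ζ * k := by linarith
    have hζk : 0 < ζ * k := by positivity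
    have e10 : (ζ * k) * Δ ≤ (ζ * k) * Δ ^ 2 := by gcongr
    have e11 : (ζ * k) ≤ (ζ * k) * Δ ^ 2 := le_mul_of_one_le_right hζk.le (one_le_pow₀ hΔ1)
    linarith
  set L : A → Finset X := fun a => if hy : ∃ y ∈ E, h a (g y)
    then univ.filter fun x => R x hy.choose else LA a with hL
  set W : A → Finset A := fun a => univ.filter fun a' => ∃ b, h a' b ∧
    ((commonNbhd R φ₀ ((leftNbrs h b).erase a') ∩ univ.filter fun y => R (φ₀ a) y).card : ℝ) <
      κ * (univ.filter fun y => R (φ₀ a) y).card - γ * m with hW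
  clear_value L W
  have hcm : c * κ / 2 * m ≤ c * m := by gcongr; linarith
  obtain ⟨φ, P, hP, hφD, hφo, hφ1, hφ2⟩ := exists_switched_bijection hR hd hd1 hdδ h Δ hA hB φ₀ D L
    LB W (c * κ / 2) (c * d * k) (ζ * k) (by positivity)
    (fun a _ => by
      simp only [hL]
      split_ifs with hy
      · refine le_trans ?_ (hdegY _)
        rw [hkX]
        gcongr
      · refine le_trans ?_ (hLA a)
        rw [hkX]
        gcongr)
    (fun a _ => by rw [hW]; exact (hφ₀ _).2)
    (fun b => by
      have hsub : ∀ {S : Finset B}, S.biUnion (leftNbrs h) ⊆ D → b ∈ S →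
          leftNbrs h b \ D = ∅ := fun hS hb =>
        sdiff_eq_empty_iff_subset.2 ((subset_biUnion_of_mem _ hb).trans hS)
      by_cases hb0 : b ∈ B₀
      · rw [hsub hDB₀ hb0]
        simpa [commonNbhd] using hcm.trans (hLB b)
      · have hLBb : LB b = univ := by simpa [hB₀] using hb0
        rw [hLBb, univ_inter]
        by_cases hb1 : b ∈ B₁
        · rw [hsub hDB₁ hb1]
          have : c * κ / 2 * m ≤ 1 * m := by gcongr; linarith
          simpa [commonNbhd] using this
        · have e1 : κ * m - γ * m ≤ (commonNbhd R φ₀ (leftNbrs h b)).card := by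
            simpa [hB₁, hm] using hb1
          have e2 : (commonNbhd R φ₀ (leftNbrs h b)).card ≤
              (commonNbhd R φ₀ (leftNbrs h b \ D)).card := by
            refine card_le_card fun y hy => ?_
            simp only [commonNbhd, mem_filter, mem_univ, true_and, mem_sdiff] at hy ⊢
            exact fun a ha => hy a ha.1
          refine (e1.trans (Nat.cast_le.2 e2)).trans' ?_
          rw [← sub_mul]
          gcongr
          linarith)
    (by rw [← hq, ← hc₂]; exact hε4)
    (by
      rw [hkX]
      have e1 : 2 * (D.card : ℝ) * (1 + Δ ^ 2) ≤ 2 * (5 * (Δ ^ 2 * ζ) * k) * (1 + Δ ^ 2) := by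
        gcongr
      have e2 : Δ * (ε * k) ≤ Δ * (ζ * k) := by gcongr
      calc _ ≤ (10 * (Δ ^ 2 * ζ) + 10 * (Δ ^ 4 * ζ) + ζ + Δ * ζ) * k := by linarith
        _ < c * d * k := by gcongr; linarith)
  have hA₀D : ∀ a, a ∉ D → LA a = univ := by
    intro a ha
    by_contra hcon
    exact ha (hDA₀ (by simp [hA₀, hcon]))
  have hB₀D : ∀ b, LB b ≠ univ → leftNbrs h b ⊆ D := fun b hb =>
    (subset_biUnion_of_mem (leftNbrs h) (by simp [hB₀, hb])).trans hDB₀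
  have hφLA : ∀ a, φ a ∈ LA a := by
    intro a
    by_cases haD : a ∈ D
    · have := hφD a haD
      simp only [hL] at this
      split_ifs at this with hy
      · obtain ⟨y, hy, hay⟩ := hy
        rw [hgA₀ y hy a hay]
        exact mem_univ _
      · exact this
    · rw [hA₀D a haD]; exact mem_univ _
  have hφE : ∀ y ∈ E, ∀ a, h a (g y) → R (φ a) y := by
    intro y hy a ha
    have haD : a ∈ D := hDE (mem_biUnion.2 ⟨y, hy, mem_leftNbrs.2 ha⟩)
    have := hφD a haD
    simp only [hL] at this
    have hex : ∃ y ∈ E, h a (g y) := ⟨y, hy, ha⟩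
    rw [dif_pos hex] at this
    have hyy : hex.choose = y := by
      by_contra hne
      exact hg2 _ hex.choose_spec.1 y hy hne (Or.inr ⟨a, hex.choose_spec.2, ha⟩)
    rw [hyy] at this
    simpa using this
  set F : B → Finset Y := fun b => LB b ∩ commonNbhd R φ (leftNbrs h b) with hF
  clear_value F
  have hFc : ∀ b, c₂ * m ≤ (F b).card := by
    intro b
    by_cases hbP : Disjoint (leftNbrs h b) P
    · rw [hc₂, hq, hF]; exact hφ1 b hbP
    · obtain ⟨hbD, a, ha, a', ha', ha'b, heq⟩ := hφ2 b hbP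
      have hLBb : LB b = univ := by
        by_contra hcon
        exact disjoint_left.1 hbD (mem_leftNbrs.2 ha'b)
          (hB₀D b hcon (mem_leftNbrs.2 ha'b))
      simp only [hF, hLBb, univ_inter, heq]
      simp only [hW, mem_filter, mem_univ, true_and, not_exists, not_and, not_lt] at ha'
      have e1 := ha' b ha'b
      rw [← filter_mem_eq_inter] at e1
      simp only [mem_filter, mem_univ, true_and] at e1
      refine le_trans ?_ e1
      have e2 : κ * (d * m) ≤ κ * (univ.filter fun y => R (φ₀ a) y).card := by
        gcongr
        exact hdegX _
      have e3 : γ * m ≤ κ * d / 4 * m := by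
        gcongr
      have e4 : c₂ * m ≤ κ * d / 4 * m := by gcongr
      have e5 : 0 < κ * d * m := by positivity
      linarith
  set tch : Finset B := univ.filter fun b => ¬ Disjoint (leftNbrs h b) (D ∪ P) with htch
  clear_value tch
  have htchc : (tch.card : ℝ) ≤ 10 * (c₂ / 100) * m := by
    rw [htch]
    refine (hfinD _).trans ?_
    have e1 : ((D ∪ P).card : ℝ) ≤ D.card + P.card := by exact_mod_cast card_union_le D P
    have e2 : (P.card : ℝ) ≤ D.card := by exact_mod_cast hP
    calc ((D ∪ P).card : ℝ) * Δ ≤ (10 * (Δ ^ 2 * ζ) * k) * Δ := by gcongr; linarith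
      _ = 10 * (Δ ^ 3 * ζ) * k := by ring
      _ ≤ _ := by gcongr
  have hB₀m : (B₀.card : ℝ) ≤ c₂ / 100 * m := by
    calc (B₀.card : ℝ) ≤ ζ * k := by linarith
      _ ≤ _ := by gcongr
  have huntouched : ∀ b, b ∉ B₀ → b ∉ tch → F b = commonNbhd R φ₀ (leftNbrs h b) := by
    intro b hb0 hbt
    have hLBb : LB b = univ := by simpa [hB₀] using hb0
    simp only [hF, hLBb, univ_inter]
    have hdj : Disjoint (leftNbrs h b) (D ∪ P) := by simpa [htch] using hbt
    ext y
    simp only [commonNbhd, mem_filter, mem_univ, true_and]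
    refine forall₂_congr fun a ha => ?_
    rw [hφo a (disjoint_left.1 hdj ha)]
  obtain ⟨ψ, hψ, hψF⟩ := exists_matching_of_expansion (E.image g)ᶜ Eᶜ
    (by rw [card_compl, card_compl, hBY, card_image_of_injOn hginj]) F (c₂ / 2 * m) (ζ * m)
    (fun b _ => by
      have e1 : (F b).card ≤ (F b ∩ Eᶜ).card + E.card := by
        refine (card_le_card (t := (F b ∩ Eᶜ) ∪ E) fun y hy => ?_).trans (card_union_le _ _)
        by_cases hyE : y ∈ E
        · exact mem_union_right _ hyE
        · exact mem_union_left _ (mem_inter.2 ⟨hy, mem_compl.2 hyE⟩)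
      have e2 : ((F b).card : ℝ) ≤ (F b ∩ Eᶜ).card + E.card := by exact_mod_cast e1
      have := hFc b
      linarith [mul_pos hc₂0 hm0])
    (fun Z _ hZ => by
      have e1 := card_le_add_of_forall_mem (S := (E.image g)ᶜ.filter fun b => Disjoint (F b) Z)
        (S₁ := B₀) (S₂ := tch) (S₃ := univ.filter fun b : B =>
          ((commonNbhd R φ₀ (leftNbrs h b) ∩ Z).card : ℝ) < κ * Z.card - γ * m) (by
          intro b hb
          by_contra hcon
          simp only [not_or] at hcon
          refine hcon.2.2 (mem_filter.2 ⟨mem_univ _, ?_⟩)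
          rw [← huntouched b hcon.1 hcon.2.1, disjoint_iff_inter_eq_empty.1 (mem_filter.1 hb).2]
          rw [card_empty, Nat.cast_zero, hγ]
          have : κ * (ζ * m) ≤ κ * Z.card := by gcongr
          linarith [mul_pos hκζ hm0])
      have e2 := (hφ₀ Z).1
      have e3 : ζ * k ≤ c₂ / 100 * m := by gcongr
      linarith [mul_pos hc₂0 hm0])
    (fun y hy => by
      have e0 : κ / 4 * m ≤ (univ.filter fun b => y ∈ commonNbhd R φ₀ (leftNbrs h b)).card := by
        simpa [hE] using hy
      have e1 := card_le_add_of_forall_mem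
        (S := univ.filter fun b => y ∈ commonNbhd R φ₀ (leftNbrs h b))
        (S₁ := (E.image g)ᶜ.filter fun b => y ∈ F b) (S₂ := tch ∪ B₀) (S₃ := E.image g) (by
          intro b hb
          by_contra hcon
          simp only [not_or, mem_union] at hcon
          refine hcon.1 (mem_filter.2 ⟨mem_compl.2 hcon.2.2, ?_⟩)
          rw [huntouched b hcon.2.1.2 hcon.2.1.1]
          exact (mem_filter.1 hb).2)
      have e2 : ((tch ∪ B₀).card : ℝ) ≤ tch.card + B₀.card := by
        exact_mod_cast card_union_le _ _
      have e3 : ((E.image g).card : ℝ) ≤ E.card := by exact_mod_cast card_image_le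
      have e4 : ζ * m ≤ c₂ / 100 * m := by gcongr
      have e5 : c₂ * m ≤ κ / 4 * m := by gcongr
      linarith [mul_pos hc₂0 hm0])
  have hψF' : ∀ b : ((E.image g)ᶜ : Finset B), ψ b ∈ LB b ∩ commonNbhd R φ (leftNbrs h b) :=
      fun b => by
    simpa only [hF] using (mem_inter.1 (hψF b)).1
  have hmemC : ∀ b, b ∉ (E.image g)ᶜ → ∃ y ∈ E, g y = b := by
    intro b hb
    simpa using hb
  refine ⟨φ, fun b => if hb : b ∈ (E.image g)ᶜ then ψ ⟨b, hb⟩ else (hmemC b hb).choose,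
    φ.injective, ?_, hφLA, ?_, ?_⟩
  · intro b b' e
    by_cases hb : b ∈ (E.image g)ᶜ <;> by_cases hb' : b' ∈ (E.image g)ᶜ
    · simp only [dif_pos hb, dif_pos hb'] at e
      simpa using hψ e
    · simp only [dif_pos hb, dif_neg hb'] at e
      have h1 := hψF ⟨b, hb⟩
      rw [e] at h1
      exact absurd (hmemC b' hb').choose_spec.1 (mem_compl.1 (mem_inter.1 h1).2)
    · simp only [dif_neg hb, dif_pos hb'] at e
      have h1 := hψF ⟨b', hb'⟩
      rw [← e] at h1
      exact absurd (hmemC b hb).choose_spec.1 (mem_compl.1 (mem_inter.1 h1).2)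
    · simp only [dif_neg hb, dif_neg hb'] at e
      rw [← (hmemC b hb).choose_spec.2, e, (hmemC b' hb').choose_spec.2]
  · intro b
    by_cases hb : b ∈ (E.image g)ᶜ
    · simp only [dif_pos hb]
      exact (mem_inter.1 (hψF' ⟨b, hb⟩)).1
    · simp only [dif_neg hb]
      obtain ⟨h1, h2⟩ := (hmemC b hb).choose_spec
      have := hgB₀ _ h1
      rw [h2] at this
      rw [this]
      exact mem_univ _
  · intro a b hab
    by_cases hb : b ∈ (E.image g)ᶜ
    · simp only [dif_pos hb]
      have := (mem_inter.1 (hψF' ⟨b, hb⟩)).2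
      simp only [commonNbhd, mem_filter, mem_univ, true_and] at this
      exact this a (mem_leftNbrs.2 hab)
    · simp only [dif_neg hb]
      obtain ⟨h1, h2⟩ := (hmemC b hb).choose_spec
      exact hφE _ h1 a (by rw [h2]; exact hab)

end

section
open scoped Classical
open Finset hiding dens
open Filter Topology

theorem OneSidedReg.mono {X Y : Type*} [Fintype X] [Fintype Y] {R : X → Y → Prop} {ε ε' δ : ℝ}
    (hR : OneSidedReg R ε δ) (hε : ε ≤ ε') : OneSidedReg R ε' δ := by
  intro Z
  refine (Nat.cast_le.2 (card_le_card ?_)).trans ((hR Z).trans (by gcongr))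
  intro x hx
  simp only [mem_filter, mem_univ, true_and] at hx ⊢
  exact lt_of_le_of_lt (by gcongr) hx

theorem eventually_mul_le (a : ℝ) {b : ℝ} (hb : 0 < b) : ∀ᶠ ε in 𝓝[>] (0 : ℝ), a * ε ≤ b := by
  have : Tendsto (fun ε : ℝ => a * ε) (𝓝[>] 0) (𝓝 (a * 0)) :=
    ((continuous_const.mul continuous_id).tendsto 0).mono_left nhdsWithin_le_nhds
  rw [mul_zero] at this
  exact (this.eventually (gt_mem_nhds hb)).mono fun _ h => le_of_lt h

theorem card_filter_sum_le {A E : Type*} [Fintype A] [Fintype E] (p : A ⊕ E → Prop)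
    (q : A → Prop) [DecidablePred p] [DecidablePred q] (hq : ∀ a, p (Sum.inl a) → q a)
    (hp : ∀ e, ¬ p (Sum.inr e)) : (univ.filter p).card ≤ (univ.filter q).card := by
  rw [← card_map (Function.Embedding.inl : A ↪ A ⊕ E)]
  refine card_le_card fun x hx => ?_
  rcases x with a | e
  · simpa using hq a (mem_filter.1 hx).2
  · exact absurd (mem_filter.1 hx).2 (hp e)

theorem exists_bipartite_embedding_of_card_le {d c : ℝ} (hd : 0 < d) (hd1 : d ≤ 1) (hc : 0 < c)
    (hc1 : c ≤ 1) (Δ : ℕ) (hΔ : 0 < Δ) : ∃ ε : ℝ, 0 < ε ∧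
    ∀ (A B X Y : Type) [Fintype A] [Fintype B] [Fintype X] [Fintype Y] (R : X → Y → Prop) (δ : ℝ)
    (h : A → B → Prop) (LA : A → Finset X) (LB : B → Finset Y),
    OneSidedReg R ε δ → d ≤ δ → δ ≤ 1 →
    Fintype.card A ≤ Fintype.card X → Fintype.card B ≤ Fintype.card Y →
    Fintype.card X ≤ Fintype.card Y →
    (∀ x, d * Fintype.card Y ≤ (univ.filter fun y => R x y).card) →
    (∀ y, d * Fintype.card X ≤ (univ.filter fun x => R x y).card) →
    (∀ a, (univ.filter fun b => h a b).card ≤ Δ) →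
    (∀ b, (univ.filter fun a => h a b).card ≤ Δ) →
    (∀ a, c * Fintype.card X ≤ (LA a).card) → (∀ b, c * Fintype.card Y ≤ (LB b).card) →
    ((univ.filter fun a => LA a ≠ univ).card : ℝ) ≤ ε * Fintype.card X →
    ((univ.filter fun b => LB b ≠ univ).card : ℝ) ≤ ε * Fintype.card X →
    ∃ (φ : A → X) (ψ : B → Y), Function.Injective φ ∧ Function.Injective ψ ∧
      (∀ a, φ a ∈ LA a) ∧ (∀ b, ψ b ∈ LB b) ∧ ∀ a b, h a b → R (φ a) (ψ b) := by
  set ζ : ℝ := c * d ^ Δ / 2 * (d / 2) ^ Δ / (100 * Δ ^ 4) with hζ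
  have hΔ' : (0 : ℝ) < Δ := by exact_mod_cast hΔ
  have hζ0 : 0 < ζ := by positivity
  obtain ⟨ε, e1, e2, e3, e4, e5, hε⟩ := ((eventually_mul_le 1 hζ0).and <|
    (eventually_mul_le (4 * Δ) one_pos).and <|
    (eventually_mul_le (4 * Δ) (b := (d ^ Δ * ζ / 2) ^ 2 / 2) (by positivity)).and <|
    (eventually_mul_le (4 * ((Δ ^ 2 * 2 ^ Δ : ℕ) : ℝ) ^ 2 * (8 * Δ + 1))
      (b := (ζ / Δ ^ 2) ^ 2 * (d ^ Δ * ζ / 2) ^ 2) (by positivity)).and <|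
    (eventually_mul_le 2 (b := d * (c * d ^ Δ / 2 * (d / 2) ^ Δ)) (by positivity)).and
      eventually_mem_nhdsWithin).exists
  refine ⟨ε, hε, ?_⟩
  intro A B X Y _ _ _ _ R δ h LA LB hR hdδ hδ1 hAX hBY hXY hdX hdY hA hB hLA hLB hLA' hLB'
  set A' := A ⊕ Fin (Fintype.card X - Fintype.card A) with hA'
  set B' := B ⊕ Fin (Fintype.card Y - Fintype.card B) with hB'
  have cA : Fintype.card A' = Fintype.card X := by simp [hA', Fintype.card_sum]; omega
  have cB : Fintype.card B' = Fintype.card Y := by simp [hB', Fintype.card_sum]; omega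
  obtain ⟨h', hh'⟩ : ∃ h' : A' → B' → Prop, ∀ a' b', h' a' b' ↔
    ∃ a b, a' = Sum.inl a ∧ b' = Sum.inl b ∧ h a b := ⟨_, fun _ _ => Iff.rfl⟩
  let LA' : A' → Finset X := Sum.elim LA fun _ => univ
  let LB' : B' → Finset Y := Sum.elim LB fun _ => univ
  obtain ⟨φ, ψ, h1, h2, h3, h4, h5⟩ := exists_bipartite_embedding_of_le (A := A') (B := B')
    (ζ := ζ) hR hε hd hd1 hc hc1 hdδ hδ1 cA cB (by rw [cA, cB]; exact hXY) hdX hdY h' Δ hΔ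
    (by
      rintro (a | a)
      · refine (card_filter_sum_le _ (h a) ?_ ?_).trans (hA a)
        · intro b hab
          obtain ⟨_, _, e, e', hab⟩ := (hh' _ _).1 hab
          rwa [Sum.inl_injective e, Sum.inl_injective e']
        · intro e; simp [hh']
      · simp [hh'])
    (by
      rintro (b | b)
      · refine (card_filter_sum_le _ (fun a => h a b) ?_ ?_).trans (hB b)
        · intro b hab
          obtain ⟨_, _, e, e', hab⟩ := (hh' _ _).1 hab
          rwa [Sum.inl_injective e, Sum.inl_injective e']
        · intro e; simp [hh']
      · simp [hh', leftNbrs])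
    LA' LB'
    (by
      rintro (a | a)
      · exact hLA a
      · simp only [LA', Sum.elim_inr, card_univ]
        exact mul_le_of_le_one_left (by positivity) hc1)
    (by
      rintro (a | a)
      · exact hLB a
      · simp only [LB', Sum.elim_inr, card_univ]
        exact mul_le_of_le_one_left (by positivity) hc1)
    (by
      rw [cA]
      refine le_trans (Nat.cast_le.2 ?_) hLA'
      exact card_filter_sum_le _ _ (fun _ ha => ha) fun _ ha => ha rfl)
    (by
      rw [cA]
      refine le_trans (Nat.cast_le.2 ?_) hLB'
      exact card_filter_sum_le _ _ (fun _ ha => ha) fun _ ha => ha rfl)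
    (by rw [hζ]; field_simp) (by linarith) e2 e3 e4 e5
  exact ⟨φ ∘ Sum.inl, ψ ∘ Sum.inl, h1.comp Sum.inl_injective, h2.comp Sum.inl_injective,
    fun a => h3 (Sum.inl a), fun b => h4 (Sum.inl b),
    fun a b hab => h5 _ _ ((hh' _ _).2 ⟨a, b, rfl, rfl, hab⟩)⟩

/-- A bipartite blow-up lemma with image restrictions on few vertices. -/
theorem exists_bipartite_embedding {d c : ℝ} (hd : 0 < d) (hd1 : d ≤ 1) (hc : 0 < c)
    (hc1 : c ≤ 1) (Δ : ℕ) (hΔ : 0 < Δ) : ∃ ε : ℝ, 0 < ε ∧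
    ∀ (A B X Y : Type) [Fintype A] [Fintype B] [Fintype X] [Fintype Y] (R : X → Y → Prop) (δ : ℝ)
    (h : A → B → Prop) (LA : A → Finset X) (LB : B → Finset Y),
    OneSidedReg R ε δ → OneSidedReg (fun y x => R x y) ε δ → d ≤ δ → δ ≤ 1 →
    Fintype.card A ≤ Fintype.card X → Fintype.card B ≤ Fintype.card Y →
    (∀ x, d * Fintype.card Y ≤ (univ.filter fun y => R x y).card) →
    (∀ y, d * Fintype.card X ≤ (univ.filter fun x => R x y).card) →
    (∀ a, (univ.filter fun b => h a b).card ≤ Δ) →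
    (∀ b, (univ.filter fun a => h a b).card ≤ Δ) →
    (∀ a, c * Fintype.card X ≤ (LA a).card) → (∀ b, c * Fintype.card Y ≤ (LB b).card) →
    ((univ.filter fun a => LA a ≠ univ).card : ℝ) ≤
      ε * min (Fintype.card X : ℝ) (Fintype.card Y) →
    ((univ.filter fun b => LB b ≠ univ).card : ℝ) ≤
      ε * min (Fintype.card X : ℝ) (Fintype.card Y) →
    ∃ (φ : A → X) (ψ : B → Y), Function.Injective φ ∧ Function.Injective ψ ∧
      (∀ a, φ a ∈ LA a) ∧ (∀ b, ψ b ∈ LB b) ∧ ∀ a b, h a b → R (φ a) (ψ b) := by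
  obtain ⟨ε, hε, H⟩ := exists_bipartite_embedding_of_card_le hd hd1 hc hc1 Δ hΔ
  refine ⟨ε, hε, ?_⟩
  intro A B X Y _ _ _ _ R δ h LA LB hR hR' hdδ hδ1 hAX hBY hdX hdY hA hB hLA hLB hLA' hLB'
  rcases le_total (Fintype.card X) (Fintype.card Y) with hXY | hXY
  · rw [min_eq_left (by exact_mod_cast hXY)] at hLA' hLB'
    exact H A B X Y R δ h LA LB hR hdδ hδ1 hAX hBY hXY hdX hdY hA hB hLA hLB hLA' hLB'
  · rw [min_eq_right (by exact_mod_cast hXY)] at hLA' hLB'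
    obtain ⟨ψ, φ, h1, h2, h3, h4, h5⟩ := H B A Y X (fun y x => R x y) δ (fun b a => h a b) LB LA hR'
      hdδ hδ1 hBY hAX hXY hdY hdX hB hA hLB hLA hLB' hLA'
    exact ⟨φ, ψ, h2, h1, h4, h3, fun a b => h5 b a⟩

theorem dens_mul_card_mul_card {V : Type*} (G : SimpleGraph V) (A B : Finset V) :
    dens G A B * (A.card * B.card) = ∑ a ∈ A, ((B.filter fun b => G.Adj a b).card : ℝ) := by
  have h1 : {p : V × V | p.1 ∈ A ∧ p.2 ∈ B ∧ G.Adj p.1 p.2} =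
      ((A ×ˢ B).filter fun p => G.Adj p.1 p.2 : Finset (V × V)) := by
    ext p; simp [and_assoc]
  have h2 : ((A ×ˢ B).filter fun p => G.Adj p.1 p.2).card =
      ∑ a ∈ A, (B.filter fun b => G.Adj a b).card := by
    simp only [card_filter]
    rw [sum_product]
  rw [dens, h1, Set.ncard_coe_finset, h2]
  push_cast
  by_cases h0 : (A.card : ℝ) * B.card = 0
  · rw [h0, mul_zero]
    rcases mul_eq_zero.1 h0 with h | h
    · rw [Nat.cast_eq_zero, card_eq_zero] at h
      simp [h]
    · rw [Nat.cast_eq_zero, card_eq_zero] at h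
      simp [h]
  · exact div_mul_cancel₀ _ h0

theorem pair_dens_nonneg {V : Type*} (G : SimpleGraph V) (A B : Finset V) : 0 ≤ dens G A B := by
  unfold dens; positivity

theorem pair_dens_le_one {V : Type*} (G : SimpleGraph V) (A B : Finset V) : dens G A B ≤ 1 := by
  rcases (Nat.cast_nonneg (α := ℝ) (A.card * B.card)).eq_or_lt with h0 | h0
  · push_cast at h0
    simp [dens, ← h0]
  · push_cast at h0
    refine le_of_mul_le_mul_right ?_ h0
    rw [dens_mul_card_mul_card, one_mul, ← nsmul_eq_mul, ← sum_const]
    exact sum_le_sum fun a _ => Nat.cast_le.2 (card_le_card (filter_subset _ _))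

theorem pair_dens_comm {V : Type*} (G : SimpleGraph V) (A B : Finset V) :
    dens G A B = dens G B A := by
  unfold dens
  rw [mul_comm (A.card : ℝ)]
  congr 2
  refine Set.ncard_congr (fun p _ => p.swap) ?_ ?_ ?_
  · rintro p ⟨h1, h2, h3⟩
    exact ⟨h2, h1, h3.symm⟩
  · rintro p q _ _ h
    exact Prod.swap_injective h
  · rintro p ⟨h1, h2, h3⟩
    exact ⟨p.swap, ⟨h2, h1, h3.symm⟩, Prod.swap_swap p⟩

/-- In a regular pair almost all vertices have about the expected degree into any given set. -/
theorem IsRegPair.card_atypical_le {V : Type*} {G : SimpleGraph V} {ε : ℝ} {A B : Finset V}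
    (hG : IsRegPair G ε A B) (hε : 0 < ε) {Z : Finset V} (hZ : Z ⊆ B) :
    ((A.filter fun a => ε * B.card <
      |((Z.filter fun b => G.Adj a b).card : ℝ) - dens G A B * Z.card|).card : ℝ)
      ≤ 2 * ε * A.card := by
  have hδ0 := pair_dens_nonneg G A B
  have hδ1 := pair_dens_le_one G A B
  set δ := dens G A B with hδ
  have hdegle : ∀ a, ((Z.filter fun b => G.Adj a b).card : ℝ) ≤ Z.card := fun a =>
    Nat.cast_le.2 (card_le_card (filter_subset _ _))
  by_cases hZc : (Z.card : ℝ) ≤ ε * B.card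
  · rw [filter_eq_empty_iff.2]
    · simp; positivity
    · intro a _
      rw [not_lt, abs_le]
      have h1 : 0 ≤ δ * Z.card := by positivity
      have h2 : δ * Z.card ≤ Z.card := mul_le_of_le_one_left (by positivity) hδ1
      have h3 := hdegle a
      have h4 : (0 : ℝ) ≤ ((Z.filter fun b => G.Adj a b).card : ℝ) := Nat.cast_nonneg _
      constructor <;> linarith
  · push Not at hZc
    have hZ0 : 0 < (Z.card : ℝ) := lt_of_le_of_lt (by positivity) hZc
    have hZB : (Z.card : ℝ) ≤ B.card := Nat.cast_le.2 (card_le_card hZ)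
    set lo := A.filter fun a => ((Z.filter fun b => G.Adj a b).card : ℝ) < (δ - ε) * Z.card
      with hlo
    set hi := A.filter fun a => (δ + ε) * Z.card < ((Z.filter fun b => G.Adj a b).card : ℝ)
      with hhi
    have hloc : (lo.card : ℝ) ≤ ε * A.card := by
      by_contra hcon
      push Not at hcon
      have h1 := (abs_lt.1 (hG lo (filter_subset _ _) Z hZ hcon hZc)).1
      have hl0 : 0 < (lo.card : ℝ) := lt_of_le_of_lt (by positivity) hcon
      have h2 := dens_mul_card_mul_card G lo Z
      have h3 : ∑ a ∈ lo, ((Z.filter fun b => G.Adj a b).card : ℝ) <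
          ∑ _a ∈ lo, (δ - ε) * (Z.card : ℝ) :=
        sum_lt_sum_of_nonempty (card_pos.1 (by exact_mod_cast hl0))
          fun a ha => (mem_filter.1 ha).2
      rw [← h2, sum_const, nsmul_eq_mul] at h3
      have h4 : (δ - ε) * (lo.card * Z.card) < dens G lo Z * (lo.card * Z.card) := by
        gcongr; linarith
      linarith
    have hhic : (hi.card : ℝ) ≤ ε * A.card := by
      by_contra hcon
      push Not at hcon
      have h1 := (abs_lt.1 (hG hi (filter_subset _ _) Z hZ hcon hZc)).2
      have hl0 : 0 < (hi.card : ℝ) := lt_of_le_of_lt (by positivity) hcon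
      have h2 := dens_mul_card_mul_card G hi Z
      have h3 : ∑ _a ∈ hi, (δ + ε) * (Z.card : ℝ) <
          ∑ a ∈ hi, ((Z.filter fun b => G.Adj a b).card : ℝ) :=
        sum_lt_sum_of_nonempty (card_pos.1 (by exact_mod_cast hl0))
          fun a ha => (mem_filter.1 ha).2
      rw [← h2, sum_const, nsmul_eq_mul] at h3
      have h4 : dens G hi Z * (hi.card * Z.card) < (δ + ε) * (hi.card * Z.card) := by
        gcongr; linarith
      linarith
    have hsub : (A.filter fun a => ε * B.card <
        |((Z.filter fun b => G.Adj a b).card : ℝ) - δ * Z.card|) ⊆ lo ∪ hi := by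
      intro a ha
      rw [mem_filter] at ha
      by_contra hcon
      simp only [hlo, hhi, mem_union, mem_filter, ha.1, true_and, not_or, not_lt] at hcon
      refine absurd ha.2 (not_lt.2 ?_)
      have : ε * Z.card ≤ ε * B.card := by gcongr
      rw [abs_le]
      constructor <;> linarith
    have h5 : (_ : ℝ) ≤ _ := Nat.cast_le.2 ((card_le_card hsub).trans (card_union_le lo hi))
    push_cast at h5
    linarith

theorem IsRegPair.oneSidedReg {V : Type*} {G : SimpleGraph V} {ε : ℝ} {A B : Finset V}
    (hG : IsRegPair G ε A B) (hε : 0 < ε) {A' B' : Finset V} (hA : A' ⊆ A) (hB : B' ⊆ B)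
    (hA' : (A.card : ℝ) ≤ 2 * A'.card) (hB' : (B.card : ℝ) ≤ 2 * B'.card) :
    OneSidedReg (fun (a : A') (b : B') => G.Adj a b) (4 * ε) (dens G A B) := by
  intro Z
  set Z' : Finset V := Z.map (Function.Embedding.subtype _) with hZ'
  have hZB : Z' ⊆ B := by
    intro b hb
    obtain ⟨b', -, rfl⟩ := mem_map.1 hb
    exact hB b'.2
  have h1 := hG.card_atypical_le hε hZB
  have h2 : ∀ a : A', (Z.filter fun b : B' => G.Adj a b).card =
      (Z'.filter fun b => G.Adj a b).card := by
    intro a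
    rw [hZ', filter_map, card_map]
    rfl
  have hZc : Z'.card = Z.card := card_map _
  simp only [Fintype.card_coe]
  calc _ ≤ ((A.filter fun a => ε * B.card <
      |((Z'.filter fun b => G.Adj a b).card : ℝ) - dens G A B * Z'.card|).card : ℝ) := by
        refine Nat.cast_le.2 (card_le_card_of_injOn (fun a : A' => (a : V)) ?_
          Subtype.val_injective.injOn)
        intro a ha
        have ha := (mem_filter.1 (mem_coe.1 ha)).2
        rw [h2, ← hZc] at ha
        exact mem_coe.2 (mem_filter.2 ⟨hA a.2, lt_of_le_of_lt (by nlinarith) ha⟩)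
    _ ≤ 2 * ε * A.card := h1
    _ ≤ _ := by nlinarith

/-- Greedy embedding of a small vertex set along regular pairs, keeping all candidate sets of
the remaining vertices large. -/
theorem exists_greedy_embedding {V W I : Type*} [Fintype W] {G : SimpleGraph V}
    {H : SimpleGraph W} {T : SimpleGraph I} {P : I → Finset V} {idx : W → I} {U : Finset W}
    {ε d : ℝ} {Δ : ℕ} (hd : 0 < d) (hd1 : d ≤ 1) (hε : 0 < ε) (hε1 : ε ≤ d / 2 * (d / 2) ^ Δ)
    (hε2 : (1 + 2 * Δ) * ε < (d / 2) ^ Δ) (hP : ∀ i j, i ≠ j → Disjoint (P i) (P j))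
    (hreg : ∀ i j, T.Adj i j → IsRegPair G ε (P i) (P j) ∧ d ≤ dens G (P i) (P j))
    (hH : ∀ w w', H.Adj w w' → T.Adj (idx w) (idx w'))
    (hU : ∀ i, ((U.filter fun w => idx w = i).card : ℝ) ≤ ε * (P i).card)
    (hdeg : ∀ w, (univ.filter fun w' => H.Adj w w').card ≤ Δ) (g₀ : W → V) :
    ∀ S ⊆ U, ∃ g : W → V, (∀ u ∈ S, g u ∈ P (idx u)) ∧ Set.InjOn g S ∧
      (∀ u ∈ S, ∀ u' ∈ S, H.Adj u u' → G.Adj (g u) (g u')) ∧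
      ∀ w, (d / 2) ^ (S.filter fun u => H.Adj w u).card * ((P (idx w)).card : ℝ) ≤
        ((P (idx w)).filter fun v => ∀ u ∈ S, H.Adj w u → G.Adj (g u) v).card := by
  intro S
  induction S using Finset.induction_on with
  | empty => exact fun _ => ⟨g₀, by simp, by simp, by simp, by simp⟩
  | insert u S huS ih =>
    intro hSU
    obtain ⟨g, hgP, hginj, hgadj, hgC⟩ := ih ((subset_insert u S).trans hSU)
    set C : W → Finset V := fun w =>
      (P (idx w)).filter fun v => ∀ u ∈ S, H.Adj w u → G.Adj (g u) v with hC
    have hCP : ∀ w, C w ⊆ P (idx w) := fun w => filter_subset _ _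
    have hCΔ : ∀ w, (d / 2) ^ Δ * ((P (idx w)).card : ℝ) ≤ (C w).card := by
      intro w
      refine le_trans ?_ (hgC w)
      refine mul_le_mul_of_nonneg_right (pow_le_pow_of_le_one (by linarith) (by linarith)
        ((card_le_card ?_).trans (hdeg w))) (Nat.cast_nonneg _)
      exact filter_subset_filter _ (subset_univ _)
    have huU := hSU (mem_insert_self u S)
    have hPpos : 0 < ((P (idx u)).card : ℝ) := by
      have h1 : 0 < ((U.filter fun w => idx w = idx u).card : ℝ) :=
        Nat.cast_pos.2 (card_pos.2 ⟨u, mem_filter.2 ⟨huU, rfl⟩⟩)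
      exact pos_of_mul_pos_right (h1.trans_le (hU _)) hε.le
    set B : W → Finset V := fun w => (P (idx u)).filter fun a => ε * (P (idx w)).card <
      |(((C w).filter fun b => G.Adj a b).card : ℝ) -
        dens G (P (idx u)) (P (idx w)) * (C w).card| with hB
    set N := univ.filter fun w => H.Adj u w with hN
    have hBc : ∀ w ∈ N, ((B w).card : ℝ) ≤ 2 * ε * (P (idx u)).card := fun w hw =>
      (hreg _ _ (hH _ _ (mem_filter.1 hw).2)).1.card_atypical_le hε (hCP w)
    set B₀ := (S.filter fun w => idx w = idx u).image g with hB₀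
    have hB₀c : (B₀.card : ℝ) ≤ ε * (P (idx u)).card := by
      refine (Nat.cast_le.2 (card_image_le.trans (card_le_card ?_))).trans (hU (idx u))
      exact filter_subset_filter _ ((subset_insert u S).trans hSU)
    obtain ⟨v, hvC, hvB⟩ : ∃ v ∈ C u, v ∉ B₀ ∪ N.biUnion B := by
      by_contra! hcon
      have h1 : (C u).card ≤ B₀.card + ∑ w ∈ N, (B w).card :=
        (card_le_card hcon).trans ((card_union_le _ _).trans (by gcongr; exact card_biUnion_le))
      have h2 : ((C u).card : ℝ) ≤ B₀.card + ∑ w ∈ N, ((B w).card : ℝ) := by exact_mod_cast h1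
      have h3 : ∑ w ∈ N, ((B w).card : ℝ) ≤ Δ * (2 * ε * (P (idx u)).card) := by
        refine (sum_le_card_nsmul N _ _ hBc).trans ?_
        rw [nsmul_eq_mul]
        gcongr
        exact hdeg u
      have h4 := hCΔ u
      have h5 := mul_lt_mul_of_pos_right hε2 hPpos
      linarith
    rw [mem_union, not_or, mem_biUnion] at hvB
    have hup : ∀ w ∈ S, Function.update g u v w = g w := fun w hw =>
      Function.update_of_ne (ne_of_mem_of_not_mem hw huS) _ _
    have hvP := hCP u hvC
    have hvadj := (mem_filter.1 hvC).2
    have hvne : ∀ w ∈ S, g w ≠ v := by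
      intro w hw h
      by_cases hi : idx w = idx u
      · exact hvB.1 (mem_image.2 ⟨w, mem_filter.2 ⟨hw, hi⟩, h⟩)
      · exact disjoint_left.1 (hP _ _ hi) (hgP w hw) (h ▸ hvP)
    refine ⟨Function.update g u v, ?_, ?_, ?_, ?_⟩
    · intro w hw
      rcases mem_insert.1 hw with rfl | hw
      · rwa [Function.update_self]
      · rw [hup w hw]; exact hgP w hw
    · intro w hw w' hw' h
      rcases mem_insert.1 (mem_coe.1 hw) with rfl | hwS <;>
        rcases mem_insert.1 (mem_coe.1 hw') with rfl | hwS'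
      · rfl
      · rw [Function.update_self, hup w' hwS'] at h
        exact absurd h.symm (hvne w' hwS')
      · rw [Function.update_self, hup w hwS] at h
        exact absurd h (hvne w hwS)
      · rw [hup w hwS, hup w' hwS'] at h
        exact hginj hwS hwS' h
    · intro w hw w' hw' h
      rcases mem_insert.1 hw with rfl | hwS <;> rcases mem_insert.1 hw' with rfl | hwS'
      · exact absurd h H.irrefl
      · rw [Function.update_self, hup w' hwS']
        exact (hvadj w' hwS' h).symm
      · rw [Function.update_self, hup w hwS]
        exact hvadj w hwS h.symm
      · rw [hup w hwS, hup w' hwS']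
        exact hgadj w hwS w' hwS' h
    · intro w
      rw [filter_insert]
      by_cases hwu : H.Adj w u
      · rw [if_pos hwu, card_insert_of_notMem (by simp [huS]), pow_succ]
        have hsub : ((C w).filter fun b => G.Adj v b) ⊆ (P (idx w)).filter fun x =>
            ∀ u' ∈ insert u S, H.Adj w u' → G.Adj (Function.update g u v u') x := by
          intro x hx
          obtain ⟨hx1, hx2⟩ := mem_filter.1 hx
          obtain ⟨hx3, hx4⟩ := mem_filter.1 hx1
          refine mem_filter.2 ⟨hx3, fun u' hu' hadj => ?_⟩
          rcases mem_insert.1 hu' with rfl | hu'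
          · rwa [Function.update_self]
          · rw [hup u' hu']
            exact hx4 u' hu' hadj
        refine le_trans ?_ (Nat.cast_le.2 (card_le_card hsub))
        have h1 : ¬ ε * (P (idx w)).card < |(((C w).filter fun b => G.Adj v b).card : ℝ) -
            dens G (P (idx u)) (P (idx w)) * (C w).card| := fun h =>
          hvB.2 ⟨w, mem_filter.2 ⟨mem_univ _, hwu.symm⟩, mem_filter.2 ⟨hvP, h⟩⟩
        have h2 := (abs_le.1 (not_lt.1 h1)).1
        have h3 : d * (C w).card ≤ dens G (P (idx u)) (P (idx w)) * (C w).card := by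
          gcongr
          exact (hreg _ _ (hH _ _ hwu.symm)).2
        have h4 : ε * ((P (idx w)).card : ℝ) ≤ d / 2 * (C w).card :=
          calc _ ≤ d / 2 * (d / 2) ^ Δ * ((P (idx w)).card : ℝ) := by gcongr
            _ = d / 2 * ((d / 2) ^ Δ * ((P (idx w)).card : ℝ)) := by ring
            _ ≤ _ := by gcongr; exact hCΔ w
        have h5 := mul_le_mul_of_nonneg_left (hgC w) (by positivity : 0 ≤ d / 2)
        have h6 : (d / 2) ^ #{u ∈ S | H.Adj w u} * (d / 2) * ((P (idx w)).card : ℝ) ≤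
            d / 2 * (C w).card := by
          refine le_trans (le_of_eq ?_) h5
          ring
        linarith
      · rw [if_neg hwu]
        refine (hgC w).trans (Nat.cast_le.2 (card_le_card ?_))
        intro x hx
        obtain ⟨hx3, hx4⟩ := mem_filter.1 hx
        refine mem_filter.2 ⟨hx3, fun u' hu' hadj => ?_⟩
        rcases mem_insert.1 hu' with rfl | hu'
        · exact absurd hadj hwu
        · rw [hup u' hu']
          exact hx4 u' hu' hadj

theorem IsRegPair.symm {V : Type*} {G : SimpleGraph V} {ε : ℝ} {A B : Finset V}
    (hG : IsRegPair G ε A B) : IsRegPair G ε B A := by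
  intro X hX Y hY hXc hYc
  rw [pair_dens_comm G X, pair_dens_comm G B]
  exact hG Y hY X hX hYc hXc

theorem card_filter_coe {α : Type*} (s : Finset α) (p : α → Prop) :
    (univ.filter fun x : s => p x).card = (s.filter p).card := by
  rw [← card_map (Function.Embedding.subtype _)]
  congr 1
  ext x
  simp [and_comm]

theorem mul_le_card_filter_adj {V : Type*} {G : SimpleGraph V} {B B' : Finset V} {v : V}
    {d ε : ℝ} (hd : 0 ≤ d) (hε : ε ≤ d / 2) (hB : B' ⊆ B)
    (hBc : (B.card : ℝ) ≤ B'.card + ε * B.card)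
    (h : d * (B.card : ℝ) < (((B : Set V) ∩ G.neighborSet v).ncard : ℝ)) :
    d / 2 * B'.card ≤ (B'.filter fun b => G.Adj v b).card := by
  have h1 : ((B : Set V) ∩ G.neighborSet v) =
      ((B.filter fun b => G.Adj v b : Finset V) : Set V) := by
    ext; simp
  rw [h1, Set.ncard_coe_finset] at h
  have h2 : (B.filter fun b => G.Adj v b).card ≤
      (B'.filter fun b => G.Adj v b).card + (B \ B').card := by
    refine (card_le_card ?_).trans (card_union_le _ _)
    intro x hx
    rw [mem_filter] at hx
    by_cases hx' : x ∈ B' <;> simp [hx, hx']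
  have h3 : (B \ B').card + B'.card = B.card := card_sdiff_add_card_eq_card hB
  have h4 : ((B.filter fun b => G.Adj v b).card : ℝ) ≤
      (B'.filter fun b => G.Adj v b).card + (B \ B').card := by exact_mod_cast h2
  have h5 : ((B \ B').card : ℝ) + B'.card = B.card := by exact_mod_cast h3
  have h6 : (B'.card : ℝ) ≤ B.card := Nat.cast_le.2 (card_le_card hB)
  have h7 : ε * B.card ≤ d / 2 * B.card := by gcongr
  have h8 : d / 2 * (B'.card : ℝ) ≤ d / 2 * B.card := by gcongr
  linarith

/-- Blow-up lemma for a single super-regular pair, after deletion of few vertices and with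
restricted target sets for few vertices. -/
theorem exists_embedding_of_isSuperRegPair {d c : ℝ} (hd : 0 < d) (hd1 : d ≤ 1) (hc : 0 < c)
    (hc1 : c ≤ 1) (Δ : ℕ) (hΔ : 0 < Δ) : ∃ ε₀ : ℝ, 0 < ε₀ ∧
    ∀ (V W : Type) (G : SimpleGraph V) (H : SimpleGraph W) (A B A' B' : Finset V)
      (C D : Finset W) (L : W → V → Prop) (ε : ℝ), 0 < ε → ε ≤ ε₀ →
      IsSuperRegPair G ε d A B → d ≤ dens G A B → A' ⊆ A → B' ⊆ B →
      (A.card : ℝ) ≤ A'.card + ε * A.card → (B.card : ℝ) ≤ B'.card + ε * B.card →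
      C.card ≤ A'.card → D.card ≤ B'.card → (∀ w, (H.neighborSet w).Finite) →
      (∀ w, (H.neighborSet w).ncard ≤ Δ) →
      (∀ w ∈ C, c * A'.card ≤ (A'.filter (L w)).card) →
      (∀ w ∈ D, c * B'.card ≤ (B'.filter (L w)).card) →
      ((C.filter fun w => ∃ v ∈ A', ¬ L w v).card : ℝ) ≤ ε * min (A.card : ℝ) B.card →
      ((D.filter fun w => ∃ v ∈ B', ¬ L w v).card : ℝ) ≤ ε * min (A.card : ℝ) B.card →
      ∃ (φ : C → V) (ψ : D → V), Function.Injective φ ∧ Function.Injective ψ ∧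
        (∀ w, φ w ∈ A' ∧ L w (φ w)) ∧ (∀ w, ψ w ∈ B' ∧ L w (ψ w)) ∧
        ∀ (w : C) (w' : D), H.Adj w w' → G.Adj (φ w) (ψ w') := by
  obtain ⟨ε₁, hε₁, hcore⟩ := exists_bipartite_embedding (half_pos hd) (by linarith) hc hc1 Δ hΔ
  refine ⟨min (min (1 / 2) (d / 2)) (ε₁ / 4), by positivity, ?_⟩
  intro V W G H A B A' B' C D L ε hε hεle hG hδ hA hB hAc hBc hCA hDB hfin hdeg hLC hLD hbC hbD
  obtain ⟨⟨hε2, hεd⟩, hε4⟩ := by simpa only [le_min_iff] using hεle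
  have hAc2 : (A.card : ℝ) ≤ 2 * A'.card := by
    have : ε * (A.card : ℝ) ≤ 1 / 2 * A.card := by gcongr
    linarith
  have hBc2 : (B.card : ℝ) ≤ 2 * B'.card := by
    have : ε * (B.card : ℝ) ≤ 1 / 2 * B.card := by gcongr
    linarith
  have hmin : ε * min (A.card : ℝ) B.card ≤ ε₁ * min (A'.card : ℝ) B'.card := by
    calc ε * min (A.card : ℝ) B.card ≤ ε * min (2 * A'.card : ℝ) (2 * B'.card) := by gcongr
      _ = 2 * ε * min (A'.card : ℝ) B'.card := by
        rw [← mul_min_of_nonneg _ _ (by norm_num : (0 : ℝ) ≤ 2)]; ring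
      _ ≤ _ := by gcongr; linarith
  have hdegC : ∀ (E : Finset W) (w : W), (univ.filter fun e : E => H.Adj w e).card ≤ Δ := by
    intro E w
    rw [card_filter_coe E (H.Adj w)]
    refine le_trans ?_ (hdeg w)
    rw [← Set.ncard_coe_finset]
    refine Set.ncard_le_ncard ?_ (hfin w)
    intro x hx
    exact (mem_filter.1 (mem_coe.1 hx)).2
  have hbad : ∀ (E : Finset W) (S : Finset V) (p : E → Prop) (_ : DecidablePred p),
      (∀ w : E, p w → ∃ v ∈ S, ¬ L w v) →
      ((E.filter fun w => ∃ v ∈ S, ¬ L w v).card : ℝ) ≤ ε * min (A.card : ℝ) B.card →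
      ((univ.filter p).card : ℝ) ≤ ε₁ * min (A'.card : ℝ) B'.card := by
    intro E S p _ hp h
    refine (Nat.cast_le.2 ?_).trans (h.trans hmin)
    refine card_le_card_of_injOn Subtype.val (fun w hw => ?_) Subtype.val_injective.injOn
    exact mem_coe.2 (mem_filter.2 ⟨w.2, hp w (mem_filter.1 (mem_coe.1 hw)).2⟩)
  obtain ⟨φ, ψ, hφ, hψ, hφL, hψL, hadj⟩ := hcore C D A' B' (fun a b => G.Adj a b) (dens G A B)
    (fun w w' => H.Adj w w') (fun w => univ.filter fun x : A' => L w x)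
    (fun w => univ.filter fun x : B' => L w x)
    ((hG.1.oneSidedReg hε hA hB hAc2 hBc2).mono (by linarith))
    (by
      have h := (hG.1.symm.oneSidedReg hε hB hA hBc2 hAc2).mono (show 4 * ε ≤ ε₁ by linarith)
      rw [pair_dens_comm] at h
      simpa only [G.adj_comm] using h)
    (by linarith) (pair_dens_le_one G A B)
    (by simpa using hCA) (by simpa using hDB)
    (by
      intro x
      rw [card_filter_coe B' (G.Adj x), Fintype.card_coe]
      exact mul_le_card_filter_adj hd.le hεd hB hBc (hG.2.1 x (hA x.2)))
    (by
      intro y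
      have h := mul_le_card_filter_adj hd.le hεd hA hAc (hG.2.2 y (hB y.2))
      rw [← card_filter_coe A' (G.Adj y), ← Fintype.card_coe] at h
      simpa only [G.adj_comm] using h)
    (fun w => hdegC D w) (fun w => by simpa only [H.adj_comm] using hdegC C w)
    (by
      intro w
      rw [card_filter_coe A' (L w), Fintype.card_coe]
      exact hLC w w.2)
    (by
      intro w
      rw [card_filter_coe B' (L w), Fintype.card_coe]
      exact hLD w w.2)
    (by
      rw [Fintype.card_coe, Fintype.card_coe]
      exact hbad C A' _ _ (fun w hw => by simpa [Finset.ext_iff] using hw) hbC)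
    (by
      rw [Fintype.card_coe, Fintype.card_coe]
      exact hbad D B' _ _ (fun w hw => by simpa [Finset.ext_iff] using hw) hbD)
  exact ⟨fun w => φ w, fun w => ψ w, Subtype.val_injective.comp hφ,
    Subtype.val_injective.comp hψ, fun w => ⟨(φ w).2, (mem_filter.1 (hφL w)).2⟩,
    fun w => ⟨(ψ w).2, (mem_filter.1 (hψL w)).2⟩, hadj⟩

/-- The embedding lemma with the vertex classes of `H` given by an index function and with an
arbitrary exceptional set `U` outside of which all edges run along the matching `M`. -/
theorem exists_hasCopy_of_matching {d : ℝ} (hd : 0 < d) (hd1 : d ≤ 1) (Δ : ℕ) (hΔ : 0 < Δ) :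
    ∃ ε : ℝ, 0 < ε ∧
    ∀ (V W I : Type) [Fintype W] (G : SimpleGraph V) (H : SimpleGraph W) (P : I → Finset V)
      (idx : W → I) (T M : SimpleGraph I) (U : Finset W) (_ : W → V),
      (∀ w, (H.neighborSet w).ncard ≤ Δ) → (∀ i j, i ≠ j → Disjoint (P i) (P j)) → M ≤ T →
      (∀ i j k, M.Adj i j → M.Adj i k → j = k) →
      (∀ i j, T.Adj i j → IsRegPair G ε (P i) (P j) ∧ d ≤ dens G (P i) (P j)) →
      (∀ i j, M.Adj i j → IsSuperRegPair G ε d (P i) (P j)) →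
      (∀ w w', H.Adj w w' → T.Adj (idx w) (idx w')) →
      (∀ i, (univ.filter fun w => idx w = i).card ≤ (P i).card) →
      (∀ i, ((U.filter fun w => idx w = i).card : ℝ) ≤ ε * (P i).card) →
      (∀ w ∉ U, ∀ w', H.Adj w w' → M.Adj (idx w) (idx w')) →
      (∀ i j, M.Adj i j →
        ((univ.filter fun w => idx w = i ∧ w ∉ U ∧ ∃ u ∈ U, H.Adj w u).card : ℝ) ≤
          ε * min ((P i).card : ℝ) (P j).card) →
      hasCopy G H := by
  set c := (d / 2) ^ Δ / 2 with hc
  have hc0 : 0 < c := by positivity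
  have hpow1 : (d / 2) ^ Δ ≤ 1 := pow_le_one₀ (by linarith) (by linarith)
  obtain ⟨ε₀, hε₀, hpair⟩ :=
    exists_embedding_of_isSuperRegPair hd hd1 hc0 (by linarith) Δ hΔ
  obtain ⟨ε, hεpos, hε1, hε2, hε3⟩ : ∃ ε : ℝ, 0 < ε ∧ 1 * ε ≤ d / 2 * (d / 2) ^ Δ ∧
      (1 + 2 * Δ) * ε ≤ c ∧ 1 * ε ≤ ε₀ :=
    (eventually_mem_nhdsWithin.and ((eventually_mul_le _ (by positivity)).and
      ((eventually_mul_le _ hc0).and (eventually_mul_le _ hε₀)))).exists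
  rw [one_mul] at hε1 hε3
  have hεc : ε ≤ c := by
    have : 0 ≤ 2 * (Δ : ℝ) * ε := by positivity
    linarith
  refine ⟨ε, hεpos, ?_⟩
  intro V W I _ G H P idx T M U g₀ hdeg hP hMT hM hreg hsuper hH hcard hU hUM hU'
  obtain ⟨g, hgP, hginj, hgadj, hgC⟩ := exists_greedy_embedding hd hd1 hεpos hε1
    (hε2.trans_lt (by linarith)) hP hreg hH hU (fun w => by
      refine le_trans (le_of_eq ?_) (hdeg w)
      rw [← Set.ncard_coe_finset]
      congr 1
      ext
      simp) g₀ U Subset.rfl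
  obtain ⟨L, hL⟩ : ∃ L : W → V → Prop, L = fun w v => ∀ u ∈ U, H.Adj w u → G.Adj (g u) v :=
    ⟨_, rfl⟩
  set A : I → Finset V := fun i => P i \ U.image g with hA
  set C : I → Finset W := fun i => univ.filter fun w => idx w = i ∧ w ∉ U with hC
  have hmemC : ∀ {w i}, w ∈ C i ↔ idx w = i ∧ w ∉ U := by simp [hC]
  have hAP : ∀ i, A i ⊆ P i := fun i => sdiff_subset
  have hAcard : ∀ i, (P i).card ≤ (A i).card + (U.filter fun w => idx w = i).card := by
    intro i
    have h1 : P i ⊆ A i ∪ (U.filter fun w => idx w = i).image g := by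
      intro v hv
      by_cases hvg : v ∈ U.image g
      · obtain ⟨u, hu, rfl⟩ := mem_image.1 hvg
        refine mem_union_right _ (mem_image_of_mem g (mem_filter.2 ⟨hu, ?_⟩))
        by_contra hne
        exact disjoint_left.1 (hP _ _ hne) (hgP u hu) hv
      · exact mem_union_left _ (mem_sdiff.2 ⟨hv, hvg⟩)
    exact (card_le_card h1).trans ((card_union_le _ _).trans (by gcongr; exact card_image_le))
  have hAcard' : ∀ i, ((P i).card : ℝ) ≤ (A i).card + ε * (P i).card := by
    intro i
    have h1 : ((P i).card : ℝ) ≤ (A i).card + (U.filter fun w => idx w = i).card := by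
      exact_mod_cast hAcard i
    linarith [hU i]
  have hCA : ∀ i, (C i).card ≤ (A i).card := by
    intro i
    have h1 : (C i).card + (U.filter fun w => idx w = i).card ≤
        (univ.filter fun w => idx w = i).card := by
      rw [← card_union_of_disjoint]
      · refine card_le_card fun w hw => ?_
        rcases mem_union.1 hw with hw | hw
        · exact mem_filter.2 ⟨mem_univ _, (hmemC.1 hw).1⟩
        · exact mem_filter.2 ⟨mem_univ _, (mem_filter.1 hw).2⟩
      · exact disjoint_left.2 fun w hw hw' => (hmemC.1 hw).2 (mem_filter.1 hw').1
    have := hcard i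
    have := hAcard i
    omega
  have hLA : ∀ i, ∀ w ∈ C i, c * (A i).card ≤ ((A i).filter (L w)).card := by
    intro i w hw
    obtain ⟨rfl, -⟩ := hmemC.1 hw
    have h1 : ((P (idx w)).filter (L w)).card ≤
        ((A (idx w)).filter (L w)).card + (U.filter fun u => idx u = idx w).card := by
      have h2 : (P (idx w)).filter (L w) ⊆
          (A (idx w)).filter (L w) ∪ (U.filter fun u => idx u = idx w).image g := by
        intro v hv
        obtain ⟨hv1, hv2⟩ := mem_filter.1 hv
        by_cases hvg : v ∈ U.image g
        · obtain ⟨u, hu, rfl⟩ := mem_image.1 hvg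
          refine mem_union_right _ (mem_image_of_mem g (mem_filter.2 ⟨hu, ?_⟩))
          by_contra hne
          exact disjoint_left.1 (hP _ _ hne) (hgP u hu) hv1
        · exact mem_union_left _ (mem_filter.2 ⟨mem_sdiff.2 ⟨hv1, hvg⟩, hv2⟩)
      exact (card_le_card h2).trans ((card_union_le _ _).trans (by gcongr; exact card_image_le))
    have h2 : (((P (idx w)).filter (L w)).card : ℝ) ≤
        ((A (idx w)).filter (L w)).card + (U.filter fun u => idx u = idx w).card := by
      exact_mod_cast h1
    have h3 : (d / 2) ^ Δ * ((P (idx w)).card : ℝ) ≤ ((P (idx w)).filter (L w)).card := by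
      refine le_trans (le_trans ?_ (hgC w)) (Nat.cast_le.2 (card_le_card fun v hv =>
        mem_filter.2 ⟨(mem_filter.1 hv).1, by rw [hL]; exact (mem_filter.1 hv).2⟩))
      refine mul_le_mul_of_nonneg_right (pow_le_pow_of_le_one (by linarith) (by linarith)
        ((le_of_eq_of_le (Set.ncard_coe_finset _).symm
          (Set.ncard_le_ncard fun x hx => ?_)).trans (hdeg w))) (Nat.cast_nonneg _)
      exact (mem_filter.1 (mem_coe.1 hx)).2
    have h4 : c * ((A (idx w)).card : ℝ) ≤ c * (P (idx w)).card := by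
      gcongr
      exact hAP _
    have h5 : ε * ((P (idx w)).card : ℝ) ≤ c * (P (idx w)).card := by gcongr
    have h6 : (d / 2) ^ Δ * ((P (idx w)).card : ℝ) = 2 * (c * (P (idx w)).card) := by
      rw [hc]; ring
    linarith [hU (idx w)]
  have hbad : ∀ i j, M.Adj i j → (((C i).filter fun w => ∃ v ∈ A i, ¬ L w v).card : ℝ) ≤
      ε * min ((P i).card : ℝ) (P j).card := by
    intro i j hij
    refine (Nat.cast_le.2 (card_le_card fun w hw => ?_)).trans (hU' i j hij)
    obtain ⟨hw, v, -, hv⟩ := mem_filter.1 hw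
    simp only [hL, not_forall] at hv
    obtain ⟨u, hu, hwu, -⟩ := hv
    exact mem_filter.2 ⟨mem_univ _, (hmemC.1 hw).1, (hmemC.1 hw).2, u, hu, hwu⟩
  clear_value A C
  set K : I → Set I := fun i => {k | k = i ∨ M.Adj i k} with hK
  have hgood : ∀ S : Set I, ∃ F : W → V, (∃ i, S = K i) →
      (∀ w ∉ U, idx w ∈ S → F w ∈ A (idx w) ∧ L w (F w)) ∧
      (∀ w ∉ U, ∀ w' ∉ U, idx w ∈ S → idx w = idx w' → F w = F w' → w = w') ∧
      (∀ w ∉ U, ∀ w' ∉ U, idx w ∈ S → H.Adj w w' → G.Adj (F w) (F w')) := by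
    intro S
    by_cases hS : ∃ i, S = K i
    swap
    · exact ⟨g, fun h => absurd h hS⟩
    obtain ⟨i, rfl⟩ := hS
    by_cases hi : ∃ j, M.Adj i j
    · obtain ⟨j, hij⟩ := hi
      have hne : i ≠ j := hij.ne
      obtain ⟨φ, ψ, hφ, hψ, hφL, hψL, hadj⟩ := hpair V W G H (P i) (P j) (A i) (A j) (C i) (C j) L
        ε hεpos hε3 (hsuper i j hij) (hreg i j (hMT hij)).2 (hAP i) (hAP j) (hAcard' i)
        (hAcard' j) (hCA i) (hCA j) (fun w => Set.toFinite _) hdeg (hLA i) (hLA j)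
        (hbad i j hij) (by rw [min_comm]; exact hbad j i hij.symm)
      have hCC : ∀ {w}, w ∈ C j → w ∉ C i := fun hw hw' =>
        hne ((hmemC.1 hw').1.symm.trans (hmemC.1 hw).1)
      set F : W → V := fun w => if h : w ∈ C i then φ ⟨w, h⟩ else
        if h : w ∈ C j then ψ ⟨w, h⟩ else g w with hF
      have hFi : ∀ w (h : w ∈ C i), F w = φ ⟨w, h⟩ := fun w h => dif_pos h
      have hFj : ∀ w (h : w ∈ C j), F w = ψ ⟨w, h⟩ := fun w h => by
        rw [hF]; simp only [dif_neg (hCC h), dif_pos h]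
      have hcases : ∀ w ∉ U, idx w ∈ K i → w ∈ C i ∨ w ∈ C j := by
        rintro w hw (h | h)
        · exact Or.inl (hmemC.2 ⟨h, hw⟩)
        · exact Or.inr (hmemC.2 ⟨(hM i j _ hij h).symm, hw⟩)
      refine ⟨F, fun _ => ⟨?_, ?_, ?_⟩⟩
      · intro w hw hwK
        rcases hcases w hw hwK with h | h
        · rw [hFi w h, (hmemC.1 h).1]; exact hφL ⟨w, h⟩
        · rw [hFj w h, (hmemC.1 h).1]; exact hψL ⟨w, h⟩
      · intro w hw w' hw' hwK hww' hFF
        rcases hcases w hw hwK with h | h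
        · have h' : w' ∈ C i := hmemC.2 ⟨hww'.symm.trans (hmemC.1 h).1, hw'⟩
          rw [hFi w h, hFi w' h'] at hFF
          exact congrArg Subtype.val (hφ hFF)
        · have h' : w' ∈ C j := hmemC.2 ⟨hww'.symm.trans (hmemC.1 h).1, hw'⟩
          rw [hFj w h, hFj w' h'] at hFF
          exact congrArg Subtype.val (hψ hFF)
      · intro w hw w' hw' hwK hadj'
        have h2 := hUM w hw w' hadj'
        rcases hcases w hw hwK with h | h
        · rw [(hmemC.1 h).1] at h2
          have h' : w' ∈ C j := hmemC.2 ⟨(hM i j _ hij h2).symm, hw'⟩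
          rw [hFi w h, hFj w' h']
          exact hadj ⟨w, h⟩ ⟨w', h'⟩ hadj'
        · rw [(hmemC.1 h).1] at h2
          have h' : w' ∈ C i := hmemC.2 ⟨(hM j i _ hij.symm h2).symm, hw'⟩
          rw [hFj w h, hFi w' h']
          exact (hadj ⟨w', h'⟩ ⟨w, h⟩ hadj'.symm).symm
    · obtain ⟨e⟩ : Nonempty (C i ↪ A i) :=
        Function.Embedding.nonempty_of_card_le (by simpa using hCA i)
      have hcases : ∀ w ∉ U, idx w ∈ K i → w ∈ C i := by
        rintro w hw (h | h)
        · exact hmemC.2 ⟨h, hw⟩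
        · exact absurd ⟨_, h⟩ hi
      have hiso : ∀ w ∈ C i, ∀ w', ¬ H.Adj w w' := fun w hw w' h =>
        hi ⟨_, (hmemC.1 hw).1 ▸ hUM w (hmemC.1 hw).2 w' h⟩
      set F : W → V := fun w => if h : w ∈ C i then e ⟨w, h⟩ else g w with hF
      have hFi : ∀ w (h : w ∈ C i), F w = e ⟨w, h⟩ := fun w h => dif_pos h
      refine ⟨F, fun _ => ⟨?_, ?_, ?_⟩⟩
      · intro w hw hwK
        have h := hcases w hw hwK
        refine ⟨?_, ?_⟩
        · rw [hFi w h, (hmemC.1 h).1]; exact (e ⟨w, h⟩).2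
        · rw [hL]
          exact fun u _ hwu => absurd hwu (hiso w h u)
      · intro w hw w' hw' hwK hww' hFF
        have h := hcases w hw hwK
        have h' := hcases w' hw' (hww' ▸ hwK)
        rw [hFi w h, hFi w' h'] at hFF
        exact congrArg Subtype.val (e.injective (Subtype.ext hFF))
      · exact fun w hw w' _ hwK hadj' => absurd hadj' (hiso w (hcases w hw hwK) w')
  choose F hF using hgood
  have hKself : ∀ i, i ∈ K i := fun i => Or.inl rfl
  have hKadj : ∀ i j, M.Adj i j → K i = K j := by
    intro i j hij
    ext k
    constructor
    · rintro (rfl | h)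
      · exact Or.inr hij.symm
      · exact Or.inl (hM i j k hij h).symm
    · rintro (rfl | h)
      · exact Or.inr hij
      · exact Or.inl (hM j i k hij.symm h).symm
  set f : W → V := fun w => if w ∈ U then g w else F (K (idx w)) w with hf
  have hfU : ∀ w ∈ U, f w = g w := fun w hw => if_pos hw
  have hfnU : ∀ w ∉ U, f w = F (K (idx w)) w := fun w hw => if_neg hw
  have hfA : ∀ w ∉ U, f w ∈ A (idx w) ∧ L w (f w) := fun w hw => by
    rw [hfnU w hw]; exact (hF _ ⟨_, rfl⟩).1 w hw (hKself _)
  have hfP : ∀ w, f w ∈ P (idx w) := by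
    intro w
    by_cases hw : w ∈ U
    · rw [hfU w hw]; exact hgP w hw
    · exact hAP _ (hfA w hw).1
  have hfg : ∀ w ∉ U, ∀ u ∈ U, f w ≠ f u := by
    intro w hw u hu h
    have h1 := (hfA w hw).1
    rw [h, hfU u hu, hA] at h1
    exact (mem_sdiff.1 h1).2 (mem_image_of_mem g hu)
  have hfUn : ∀ w ∉ U, ∀ u ∈ U, H.Adj w u → G.Adj (f u) (f w) := by
    intro w hw u hu h
    have h1 := (hfA w hw).2
    rw [hL] at h1
    rw [hfU u hu]
    exact h1 u hu h
  refine ⟨⟨f, ?_⟩, ?_⟩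
  · intro w w' h
    by_cases hw : w ∈ U <;> by_cases hw' : w' ∈ U
    · rw [hfU w hw, hfU w' hw']; exact hgadj w hw w' hw' h
    · exact hfUn w' hw' w hw h.symm
    · exact (hfUn w hw w' hw' h).symm
    · rw [hfnU w hw, hfnU w' hw', ← hKadj _ _ (hUM w hw w' h)]
      exact (hF _ ⟨_, rfl⟩).2.2 w hw w' hw' (hKself _) h
  · intro w w' h
    change f w = f w' at h
    have hidx : idx w = idx w' := by
      by_contra hne
      exact disjoint_left.1 (hP _ _ hne) (hfP w) (h ▸ hfP w')
    by_cases hw : w ∈ U <;> by_cases hw' : w' ∈ U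
    · rw [hfU w hw, hfU w' hw'] at h; exact hginj hw hw' h
    · exact absurd h.symm (hfg w' hw' w hw)
    · exact absurd h (hfg w hw w' hw')
    · rw [hfnU w hw, hfnU w' hw', ← hidx] at h
      exact (hF _ ⟨_, rfl⟩).2.1 w hw w' hw' (hKself _) hidx h

end

/-- Embedding Lemma: for all `d > 0` and `Δ > 0` there is `ε > 0` such that whenever an
`N`-vertex graph `G` has a partition `(V_i)_{i∈[s]}` whose (ε,d)-reduced graph contains a tree
`T` on `[s]`, `G` is (ε,d)-super-regular on a subgraph `M ⊆ T` whose edge set is a matching,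
and `H` is an `n`-vertex graph (`n ≤ N`) of maximum degree at most `Δ` with a partition
`(W_i)_{i∈[s]}` that is (ε,T,M)-compatible with `(V_i)_{i∈[s]}`, then `H ⊆ G`. -/
theorem embedding_lemma :
    ∀ d : ℝ, 0 < d → ∀ Δ : ℕ, 0 < Δ → ∃ ε : ℝ, 0 < ε ∧
      ∀ (N n s : ℕ) (G : SimpleGraph (Fin N)) (H : SimpleGraph (Fin n))
        (P : Fin s → Finset (Fin N)) (Q : Fin s → Finset (Fin n))
        (T M : SimpleGraph (Fin s)),
        n ≤ N →
        -- H has maximum degree at most Δ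
        (∀ w, (H.neighborSet w).ncard ≤ Δ) →
        -- (V_i) is a partition of V(G)
        (∀ i j, i ≠ j → Disjoint (P i) (P j)) → (∀ v, ∃ i, v ∈ P i) →
        -- (W_i) is a partition of V(H)
        (∀ i j, i ≠ j → Disjoint (Q i) (Q j)) → (∀ w, ∃ i, w ∈ Q i) →
        -- T is a tree on [s], M ⊆ T and the edge set of M is a matching
        T.IsTree → M ≤ T → (∀ i, (M.neighborSet i).ncard ≤ 1) →
        -- the (ε,d)-reduced graph of (V_i) contains T
        (∀ i j, T.Adj i j → IsRegPair G ε (P i) (P j) ∧ d ≤ dens G (P i) (P j)) →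
        -- G is (ε,d)-super-regular on M
        (∀ i j, M.Adj i j → IsSuperRegPair G ε d (P i) (P j)) →
        -- compatibility condition (I)
        (∀ i j, ∀ w ∈ Q i, ∀ w' ∈ Q j, H.Adj w w' → T.Adj i j) →
        -- compatibility condition (II)
        (∀ i, (Q i).card ≤ (P i).card) →
        -- compatibility condition (III)
        (∀ i, ((compatU H Q T M i).ncard : ℝ) ≤ ε * ((P i).card : ℝ)) →
        -- compatibility condition (IV)
        (∀ i j, M.Adj i j →
          ((compatU' H Q T M i).ncard : ℝ) ≤ ε * min ((P i).card : ℝ) ((P j).card : ℝ) ∧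
          ((compatU' H Q T M j).ncard : ℝ) ≤ ε * min ((P i).card : ℝ) ((P j).card : ℝ)) →
        hasCopy G H := by
  classical
  intro d hd Δ hΔ
  obtain ⟨ε, hε, hmain⟩ :=
    exists_hasCopy_of_matching (lt_min hd one_pos) (min_le_right d 1) Δ hΔ
  refine ⟨ε, hε, ?_⟩
  intro N n s G H P Q T M hnN hdeg hP _ hQ hQc _ hMT hM hreg hsuper hI hII hIII hIV
  choose idx hidx using hQc
  have hQ_iff : ∀ {w i}, w ∈ Q i ↔ idx w = i := by
    intro w i
    refine ⟨fun h => ?_, fun h => h ▸ hidx w⟩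
    by_contra hne
    exact Finset.disjoint_left.1 (hQ _ _ hne) (hidx w) h
  have hH : ∀ w w', H.Adj w w' → T.Adj (idx w) (idx w') := fun w w' =>
    hI _ _ w (hidx w) w' (hidx w')
  have hU_iff : ∀ {w i}, w ∈ compatU H Q T M i ↔
      idx w = i ∧ ∃ w', H.Adj w w' ∧ ¬ M.Adj (idx w) (idx w') := by
    intro w i
    constructor
    · rintro ⟨hw, j, -, hij, w', hw', h⟩
      obtain rfl := hQ_iff.1 hw
      obtain rfl := hQ_iff.1 hw'
      exact ⟨rfl, w', h, hij⟩
    · rintro ⟨rfl, w', h, hij⟩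
      exact ⟨hidx w, _, hH _ _ h, hij, w', hidx w', h⟩
  have hUn_iff : ∀ {w}, w ∈ compatUnion H Q T M ↔
      ∃ w', H.Adj w w' ∧ ¬ M.Adj (idx w) (idx w') := by
    intro w
    simp only [compatUnion, Set.mem_iUnion, hU_iff]
    exact ⟨fun ⟨_, _, h⟩ => h, fun h => ⟨_, rfl, h⟩⟩
  refine hmain (Fin N) (Fin n) (Fin s) G H P idx T M
    (Finset.univ.filter fun w => w ∈ compatUnion H Q T M) (Fin.castLE hnN) hdeg hP hMT ?_ ?_ ?_
    hH ?_ ?_ ?_ ?_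
  · intro i j k hj hk
    exact (Set.ncard_le_one (Set.toFinite _)).1 (hM i) j hj k hk
  · exact fun i j hij => ⟨(hreg i j hij).1, (min_le_left d 1).trans (hreg i j hij).2⟩
  · intro i j hij
    obtain ⟨h1, h2, h3⟩ := hsuper i j hij
    refine ⟨h1, fun a ha => lt_of_le_of_lt ?_ (h2 a ha), fun b hb => lt_of_le_of_lt ?_ (h3 b hb)⟩
    all_goals gcongr; exact min_le_left d 1
  · intro i
    refine (Finset.card_le_card fun w hw => ?_).trans (hII i)
    exact hQ_iff.2 (by simpa using hw)
  · intro i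
    refine le_trans (Nat.cast_le.2 ?_) (hIII i)
    rw [← Set.ncard_coe_finset]
    refine Set.ncard_le_ncard (fun w hw => ?_) (Set.toFinite _)
    simp only [Finset.coe_filter, Finset.mem_filter, Finset.mem_univ, true_and,
      Set.mem_ofPred_eq] at hw
    exact hU_iff.2 ⟨hw.2, hUn_iff.1 hw.1⟩
  · intro w hw w' h
    by_contra hcon
    exact hw (Finset.mem_filter.2 ⟨Finset.mem_univ _, hUn_iff.2 ⟨w', h, hcon⟩⟩)
  · intro i j hij
    refine le_trans (Nat.cast_le.2 ?_) (hIV i j hij).1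
    rw [← Set.ncard_coe_finset]
    refine Set.ncard_le_ncard (fun w hw => ?_) (Set.toFinite _)
    simp only [Finset.coe_filter, Finset.mem_filter, Finset.mem_univ, true_and,
      Set.mem_ofPred_eq] at hw
    exact ⟨hQ_iff.2 hw.1, hw.2⟩
end

section
/- For every integer ℓ̂ ≥ 1 there exists n₀ such that the following holds for every graph H = (W,E) with W = {w₁,...,w_n} and n ≥ n₀. For every β-balanced 2-coloring χ of W with β ≤ 2/ℓ̂, and every partition of W into intervals I₁,...,I_{ℓ̂} with |I₁| ≤ ... ≤ |I_{ℓ̂}| ≤ |I₁| + 1, there exists a permutation σ of [ℓ̂] such that for every pair of integers 1 ≤ a < b ≤ ℓ̂ one has |C₁(σ,a,b) − C₂(σ,a,b)| ≤ 2(n/ℓ̂ + 1). -/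
/-- `C_i` of the interval `{w_t : lo ≤ t < hi}` (0-indexed): the number of vertices `w_t` with
`lo ≤ t < hi` receiving color `i` under `χ`. -/
def intervalCount (n : ℕ) (χ : Fin n → Fin 2) (lo hi : ℕ) (i : Fin 2) : ℕ :=
  (Finset.univ.filter fun t : Fin n => lo ≤ (t : ℕ) ∧ (t : ℕ) < hi ∧ χ t = i).card

open Finset in
/-- If `0` and `∑ i ∈ s, d i` lie in an interval of length `2 * M` and `|d i| ≤ M` on a nonempty
`s`, some term of the sum can be left out without leaving the interval. -/
lemma exists_sum_erase_mem_Icc {ι : Type*} [DecidableEq ι] {d : ι → ℝ} {L M : ℝ} {s : Finset ι}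
    (hs : s.Nonempty) (hd : ∀ i ∈ s, |d i| ≤ M) (h0 : (0 : ℝ) ∈ Set.Icc L (L + 2 * M))
    (hsum : ∑ i ∈ s, d i ∈ Set.Icc L (L + 2 * M)) :
    ∃ x ∈ s, ∑ i ∈ s.erase x, d i ∈ Set.Icc L (L + 2 * M) := by
  obtain ⟨y, hy⟩ := hs
  obtain ⟨h0l, h0u⟩ := h0
  obtain ⟨hl, hu⟩ := hsum
  rcases le_total (L + M) (∑ i ∈ s, d i) with hT | hT
  · by_cases hx : ∃ x ∈ s, 0 ≤ d x
    · obtain ⟨x, hx, hx0⟩ := hx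
      have h1 := add_sum_erase s d hx
      have h2 := abs_le.1 (hd x hx)
      exact ⟨x, hx, by linarith, by linarith⟩
    · push Not at hx
      have h1 := add_sum_erase s d hy
      have h2 : ∑ i ∈ s.erase y, d i ≤ 0 :=
        sum_nonpos fun i hi => (hx i (mem_of_mem_erase hi)).le
      exact ⟨y, hy, by linarith [hx y hy], by linarith⟩
  · by_cases hx : ∃ x ∈ s, d x ≤ 0
    · obtain ⟨x, hx, hx0⟩ := hx
      have h1 := add_sum_erase s d hx
      have h2 := abs_le.1 (hd x hx)
      exact ⟨x, hx, by linarith, by linarith⟩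
    · push Not at hx
      have h1 := add_sum_erase s d hy
      have h2 : 0 ≤ ∑ i ∈ s.erase y, d i :=
        sum_nonneg fun i hi => (hx i (mem_of_mem_erase hi)).le
      exact ⟨y, hy, by linarith, by linarith [hx y hy]⟩

open Finset in
/-- Under the same hypotheses, `s` can be enumerated so that all partial sums of `d` stay in the
interval. -/
lemma exists_enumeration_partial_sums_mem_Icc {ι : Type*} [DecidableEq ι] [Inhabited ι]
    {d : ι → ℝ} {L M : ℝ} (h0 : (0 : ℝ) ∈ Set.Icc L (L + 2 * M)) (m : ℕ) :
    ∀ s : Finset ι, s.card = m → (∀ i ∈ s, |d i| ≤ M) →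
      ∑ i ∈ s, d i ∈ Set.Icc L (L + 2 * M) →
      ∃ f : ℕ → ι, Set.InjOn f (Set.Iio m) ∧ Set.MapsTo f (Set.Iio m) s ∧
        ∀ k ≤ m, ∑ i ∈ range k, d (f i) ∈ Set.Icc L (L + 2 * M) := by
  induction m with
  | zero =>
    intro s _ _ _
    refine ⟨fun _ => default, by simp [Set.InjOn], by simp [Set.MapsTo], ?_⟩
    intro k hk
    simpa [Nat.le_zero.1 hk] using h0
  | succ m ih =>
    intro s hs hd hsum
    obtain ⟨x, hx, hxs⟩ :=
      exists_sum_erase_mem_Icc (card_pos.1 (by omega)) hd h0 hsum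
    obtain ⟨f, hinj, hmaps, hf⟩ := ih (s.erase x) (by rw [card_erase_of_mem hx]; omega)
      (fun i hi => hd i (mem_of_mem_erase hi)) hxs
    have hne : ∀ i < m, f i ∈ s ∧ f i ≠ x := fun i hi => by
      simpa using hmaps (Set.mem_Iio.2 hi)
    have hold : ∀ i < m, Function.update f m x i = f i := fun i hi =>
      Function.update_of_ne hi.ne _ _
    have hinj' : Set.InjOn (Function.update f m x) (Set.Iio (m + 1)) := by
      intro i hi j hj hij
      rw [Set.mem_Iio] at hi hj
      rcases Nat.lt_succ_iff_lt_or_eq.1 hi with hi | rfl <;>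
        rcases Nat.lt_succ_iff_lt_or_eq.1 hj with hj | rfl
      · rw [hold i hi, hold j hj] at hij
        exact hinj hi hj hij
      · rw [hold i hi, Function.update_self] at hij
        exact absurd hij (hne i hi).2
      · rw [hold j hj, Function.update_self] at hij
        exact absurd hij.symm (hne j hj).2
      · rfl
    have hmaps' : Set.MapsTo (Function.update f m x) (Set.Iio (m + 1)) s := by
      intro i hi
      rcases Nat.lt_succ_iff_lt_or_eq.1 hi with hi | rfl
      · rw [hold i hi]
        exact (hne i hi).1
      · simpa using hx
    refine ⟨Function.update f m x, hinj', hmaps', fun k hk => ?_⟩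
    rcases Nat.le_succ_iff.1 hk with hk | rfl
    · rw [sum_congr rfl fun i hi => by rw [hold i (by have := mem_range.1 hi; omega)]]
      exact hf k hk
    · have himage : (range (m + 1)).image (Function.update f m x) = s := by
        refine eq_of_subset_of_card_le ?_ ?_
        · intro y hy
          obtain ⟨i, hi, rfl⟩ := mem_image.1 hy
          exact hmaps' (by simpa using hi)
        · rw [card_image_of_injOn (by simpa using hinj'), card_range, hs]
      rw [← sum_image (f := d) (by simpa using hinj'), himage]
      exact hsum

open Finset in
/-- Reals `d 0, …, d (m - 1)` with `|d i| ≤ M` and `|∑ i, d i| ≤ 2 * M` can be permuted so that the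
sum of every block of consecutive terms is at most `2 * M` in absolute value. -/
lemma exists_perm_abs_block_sum_le {m : ℕ} {d : Fin m → ℝ} {M : ℝ} (hM : 0 ≤ M)
    (hd : ∀ i, |d i| ≤ M) (hsum : |∑ i, d i| ≤ 2 * M) :
    ∃ σ : Equiv.Perm (Fin m), ∀ p q : ℕ, 1 ≤ p → p < q → q ≤ m →
      |∑ j ∈ univ.filter (fun j : Fin m => p ≤ (j : ℕ) + 1 ∧ (j : ℕ) + 1 ≤ q), d (σ j)| ≤
        2 * M := by
  rcases Nat.eq_zero_or_pos m with rfl | hm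
  · exact ⟨1, fun p q _ _ _ => by omega⟩
  have : NeZero m := ⟨hm.ne'⟩
  have : Inhabited (Fin m) := ⟨0⟩
  obtain ⟨hl, hu⟩ := abs_le.1 hsum
  obtain ⟨L, h0, hL⟩ : ∃ L : ℝ, (0 : ℝ) ∈ Set.Icc L (L + 2 * M) ∧
      ∑ i, d i ∈ Set.Icc L (L + 2 * M) := by
    rcases le_total 0 (∑ i, d i) with h | h
    · exact ⟨0, ⟨by linarith, by linarith⟩, ⟨by linarith, by linarith⟩⟩
    · exact ⟨-(2 * M), ⟨by linarith, by linarith⟩, ⟨by linarith, by linarith⟩⟩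
  obtain ⟨f, hinj, -, hf⟩ := exists_enumeration_partial_sums_mem_Icc h0 m univ (by simp)
    (fun i _ => hd i) hL
  have hbij : Function.Bijective fun j : Fin m => f j :=
    Finite.injective_iff_bijective.1 fun i j hij => Fin.ext (hinj i.2 j.2 hij)
  refine ⟨Equiv.ofBijective _ hbij, fun p q hp hpq hq => ?_⟩
  have hblock : ∑ j ∈ univ.filter (fun j : Fin m => p ≤ (j : ℕ) + 1 ∧ (j : ℕ) + 1 ≤ q),
      d (Equiv.ofBijective _ hbij j) = ∑ i ∈ Ico (p - 1) q, d (f i) := by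
    refine sum_bij (fun j _ => (j : ℕ)) ?_ ?_ ?_ ?_
    · intro j hj
      simp only [mem_filter, mem_univ, true_and] at hj
      simp only [mem_Ico]
      omega
    · intro i _ j _ hij
      exact Fin.ext hij
    · intro i hi
      simp only [mem_Ico] at hi
      refine ⟨⟨i, by omega⟩, ?_, rfl⟩
      simp only [mem_filter, mem_univ, true_and]
      omega
    · intro j _
      rfl
  rw [hblock, sum_Ico_eq_sub _ (by omega), abs_le]
  obtain ⟨h1, h2⟩ := hf q hq
  obtain ⟨h3, h4⟩ := hf (p - 1) (by omega)
  constructor <;> linarith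

lemma intervalCount_add (n : ℕ) (χ : Fin n → Fin 2) {lo mid hi : ℕ} (h₁ : lo ≤ mid)
    (h₂ : mid ≤ hi) (i : Fin 2) :
    intervalCount n χ lo mid i + intervalCount n χ mid hi i = intervalCount n χ lo hi i := by
  unfold intervalCount
  rw [← Finset.card_union_of_disjoint]
  · congr 1
    ext t
    simp only [Finset.mem_union, Finset.mem_filter, Finset.mem_univ, true_and]
    constructor
    · rintro (⟨h, h', hc⟩ | ⟨h, h', hc⟩) <;> exact ⟨by omega, by omega, hc⟩
    · rintro ⟨h, h', hc⟩
      rcases lt_or_ge (t : ℕ) mid with ht | ht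
      · exact Or.inl ⟨h, ht, hc⟩
      · exact Or.inr ⟨ht, h', hc⟩
  · rw [Finset.disjoint_left]
    intro t ht ht'
    simp only [Finset.mem_filter, Finset.mem_univ, true_and] at ht ht'
    omega

lemma sum_intervalCount (n : ℕ) (χ : Fin n → Fin 2) {a : ℕ → ℕ} (ha : Monotone a) (i : Fin 2)
    (m : ℕ) :
    ∑ j ∈ Finset.range m, intervalCount n χ (a j) (a (j + 1)) i =
      intervalCount n χ (a 0) (a m) i := by
  induction m with
  | zero =>
    symm
    simp only [Finset.range_zero, Finset.sum_empty, intervalCount, Finset.card_eq_zero,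
      Finset.filter_eq_empty_iff]
    omega
  | succ m ih =>
    rw [Finset.sum_range_succ, ih, intervalCount_add n χ (ha m.zero_le) (ha m.le_succ)]

lemma intervalCount_le (n : ℕ) (χ : Fin n → Fin 2) (lo hi : ℕ) (i : Fin 2) :
    intervalCount n χ lo hi i ≤ hi - lo := by
  rw [← Nat.card_Ico]
  refine Finset.card_le_card_of_injOn (fun t => (t : ℕ)) ?_ (Fin.val_injective.injOn)
  intro t ht
  simp only [Finset.coe_filter, Finset.mem_univ, true_and, Set.mem_ofPred_eq] at ht
  simp only [Finset.coe_Ico, Set.mem_Ico]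
  omega

/-- Color counts with `1 - β ≤ x / y ≤ 1 + β` and `β ≤ 2 / ℓ` differ by at most `2 * (n / ℓ)`;
this includes `y = 0`, where `x / y = 0`. -/
lemma abs_sub_le_of_balanced {x y n ℓ β : ℝ} (hx : 0 ≤ x) (hy : 0 ≤ y) (hxn : x ≤ n) (hyn : y ≤ n)
    (hβ : β ≤ 2 / ℓ) (h₁ : 1 - β ≤ x / y) (h₂ : x / y ≤ 1 + β) :
    |x - y| ≤ 2 * (n / ℓ) := by
  have hn : 2 / ℓ * n = 2 * (n / ℓ) := by ring
  rw [← hn]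
  rcases hy.eq_or_lt with rfl | hy
  · rw [div_zero] at h₁
    rw [sub_zero, abs_of_nonneg hx]
    nlinarith
  · have hxy : x / y * y = x := div_mul_cancel₀ x hy.ne'
    have hβ0 : 0 ≤ β := by linarith
    have hbound : β * y ≤ 2 / ℓ * n := mul_le_mul hβ hyn hy.le (hβ0.trans hβ)
    rw [abs_le]
    constructor <;> nlinarith

/-- For every integer ℓ̂ ≥ 1 there is n₀ such that for every graph `H` on the ordered vertex
set `w₀,…,w_{n−1}` with `n ≥ n₀`, every β-balanced 2-coloring `χ` with `β ≤ 2/ℓ̂`, and every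
partition into intervals `I₁,…,I_ℓ̂` (given by the boundary function `a`, interval `j+1` being
`[a j, a (j+1))`) with `|I₁| ≤ … ≤ |I_ℓ̂| ≤ |I₁| + 1`, there is a permutation `σ` of `[ℓ̂]`
such that `|C₁(σ,a,b) − C₂(σ,a,b)| ≤ 2(n/ℓ̂ + 1)` for all `1 ≤ a < b ≤ ℓ̂`
(where `C_i(σ,a,b) = Σ_{j=a}^{b} C_i(I_{σ(j)})`, with intervals indexed from 1). -/
theorem balanced_segments :
    ∀ lh : ℕ, 1 ≤ lh → ∃ n₀ : ℕ, ∀ n : ℕ, n₀ ≤ n →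
      ∀ (H : SimpleGraph (Fin n)) (χ : Fin n → Fin 2) (β : ℝ),
        β ≤ 2 / (lh : ℝ) →
        -- χ is β-balanced: 1 − β ≤ C₁(W)/C₂(W) ≤ 1 + β
        (1 - β ≤ (intervalCount n χ 0 n 0 : ℝ) / (intervalCount n χ 0 n 1 : ℝ) ∧
          (intervalCount n χ 0 n 0 : ℝ) / (intervalCount n χ 0 n 1 : ℝ) ≤ 1 + β) →
        ∀ a : ℕ → ℕ, Monotone a → a 0 = 0 → a lh = n →
          -- the interval sizes are nondecreasing
          (∀ j k : ℕ, j ≤ k → k < lh → a (j + 1) - a j ≤ a (k + 1) - a k) →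
          -- the largest interval exceeds the smallest by at most 1
          (∀ j : ℕ, j < lh → a (j + 1) - a j ≤ (a 1 - a 0) + 1) →
          ∃ σ : Equiv.Perm (Fin lh),
            ∀ p q : ℕ, 1 ≤ p → p < q → q ≤ lh →
              |(∑ j ∈ Finset.univ.filter
                    (fun j : Fin lh => p ≤ (j : ℕ) + 1 ∧ (j : ℕ) + 1 ≤ q),
                  (intervalCount n χ (a ((σ j : ℕ))) (a ((σ j : ℕ) + 1)) 0 : ℝ)) -
                (∑ j ∈ Finset.univ.filter
                    (fun j : Fin lh => p ≤ (j : ℕ) + 1 ∧ (j : ℕ) + 1 ≤ q),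
                  (intervalCount n χ (a ((σ j : ℕ))) (a ((σ j : ℕ) + 1)) 1 : ℝ))| ≤
                2 * ((n : ℝ) / (lh : ℝ) + 1) := by
  intro lh hlh
  refine ⟨0, fun n _ H χ β hβ hbal a ha ha0 halh hmono hle => ?_⟩
  have hpos : (0 : ℝ) < lh := by exact_mod_cast hlh
  have hfirst : lh * (a 1 - a 0) ≤ n := by
    calc lh * (a 1 - a 0) = ∑ _j ∈ Finset.range lh, (a 1 - a 0) := by simp
      _ ≤ ∑ j ∈ Finset.range lh, (a (j + 1) - a j) :=
        Finset.sum_le_sum fun j hj => hmono 0 j j.zero_le (Finset.mem_range.1 hj)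
      _ = n := by rw [Finset.sum_range_tsub ha, halh, ha0, Nat.sub_zero]
  have hsize : ∀ j < lh, ((a (j + 1) - a j : ℕ) : ℝ) ≤ n / lh + 1 := by
    intro j hj
    have h1 : ((a (j + 1) - a j : ℕ) : ℝ) ≤ ((a 1 - a 0 : ℕ) : ℝ) + 1 := by
      exact_mod_cast hle j hj
    have h2 : ((a 1 - a 0 : ℕ) : ℝ) ≤ n / lh := by
      rw [le_div_iff₀ hpos, mul_comm]
      exact_mod_cast hfirst
    linarith
  have hcount : ∀ (lo hi : ℕ) (i : Fin 2), (intervalCount n χ lo hi i : ℝ) ≤ (hi - lo : ℕ) :=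
    fun lo hi i => by exact_mod_cast intervalCount_le n χ lo hi i
  have htotal : ∀ i : Fin 2, ∑ j : Fin lh, (intervalCount n χ (a j) (a (j + 1)) i : ℝ) =
      intervalCount n χ 0 n i := by
    intro i
    rw [Fin.sum_univ_eq_sum_range fun j => (intervalCount n χ (a j) (a (j + 1)) i : ℝ)]
    rw [← Nat.cast_sum, sum_intervalCount n χ ha i lh, ha0, halh]
  obtain ⟨σ, hσ⟩ := exists_perm_abs_block_sum_le (M := (n : ℝ) / lh + 1)
    (d := fun j : Fin lh => (intervalCount n χ (a j) (a (j + 1)) 0 : ℝ) -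
      intervalCount n χ (a j) (a (j + 1)) 1) (by positivity)
    (fun j => by
      refine (abs_sub_le_of_nonneg_of_le (Nat.cast_nonneg _) (hcount _ _ _) (Nat.cast_nonneg _)
        (hcount _ _ _)).trans (hsize j j.2))
    (by
      rw [Finset.sum_sub_distrib, htotal, htotal]
      have := abs_sub_le_of_balanced (Nat.cast_nonneg _) (Nat.cast_nonneg _) (hcount 0 n 0)
        (hcount 0 n 1) hβ hbal.1 hbal.2
      rw [Nat.sub_zero] at this
      linarith)
  refine ⟨σ, fun p q hp hpq hq => ?_⟩
  rw [← Finset.sum_sub_distrib]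
  exact hσ p q hp hpq hq
end
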